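/- Let d ≥ 3, let r = d − 2, and let Δ ⊆ ℝ^d be a d-dimensional Gorenstein polytope of index r. Then 24 = Σ_θ v(θ)·v(θ*) + (r(1−r)/2)·v(Δ), where the sum runs over all r-dimensional faces θ of Δ and θ* is the dual face of θ. -/

import Mathlib

open MeasureTheory Filter Pointwise

noncomputable section

/-- The canonical embedding of a lattice point of `ℤ^d` into `ℝ^d`. -/
def coeLat {d : ℕ} (n : Fin d → ℤ) : Fin d → ℝ := fun i => (n i : ℝ)

/-- The set of lattice points lying in a subset `S ⊆ ℝ^d`. -/
def latticePoints {d : ℕ} (S : Set (Fin d → ℝ)) : Set (Fin d → ℤ) :=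
  {n | coeLat n ∈ S}

/-- A lattice polytope: the convex hull of finitely many points of `ℤ^d`. -/
def IsLatticePolytope {d : ℕ} (P : Set (Fin d → ℝ)) : Prop :=
  ∃ V : Finset (Fin d → ℤ), P = convexHull ℝ (coeLat '' (V : Set (Fin d → ℤ)))

/-- The dual (polar) body `P* = {y | ⟨y,x⟩ ≥ -1 ∀ x ∈ P}`. -/
def polarDual {d : ℕ} (P : Set (Fin d → ℝ)) : Set (Fin d → ℝ) :=
  {y | ∀ x ∈ P, -1 ≤ ∑ i, y i * x i}

/-- Dimension of a subset of `ℝ^d`: the dimension of its affine span. -/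
def dimSet {d : ℕ} (S : Set (Fin d → ℝ)) : ℕ :=
  Module.finrank ℝ (affineSpan ℝ S).direction

/-- A reflexive polytope: a lattice polytope containing the origin in its interior
whose dual is again a lattice polytope. -/
def IsReflexive {d : ℕ} (P : Set (Fin d → ℝ)) : Prop :=
  IsLatticePolytope P ∧ (0 : Fin d → ℝ) ∈ interior P ∧ IsLatticePolytope (polarDual P)

/-- A (nonempty, exposed) face of dimension `k` of a polytope `P`. -/
def IsFaceOfDim {d : ℕ} (P : Set (Fin d → ℝ)) (k : ℕ) (θ : Set (Fin d → ℝ)) : Prop :=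
  IsExposed ℝ P θ ∧ θ.Nonempty ∧ dimSet θ = k

/-- The dual face `θ* = {y ∈ P* | ⟨y,x⟩ = -1 ∀ x ∈ θ}` of a face `θ` of `P`. -/
def dualFace {d : ℕ} (P θ : Set (Fin d → ℝ)) : Set (Fin d → ℝ) :=
  {y ∈ polarDual P | ∀ x ∈ θ, ∑ i, y i * x i = -1}

/-- The normalized volume of a `k`-dimensional lattice polytope `θ ⊆ ℝ^d`:
`lim_{m → ∞} k! ⬝ |mθ ∩ ℤ^d| / m^k`. -/
def normVol {d : ℕ} (k : ℕ) (θ : Set (Fin d → ℝ)) : ℝ :=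
  limUnder atTop
    (fun m : ℕ => (Nat.factorial k : ℝ) * (latticePoints ((m : ℝ) • θ)).ncard / (m : ℝ) ^ k)

/-! ### Half-open decomposition of simplicial cones -/

lemma ev_pos (a b : ℝ) (h : 0 < a ∨ (a = 0 ∧ 0 < b)) :
    ∀ᶠ δ in nhdsWithin (0:ℝ) (Set.Ioi 0), 0 < a + δ * b := by
  rcases h with h | ⟨rfl, hb⟩
  · have : Tendsto (fun δ : ℝ => a + δ * b) (nhdsWithin (0:ℝ) (Set.Ioi 0)) (nhds (a + 0 * b)) := by
      apply Tendsto.mono_left _ nhdsWithin_le_nhds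
      exact (continuous_const.add (continuous_id.mul continuous_const)).tendsto 0
    exact this.eventually (lt_mem_nhds (by simpa using h))
  · filter_upwards [self_mem_nhdsWithin] with δ hδ
    have : (0:ℝ) < δ := hδ
    simpa using mul_pos this hb

lemma ev_neg (a b : ℝ) (h : a < 0 ∨ (a = 0 ∧ b < 0)) :
    ∀ᶠ δ in nhdsWithin (0:ℝ) (Set.Ioi 0), a + δ * b < 0 := by
  have := ev_pos (-a) (-b) (by rcases h with h | ⟨h, h'⟩ <;> [left; right] <;> simp_all)
  filter_upwards [this] with δ hδ
  nlinarith

lemma ev_ne (a b : ℝ) (h : a ≠ 0 ∨ b ≠ 0) :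
    ∀ᶠ δ in nhdsWithin (0:ℝ) (Set.Ioi 0), a + δ * b ≠ 0 := by
  rcases lt_trichotomy a 0 with ha | ha | ha
  · exact (ev_neg a b (Or.inl ha)).mono fun _ h => h.ne
  · have hb : b ≠ 0 := by tauto
    rcases lt_or_gt_of_ne hb with hb | hb
    · exact (ev_neg a b (Or.inr ⟨ha, hb⟩)).mono fun _ h => h.ne
    · exact (ev_pos a b (Or.inr ⟨ha, hb⟩)).mono fun _ h => h.ne'
  · exact (ev_pos a b (Or.inl ha)).mono fun _ h => h.ne'

lemma exists_generic {ι : Type*} [Fintype ι] (S : Finset ((ι → ℝ) →ₗ[ℝ] ℝ))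
    (hS : ∀ φ ∈ S, φ ≠ 0) : ∃ t : ι → ℝ, (∀ i, 0 < t i) ∧ ∀ φ ∈ S, φ t ≠ 0 := by
  classical
  induction S using Finset.induction_on with
  | empty => exact ⟨fun _ => 1, fun _ => one_pos, by simp⟩
  | insert φ S hφ ih =>
    obtain ⟨t, ht, htS⟩ := ih fun ψ hψ => hS ψ (Finset.mem_insert_of_mem hψ)
    have hne := hS φ (Finset.mem_insert_self _ _)
    obtain ⟨e, he⟩ : ∃ e, φ e ≠ 0 := by
      by_contra hcon
      push Not at hcon
      exact hne (LinearMap.ext hcon)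
    have h1 : ∀ᶠ δ in nhdsWithin (0:ℝ) (Set.Ioi 0), ∀ i, 0 < t i + δ * e i :=
      eventually_all.2 fun i => ev_pos _ _ (Or.inl (ht i))
    have h2 : ∀ᶠ δ in nhdsWithin (0:ℝ) (Set.Ioi 0), ∀ ψ ∈ S, ψ t + δ * ψ e ≠ 0 :=
      (Finset.eventually_all S).2 fun ψ hψ => ev_ne _ _ (Or.inl (htS ψ hψ))
    have h3 := ev_ne (φ t) (φ e) (Or.inr he)
    obtain ⟨δ, h1, h2, h3⟩ := (h1.and (h2.and h3)).exists
    refine ⟨t + δ • e, fun i => by simpa using h1 i, fun ψ hψ => ?_⟩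
    rw [map_add, map_smul, smul_eq_mul]
    rcases Finset.mem_insert.1 hψ with rfl | hψ
    · exact h3
    · exact h2 ψ hψ

section cone
variable {ι : Type*} [Fintype ι] [DecidableEq ι] {E : Type*} [AddCommGroup E] [Module ℝ E]

/-- The cone generated by the family `v`. -/
def coneOf (v : ι → E) : Set E := {x | ∃ l : ι → ℝ, (∀ i, 0 ≤ l i) ∧ ∑ i, l i • v i = x}

/-- `c` is the coordinate map of the basis indexed by `σ`. -/
def IsCoord (v : ι → E) (σ : Finset ι) (c : E →ₗ[ℝ] (ι → ℝ)) : Prop :=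
  (∀ x i, i ∉ σ → c x i = 0) ∧ (∀ x, ∑ i, c x i • v i = x) ∧
    (∀ i ∈ σ, c (v i) = Pi.single i 1)

/-- `σ` indexes a basis. -/
def IsB (v : ι → E) (σ : Finset ι) : Prop := ∃ c, IsCoord v σ c

open Classical in
/-- The coordinate map. -/
def co (v : ι → E) (σ : Finset ι) : E →ₗ[ℝ] (ι → ℝ) :=
  if h : IsB v σ then h.choose else 0

lemma IsB.isCoord {v : ι → E} {σ : Finset ι} (h : IsB v σ) : IsCoord v σ (co v σ) := by
  rw [co, dif_pos h]; exact h.choose_spec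

lemma IsB.zero {v : ι → E} {σ : Finset ι} (h : IsB v σ) (x : E) {i : ι} (hi : i ∉ σ) :
    co v σ x i = 0 := h.isCoord.1 x i hi

lemma IsB.sum {v : ι → E} {σ : Finset ι} (h : IsB v σ) (x : E) :
    ∑ i, co v σ x i • v i = x := h.isCoord.2.1 x

lemma IsB.co_sum {v : ι → E} {σ : Finset ι} (h : IsB v σ) (l : ι → ℝ) (hl : ∀ i, i ∉ σ → l i = 0) :
    co v σ (∑ i, l i • v i) = l := by
  rw [map_sum]
  have : ∀ i, co v σ (l i • v i) = Pi.single i (l i) := by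
    intro i
    by_cases hi : i ∈ σ
    · rw [map_smul, h.isCoord.2.2 i hi]
      ext j
      by_cases hij : j = i
      · subst hij; simp
      · simp [hij]
    · simp [hl i hi]
  simp_rw [this]
  exact Finset.univ_sum_single l

lemma isB_of_linearIndepOn (v : ι → E) (σ : Finset ι) (h : LinearIndepOn ℝ v (σ : Set ι))
    (hs : ∀ x, x ∈ Submodule.span ℝ (v '' (σ : Set ι))) : IsB v σ := by
  have h' : LinearIndependent ℝ (fun i : σ => v i) := h
  have hsp : ⊤ ≤ Submodule.span ℝ (Set.range (fun i : σ => v i)) := by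
    intro x _
    have := hs x
    convert this using 2
    ext y; simp
  let b := Module.Basis.mk h' hsp
  let c : E →ₗ[ℝ] (ι → ℝ) := LinearMap.pi fun i =>
    if hi : i ∈ σ then b.coord ⟨i, hi⟩ else 0
  refine ⟨c, ?_, ?_, ?_⟩
  · intro x i hi; simp [c, hi]
  · intro x
    have h1 : ∑ i ∈ σ, c x i • v i = ∑ i, c x i • v i := by
      apply Finset.sum_subset (Finset.subset_univ _)
      intro i _ hi; simp [c, hi]
    rw [← h1, ← Finset.sum_coe_sort]
    conv_rhs => rw [← b.sum_repr x]
    apply Finset.sum_congr rfl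
    intro i _
    simp [c, b]
  · intro i hi
    ext j
    by_cases hj : j ∈ σ
    · have : b.repr (v i) = Finsupp.single ⟨i, hi⟩ 1 := by
        have := b.repr_self ⟨i, hi⟩
        rwa [Module.Basis.mk_apply] at this
      simp only [c, LinearMap.pi_apply, hj, dif_pos, Module.Basis.coord_apply, this]
      by_cases hij : j = i
      · subst hij; simp
      · rw [Finsupp.single_apply, if_neg (by simpa using Ne.symm hij), Pi.single_apply, if_neg hij]
    · have : j ≠ i := by rintro rfl; exact hj hi
      simp [c, hj, this]

lemma exists_isB_extend (v : ι → E) (hv : ∀ x, x ∈ Submodule.span ℝ (Set.range v))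
    (τ : Set ι) (hτ : LinearIndepOn ℝ v τ) : ∃ σ : Finset ι, τ ⊆ σ ∧ IsB v σ := by
  classical
  obtain ⟨b, -, hb1, hb2, hb3⟩ := exists_linearIndepOn_extension hτ (Set.subset_univ τ)
  refine ⟨b.toFinset, by simpa using hb1, isB_of_linearIndepOn v _ (by simpa using hb3) ?_⟩
  intro x
  rw [Set.image_univ] at hb2
  simpa using (Submodule.span_le.2 hb2) (hv x)

lemma IsB.card {v : ι → E} {σ : Finset ι} (h : IsB v σ) : σ.card = Module.finrank ℝ E := by
  let e : E ≃ₗ[ℝ] (σ → ℝ) :=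
    { toFun := fun x i => co v σ x i
      map_add' := by intro x y; ext i; simp
      map_smul' := by intro x y; ext i; simp
      invFun := fun l => ∑ i, (if hi : i ∈ σ then l ⟨i, hi⟩ else 0) • v i
      left_inv := by
        intro x
        conv_rhs => rw [← h.sum x]
        apply Finset.sum_congr rfl
        intro i _
        by_cases hi : i ∈ σ
        · simp [hi]
        · simp [hi, h.zero x hi]
      right_inv := by
        intro l
        ext i
        simp only
        rw [h.co_sum]
        · simp
        · intro i hi; simp [hi] }
  rw [e.finrank_eq]; simp

/-- The linear functional with value `w i` at `v i`, `i ∈ σ`. -/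
def lw (v : ι → E) (w : ι → ℝ) (σ : Finset ι) (x : E) : ℝ := ∑ i, co v σ x i * w i

/-- Genericity of a weight. -/
def GenW (v : ι → E) (w : ι → ℝ) : Prop :=
  ∀ σ, IsB v σ → ∀ j, j ∉ σ → lw v w σ (v j) ≠ w j

/-- Genericity of a direction. -/
def GenQ (v : ι → E) (q : E) : Prop := ∀ σ, IsB v σ → ∀ i ∈ σ, co v σ q i ≠ 0

lemma exists_genW (v : ι → E) : ∃ w, GenW v w := by
  classical
  let φ : Finset ι × ι → ((ι → ℝ) →ₗ[ℝ] ℝ) := fun p =>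
    ∑ i, (co v p.1 (v p.2) i) • LinearMap.proj i - LinearMap.proj p.2
  obtain ⟨w, -, hw⟩ := exists_generic
    ((Finset.univ.filter fun p : Finset ι × ι => IsB v p.1 ∧ p.2 ∉ p.1).image φ) (by
      intro ψ hψ
      obtain ⟨⟨σ, j⟩, hp, rfl⟩ := Finset.mem_image.1 hψ
      obtain ⟨h1, h2⟩ := (Finset.mem_filter.1 hp).2
      intro h0
      have := congrArg (fun f => f (Pi.single j 1)) h0
      simp [φ, Pi.single_apply, h1.zero _ h2] at this)
  refine ⟨w, fun σ hσ j hj h => ?_⟩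
  have := hw (φ (σ, j)) (Finset.mem_image_of_mem _ (by simp [hσ, hj]))
  apply this
  simp only [φ, LinearMap.sub_apply, LinearMap.sum_apply, LinearMap.smul_apply,
    LinearMap.proj_apply, smul_eq_mul]
  rw [lw] at h
  linarith

lemma exists_genQ (v : ι → E) (hv : ∀ x, x ∈ Submodule.span ℝ (Set.range v)) :
    ∃ t : ι → ℝ, (∀ i, 0 < t i) ∧ GenQ v (∑ i, t i • v i) := by
  classical
  let φ : Finset ι × ι → ((ι → ℝ) →ₗ[ℝ] ℝ) := fun p =>
    (LinearMap.proj p.2) ∘ₗ (co v p.1) ∘ₗ (Fintype.linearCombination ℝ v)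
  obtain ⟨t, ht, hw⟩ := exists_generic
    ((Finset.univ.filter fun p : Finset ι × ι => IsB v p.1 ∧ p.2 ∈ p.1).image φ) (by
      intro ψ hψ
      obtain ⟨⟨σ, j⟩, hp, rfl⟩ := Finset.mem_image.1 hψ
      obtain ⟨h1, h2⟩ := (Finset.mem_filter.1 hp).2
      intro h0
      have := congrArg (fun f => f (Pi.single j 1)) h0
      simp [φ, h1.isCoord.2.2 _ h2] at this)
  refine ⟨t, ht, fun σ hσ i hi h => ?_⟩
  have := hw (φ (σ, i)) (Finset.mem_image_of_mem _ (by simp [hσ, hi]))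
  apply this
  simpa [φ, Fintype.linearCombination_apply] using h

lemma GenQ.neg {v : ι → E} {q : E} (h : GenQ v q) : GenQ v (-q) := by
  intro σ hσ i hi
  simpa using h σ hσ i hi

/-- the cells of the regular triangulation -/
def IsCell (v : ι → E) (w : ι → ℝ) (σ : Finset ι) : Prop :=
  IsB v σ ∧ ∀ j, j ∉ σ → lw v w σ (v j) < w j

/-- `x` belongs to the half open cone -/
def Owns (v : ι → E) (q : E) (σ : Finset ι) (x : E) : Prop :=
  ∀ i ∈ σ, 0 < co v σ x i ∨ (co v σ x i = 0 ∧ 0 < co v σ q i)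

lemma Owns.ev {v : ι → E} {q : E} {σ : Finset ι} {x : E} (h : Owns v q σ x) :
    ∀ᶠ ε in nhdsWithin (0:ℝ) (Set.Ioi 0), ∀ i ∈ σ, 0 < co v σ (x + ε • q) i := by
  rw [Finset.eventually_all]
  intro i hi
  filter_upwards [ev_pos _ _ (h i hi)] with ε hε
  simpa using hε

lemma owns_of_ev {v : ι → E} {q : E} {σ : Finset ι} {x : E}
    (h : ∃ᶠ ε in nhdsWithin (0:ℝ) (Set.Ioi 0), ∀ i ∈ σ, 0 < co v σ (x + ε • q) i) :
    Owns v q σ x := by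
  intro i hi
  by_contra hcon
  push Not at hcon
  rcases hcon.1.lt_or_eq with h1 | h1
  · obtain ⟨ε, h2, h3⟩ := (h.and_eventually (ev_neg _ (co v σ q i) (Or.inl h1))).exists
    have := h2 i hi
    simp at this; linarith
  · have h4 := hcon.2 h1
    obtain ⟨ε, h2, h3⟩ := (h.and_eventually self_mem_nhdsWithin).exists
    have := h2 i hi
    have h3 : (0:ℝ) < ε := h3
    simp [h1] at this
    nlinarith

lemma Owns.nonneg {v : ι → E} {q : E} {σ : Finset ι} {x : E} (h : Owns v q σ x) :
    ∀ i ∈ σ, 0 ≤ co v σ x i := by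
  intro i hi
  rcases h i hi with h | h
  · exact h.le
  · exact h.1.ge

lemma mem_cone_of_co {v : ι → E} {σ : Finset ι} (hσ : IsB v σ) {x : E}
    (h : ∀ i ∈ σ, 0 ≤ co v σ x i) : x ∈ coneOf v := by
  refine ⟨co v σ x, fun i => ?_, hσ.sum x⟩
  by_cases hi : i ∈ σ
  · exact h i hi
  · exact (hσ.zero x hi).ge

lemma lw_sum {v : ι → E} {w : ι → ℝ} {σ : Finset ι} (l : ι → ℝ) :
    lw v w σ (∑ i, l i • v i) = ∑ i, l i * lw v w σ (v i) := by
  simp only [lw, map_sum, map_smul, Finset.sum_apply, Pi.smul_apply, smul_eq_mul,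
    Finset.sum_mul, Finset.mul_sum]
  rw [Finset.sum_comm]
  apply Finset.sum_congr rfl; intro i _
  apply Finset.sum_congr rfl; intro j _
  ring

lemma lw_self {v : ι → E} {w : ι → ℝ} {σ : Finset ι} (hσ : IsB v σ) {i : ι} (hi : i ∈ σ) :
    lw v w σ (v i) = w i := by
  simp [lw, hσ.isCoord.2.2 i hi, Pi.single_apply]

lemma cell_unique {v : ι → E} {w : ι → ℝ} {σ τ : Finset ι} (hσ : IsCell v w σ)
    (hτ : IsCell v w τ) {y : E} (h1 : ∀ i ∈ σ, 0 < co v σ y i) (h2 : ∀ i ∈ τ, 0 < co v τ y i) :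
    σ = τ := by
  have key : ∀ {σ τ : Finset ι}, IsCell v w σ → IsCell v w τ → (∀ i ∈ τ, 0 < co v τ y i) →
      lw v w σ y ≤ lw v w τ y ∧ (lw v w σ y = lw v w τ y → τ ⊆ σ) := by
    intro σ τ hσ hτ h2
    have e1 : lw v w σ y = ∑ i, co v τ y i * lw v w σ (v i) := by
      conv_lhs => rw [← hτ.1.sum y]
      rw [lw_sum]
    have hle : ∀ i ∈ Finset.univ, co v τ y i * lw v w σ (v i) ≤ co v τ y i * w i := by
      intro i _
      by_cases hi : i ∈ τ
      · apply mul_le_mul_of_nonneg_left _ (h2 i hi).le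
        by_cases hs : i ∈ σ
        · exact (lw_self hσ.1 hs).le
        · exact (hσ.2 i hs).le
      · simp [hτ.1.zero y hi]
    refine ⟨by rw [e1]; exact Finset.sum_le_sum hle, fun heq i hi => ?_⟩
    by_contra hs
    have : ∑ i, co v τ y i * lw v w σ (v i) < ∑ i, co v τ y i * w i :=
      Finset.sum_lt_sum hle ⟨i, Finset.mem_univ _, mul_lt_mul_of_pos_left (hσ.2 i hs) (h2 i hi)⟩
    rw [← e1, heq] at this
    exact lt_irrefl _ this
  have k1 := key hσ hτ h2
  have k2 := key hτ hσ h1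
  have e := le_antisymm k1.1 k2.1
  exact Finset.Subset.antisymm (k2.2 e.symm) (k1.2 e)

lemma exists_min {v : ι → E} (w : ι → ℝ) (deg : E →ₗ[ℝ] ℝ) (hdeg : ∀ i, deg (v i) = 1) {y : E}
    (hy : y ∈ coneOf v) : ∃ l : ι → ℝ, (∀ i, 0 ≤ l i) ∧ ∑ i, l i • v i = y ∧
      ∀ l' : ι → ℝ, (∀ i, 0 ≤ l' i) → ∑ i, l' i • v i = y → ∑ i, l i * w i ≤ ∑ i, l' i * w i := by
  let S : Set (ι → ℝ) := {l | (∀ i, 0 ≤ l i) ∧ ∑ i, l i • v i = y}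
  have hsub : S ⊆ Set.Icc 0 (fun _ => deg y) := by
    rintro l ⟨h0, h1⟩
    refine ⟨h0, fun i => ?_⟩
    rw [← h1, map_sum]
    simp only [map_smul, hdeg, smul_eq_mul, mul_one]
    exact Finset.single_le_sum (fun j _ => h0 j) (Finset.mem_univ i)
  have hclosed : IsClosed S := by
    have e : S = {l | ∀ i, 0 ≤ l i} ∩ (Fintype.linearCombination ℝ v) ⁻¹' {y} := by
      ext l; simp [S, Fintype.linearCombination_apply]
    rw [e]
    apply IsClosed.inter
    · simp only [Set.ofPred_forall]
      exact isClosed_iInter fun i => isClosed_le continuous_const (continuous_apply i)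
    · obtain ⟨l0, h0, h1⟩ := hy
      have : (Fintype.linearCombination ℝ v) ⁻¹' {y} =
          (fun l => l - l0) ⁻¹' ((LinearMap.ker (Fintype.linearCombination ℝ v) :
            Submodule ℝ (ι → ℝ)) : Set (ι → ℝ)) := by
        ext l
        simp [Fintype.linearCombination_apply, sub_smul, h1, sub_eq_zero]
      rw [this]
      exact (Submodule.closed_of_finiteDimensional _).preimage (continuous_id.sub continuous_const)
  have hcomp : IsCompact S := isCompact_Icc.of_isClosed_subset hclosed hsub
  have hne : S.Nonempty := by
    obtain ⟨l0, h0, h1⟩ := hy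
    exact ⟨l0, h0, h1⟩
  have hcont : Continuous (fun l : ι → ℝ => ∑ i, l i * w i) := by fun_prop
  obtain ⟨l, hl, hmin⟩ := hcomp.exists_isMinOn hne hcont.continuousOn
  exact ⟨l, hl.1, hl.2, fun l' h0 h1 => hmin (show l' ∈ S from ⟨h0, h1⟩)⟩

lemma exists_cell {v : ι → E} (hv : ∀ x, x ∈ Submodule.span ℝ (Set.range v)) {w : ι → ℝ}
    (hw : GenW v w) (deg : E →ₗ[ℝ] ℝ) (hdeg : ∀ i, deg (v i) = 1) {y : E}
    (hy : y ∈ coneOf v) (hgen : ∀ σ, IsB v σ → ∀ i ∈ σ, co v σ y i ≠ 0) :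
    ∃ σ, IsCell v w σ ∧ ∀ i ∈ σ, 0 < co v σ y i := by
  classical
  obtain ⟨l, hl0, hly, hmin⟩ := exists_min w deg hdeg hy
  have move : ∀ μ : ι → ℝ, ∑ i, μ i • v i = 0 → (∀ i, l i = 0 → 0 ≤ μ i) →
      0 ≤ ∑ i, μ i * w i := by
    intro μ hμ hμ0
    have h1 : ∀ᶠ δ in nhdsWithin (0:ℝ) (Set.Ioi 0), ∀ i, 0 ≤ l i + δ * μ i := by
      rw [eventually_all]
      intro i
      rcases (hl0 i).lt_or_eq with h | h
      · exact (ev_pos _ _ (Or.inl h)).mono fun _ h => h.le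
      · filter_upwards [self_mem_nhdsWithin] with δ hδ
        have hδ : (0:ℝ) < δ := hδ
        rw [← h]
        have := mul_nonneg hδ.le (hμ0 i h.symm)
        linarith
    obtain ⟨δ, h1, h2⟩ := (h1.and self_mem_nhdsWithin).exists
    have h2 : (0:ℝ) < δ := h2
    have := hmin (fun i => l i + δ * μ i) h1 (by
      simp only [add_smul, mul_smul, Finset.sum_add_distrib, ← Finset.smul_sum, hly, hμ]; simp)
    simp only [add_mul, Finset.sum_add_distrib, mul_assoc, ← Finset.mul_sum] at this
    by_contra hcon
    nlinarith
  have dir : ∀ σ, IsB v σ → ∀ j, ∑ i, (Pi.single j (1:ℝ) - co v σ (v j) : ι → ℝ) i • v i = 0 := by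
    intro σ hσ j
    simp only [Pi.sub_apply, sub_smul, Finset.sum_sub_distrib, hσ.sum]
    simp [Pi.single_apply]
  have dirw : ∀ σ j, ∑ i, (Pi.single j (1:ℝ) - co v σ (v j) : ι → ℝ) i * w i
      = w j - lw v w σ (v j) := by
    intro σ j
    simp only [Pi.sub_apply, sub_mul, Finset.sum_sub_distrib, lw]
    simp [Pi.single_apply]
  -- the support is linearly independent
  obtain ⟨τ, hτs, -, hτspan, hτ⟩ := exists_linearIndepOn_extension
    (K := ℝ) (v := v) (s := ∅) (t := {i | l i ≠ 0}) (linearIndepOn_empty ℝ v) (Set.empty_subset _)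
  obtain ⟨σ, hτσ, hσ⟩ := exists_isB_extend v hv τ hτ
  have hsupp : ∀ i, l i ≠ 0 → i ∈ τ := by
    intro j hj
    by_contra hjτ
    have hvj : v j ∈ Submodule.span ℝ (v '' τ) := hτspan ⟨j, hj, rfl⟩
    have hsup : ∀ i, i ∉ τ → co v σ (v j) i = 0 := by
      intro i hi
      have : ∀ x ∈ Submodule.span ℝ (v '' τ), co v σ x i = 0 := by
        intro x hx
        induction hx using Submodule.span_induction with
        | mem x hx =>
          obtain ⟨k, hk, rfl⟩ := hx
          rw [hσ.isCoord.2.2 k (by simpa using hτσ hk)]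
          have : i ≠ k := by rintro rfl; exact hi hk
          simp [this]
        | zero => simp
        | add x y _ _ hx hy => simp [hx, hy]
        | smul a x _ hx => simp [hx]
      exact this _ hvj
    have hjσ : j ∉ σ := by
      intro hjσ
      have h1 := hsup j hjτ
      rw [hσ.isCoord.2.2 j hjσ] at h1
      simp at h1
    have hz : ∀ i, l i = 0 → (Pi.single j (1:ℝ) - co v σ (v j) : ι → ℝ) i = 0 := by
      intro i hi
      have h1 : i ≠ j := by rintro rfl; exact hj hi
      have h2 : i ∉ τ := fun h => hτs h hi
      simp [h1, hsup i h2]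
    have m1 := move _ (dir σ hσ j) (fun i hi => (hz i hi).ge)
    have m2 := move (-(Pi.single j (1:ℝ) - co v σ (v j) : ι → ℝ))
      (by simp only [Pi.neg_apply, neg_smul, Finset.sum_neg_distrib, dir σ hσ j, neg_zero])
      (fun i hi => by rw [Pi.neg_apply, hz i hi, neg_zero])
    simp only [Pi.neg_apply, neg_mul, Finset.sum_neg_distrib] at m2
    rw [dirw] at m1 m2
    exact hw σ hσ j hjσ (by linarith)
  have hco : co v σ y = l := by
    rw [← hly]
    apply hσ.co_sum
    intro i hi
    by_contra h
    exact hi (by simpa using hτσ (hsupp i h))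
  have hpos : ∀ i ∈ σ, 0 < co v σ y i := by
    intro i hi
    have := hgen σ hσ i hi
    rw [hco] at this ⊢
    exact lt_of_le_of_ne (hl0 i) this.symm
  refine ⟨σ, ⟨hσ, fun j hj => ?_⟩, hpos⟩
  have m1 := move _ (dir σ hσ j) (fun i hi => by
    have his : i ∉ σ := fun h => by
      have := hpos i h
      rw [hco, hi] at this
      exact lt_irrefl _ this
    rw [Pi.sub_apply, hσ.zero _ his, Pi.single_apply]
    split_ifs <;> norm_num)
  rw [dirw] at m1
  exact lt_of_le_of_ne (by linarith) (hw σ hσ j hj)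

lemma exists_owns {v : ι → E} (hv : ∀ x, x ∈ Submodule.span ℝ (Set.range v)) {w : ι → ℝ}
    (hw : GenW v w) (deg : E →ₗ[ℝ] ℝ) (hdeg : ∀ i, deg (v i) = 1) {q : E} (hq : GenQ v q) {x : E}
    (hx : ∃ᶠ ε in nhdsWithin (0:ℝ) (Set.Ioi 0), x + ε • q ∈ coneOf v) :
    ∃ σ, IsCell v w σ ∧ Owns v q σ x := by
  classical
  have h1 : ∀ᶠ ε in nhdsWithin (0:ℝ) (Set.Ioi 0), ∀ σ, IsB v σ → ∀ i ∈ σ,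
      co v σ (x + ε • q) i ≠ 0 := by
    rw [eventually_all]
    intro σ
    by_cases hσ : IsB v σ
    · have : ∀ᶠ ε in nhdsWithin (0:ℝ) (Set.Ioi 0), ∀ i ∈ σ, co v σ (x + ε • q) i ≠ 0 := by
        rw [Finset.eventually_all]
        intro i hi
        filter_upwards [ev_ne (co v σ x i) _ (Or.inr (hq σ hσ i hi))] with ε hε
        simpa using hε
      exact this.mono fun _ h _ => h
    · exact Eventually.of_forall fun _ h => absurd h hσ
  have h2 : ∃ᶠ ε in nhdsWithin (0:ℝ) (Set.Ioi 0), ∃ σ, IsCell v w σ ∧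
      ∀ i ∈ σ, 0 < co v σ (x + ε • q) i :=
    (hx.and_eventually h1).mono fun ε h => exists_cell hv hw deg hdeg h.1 h.2
  by_contra hcon
  push Not at hcon
  have h3 : ∀ᶠ ε in nhdsWithin (0:ℝ) (Set.Ioi 0), ∀ σ, ¬ (IsCell v w σ ∧
      ∀ i ∈ σ, 0 < co v σ (x + ε • q) i) := by
    rw [eventually_all]
    intro σ
    by_contra hf
    have hf : ∃ᶠ ε in nhdsWithin (0:ℝ) (Set.Ioi 0), (IsCell v w σ ∧
      ∀ i ∈ σ, 0 < co v σ (x + ε • q) i) := by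
      exact (Filter.not_eventually.1 hf).mono fun _ h => not_not.1 h
    obtain ⟨ε, hε⟩ := hf.exists
    exact hcon σ hε.1 (owns_of_ev (hf.mono fun _ h => h.2))
  obtain ⟨ε, ⟨σ, hσ⟩, h4⟩ := (h2.and_eventually h3).exists
  exact h4 σ hσ

lemma owns_unique {v : ι → E} {w : ι → ℝ} {q x : E} {σ τ : Finset ι}
    (hσ : IsCell v w σ) (hτ : IsCell v w τ) (h1 : Owns v q σ x) (h2 : Owns v q τ x) : σ = τ := by
  obtain ⟨ε, h3, h4⟩ := (h1.ev.and h2.ev).exists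
  exact cell_unique hσ hτ h3 h4

end cone

section count
variable {ι : Type*} [Fintype ι] [DecidableEq ι] {E : Type*} [AddCommGroup E] [Module ℝ E]

/-- Lattice points of degree `k` in a half open cone. -/
def ownSet (v : ι → E) (Λ : AddSubgroup E) (deg : E →ₗ[ℝ] ℝ) (q : E) (σ : Finset ι) (k : ℕ) :
    Set E := {x | x ∈ Λ ∧ Owns v q σ x ∧ deg x = k}

/-- Lattice points of degree `k` in a half open parallelepiped. -/
def parSet (v : ι → E) (Λ : AddSubgroup E) (deg : E →ₗ[ℝ] ℝ) (q : E) (σ : Finset ι) (k : ℕ) :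
    Set E := {x | x ∈ Λ ∧ (∀ i ∈ σ, (0 < co v σ q i → 0 ≤ co v σ x i ∧ co v σ x i < 1) ∧
      (co v σ q i < 0 → 0 < co v σ x i ∧ co v σ x i ≤ 1)) ∧ deg x = k}

/-- Lattice points of degree `k` in the cone. -/
def coneSet (v : ι → E) (Λ : AddSubgroup E) (deg : E →ₗ[ℝ] ℝ) (k : ℕ) :
    Set E := {x | x ∈ Λ ∧ x ∈ coneOf v ∧ deg x = k}

variable {v : ι → E} {Λ : AddSubgroup E} {deg : E →ₗ[ℝ] ℝ} {q : E} {σ : Finset ι}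

lemma deg_eq (hdeg : ∀ i, deg (v i) = 1) (hσ : IsB v σ) (x : E) :
    deg x = ∑ i, co v σ x i := by
  conv_lhs => rw [← hσ.sum x]
  simp [map_sum, hdeg]

lemma ownSet_sub (hσ : IsB v σ) (k : ℕ) : ownSet v Λ deg q σ k ⊆ coneSet v Λ deg k := by
  rintro x ⟨h1, h2, h3⟩
  exact ⟨h1, mem_cone_of_co hσ h2.nonneg, h3⟩

lemma parSet_sub (hσ : IsB v σ) (hq : GenQ v q) (k : ℕ) :
    parSet v Λ deg q σ k ⊆ ownSet v Λ deg q σ k := by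
  rintro x ⟨h1, h2, h3⟩
  refine ⟨h1, fun i hi => ?_, h3⟩
  rcases lt_or_gt_of_ne (hq σ hσ i hi) with h | h
  · exact Or.inl ((h2 i hi).2 h).1
  · rcases ((h2 i hi).1 h).1.lt_or_eq with h' | h'
    · exact Or.inl h'
    · exact Or.inr ⟨h'.symm, h⟩

lemma own_card (hdeg : ∀ i, deg (v i) = 1) (hvΛ : ∀ i, v i ∈ Λ)
    (hdegΛ : ∀ x ∈ Λ, ∃ k : ℤ, deg x = k) (hfin : ∀ k, (coneSet v Λ deg k).Finite)
    (hσ : IsB v σ) (hq : GenQ v q) (k : ℕ) :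
    (ownSet v Λ deg q σ k).ncard = ∑ p ∈ Finset.HasAntidiagonal.antidiagonal k,
      (parSet v Λ deg q σ p.1).ncard * (Module.finrank ℝ E).multichoose p.2 := by
  classical
  have hfo : ∀ k, (ownSet v Λ deg q σ k).Finite := fun k => (hfin k).subset (ownSet_sub hσ k)
  have hfp : ∀ k, (parSet v Λ deg q σ k).Finite := fun k => (hfo k).subset (parSet_sub hσ hq k)
  have hrhs : ∑ p ∈ Finset.HasAntidiagonal.antidiagonal k,
      (parSet v Λ deg q σ p.1).ncard * (Module.finrank ℝ E).multichoose p.2 =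
      ((Finset.HasAntidiagonal.antidiagonal k).sigma fun p =>
        (hfp p.1).toFinset ×ˢ (Finset.finsuppAntidiag σ p.2)).card := by
    rw [Finset.card_sigma]
    apply Finset.sum_congr rfl
    intro p _
    rw [Finset.card_product, Finset.card_finsuppAntidiag_nat_eq_multichoose, hσ.card,
      Set.ncard_eq_toFinset_card _ (hfp p.1)]
  rw [hrhs, Set.ncard_eq_toFinset_card _ (hfo k)]
  symm
  have hcoadd : ∀ (x : E) (f : ι →₀ ℕ), f.support ⊆ σ → ∀ i,
      co v σ (x + ∑ j, (f j : ℝ) • v j) i = co v σ x i + f i := by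
    intro x f hf i
    rw [map_add, hσ.co_sum (fun j => (f j : ℝ))]
    · rfl
    · intro j hj
      have : j ∉ f.support := fun h => hj (hf h)
      simpa using this
  refine Finset.card_bij (fun a _ => a.2.1 + ∑ j, (a.2.2 j : ℝ) • v j) ?_ ?_ ?_
  · rintro ⟨⟨a, b⟩, x, f⟩ h
    simp only [Finset.mem_sigma, Finset.HasAntidiagonal.mem_antidiagonal, Finset.mem_product,
      Set.Finite.mem_toFinset, Finset.mem_finsuppAntidiag] at h
    obtain ⟨hab, hx, hf1, hf2⟩ := h
    rw [Set.Finite.mem_toFinset]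
    refine ⟨?_, ?_, ?_⟩
    · refine Λ.add_mem hx.1 (Λ.sum_mem fun i _ => ?_)
      rw [Nat.cast_smul_eq_nsmul]
      exact Λ.nsmul_mem (hvΛ i) _
    · intro i hi
      have h0 : Owns v q σ x := (parSet_sub hσ hq _ hx).2.1
      rw [hcoadd x f hf2]
      rcases Nat.eq_zero_or_pos (f i) with h | h
      · rw [h]; simpa using h0 i hi
      · left
        have h1 := h0.nonneg i hi
        have : (0:ℝ) < f i := by exact_mod_cast h
        linarith
    · rw [map_add, hx.2.2, map_sum]
      simp only [map_smul, hdeg, smul_eq_mul, mul_one]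
      have : ∑ i, (f i : ℝ) = b := by
        rw [← hf1]
        push_cast
        symm
        apply Finset.sum_subset (Finset.subset_univ _)
        intro i _ hi
        have : i ∉ f.support := fun h => hi (hf2 h)
        simpa using this
      rw [this, ← hab]; push_cast; rfl
  · rintro ⟨⟨a, b⟩, x, f⟩ h ⟨⟨a', b'⟩, x', f'⟩ h' heq
    simp only [Finset.mem_sigma, Finset.HasAntidiagonal.mem_antidiagonal, Finset.mem_product,
      Set.Finite.mem_toFinset, Finset.mem_finsuppAntidiag] at h h'
    obtain ⟨hab, hx, hf1, hf2⟩ := h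
    obtain ⟨hab', hx', hf1', hf2'⟩ := h'
    simp only at heq
    have hff : f = f' := by
      ext i
      by_cases hi : i ∈ σ
      · have e := hcoadd x f hf2 i
        rw [heq, hcoadd x' f' hf2' i] at e
        have hr : (f i : ℝ) < f' i + 1 ∧ (f' i : ℝ) < f i + 1 := by
          rcases lt_or_gt_of_ne (hq σ hσ i hi) with h | h
          · have h1 := (hx.2.1 i hi).2 h
            have h2 := (hx'.2.1 i hi).2 h
            constructor <;> linarith
          · have h1 := (hx.2.1 i hi).1 h
            have h2 := (hx'.2.1 i hi).1 h
            constructor <;> linarith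
        have h3 : f i < f' i + 1 := by exact_mod_cast hr.1
        have h4 : f' i < f i + 1 := by exact_mod_cast hr.2
        omega
      · have h1 : i ∉ f.support := fun h => hi (hf2 h)
        have h2 : i ∉ f'.support := fun h => hi (hf2' h)
        simp at h1 h2
        rw [h1, h2]
    subst hff
    have hxx : x = x' := by simpa using heq
    subst hxx
    have ha : (a:ℝ) = a' := by rw [← hx.2.2, ← hx'.2.2]
    have ha : a = a' := by exact_mod_cast ha
    subst ha
    have : b = b' := by omega
    subst this
    rfl
  · intro y hy
    rw [Set.Finite.mem_toFinset] at hy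
    obtain ⟨hy1, hy2, hy3⟩ := hy
    let N : ι → ℕ := fun i => if i ∈ σ then
      (if 0 < co v σ q i then ⌊co v σ y i⌋₊ else ⌈co v σ y i⌉₊ - 1) else 0
    let f : ι →₀ ℕ := Finsupp.equivFunOnFinite.symm N
    have hfN : ∀ i, f i = N i := fun i => rfl
    have hf2 : f.support ⊆ σ := by
      intro i hi
      by_contra h
      simp [hfN, N, h] at hi
    let x := y - ∑ j, (f j : ℝ) • v j
    have hxy : x + ∑ j, (f j : ℝ) • v j = y := by simp [x]
    have hcx : ∀ i, co v σ x i = co v σ y i - f i := by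
      intro i
      have := hcoadd x f hf2 i
      rw [hxy] at this
      linarith
    have hxΛ : x ∈ Λ := by
      refine Λ.sub_mem hy1 (Λ.sum_mem fun i _ => ?_)
      rw [Nat.cast_smul_eq_nsmul]
      exact Λ.nsmul_mem (hvΛ i) _
    have hpar : ∀ i ∈ σ, (0 < co v σ q i → 0 ≤ co v σ x i ∧ co v σ x i < 1) ∧
      (co v σ q i < 0 → 0 < co v σ x i ∧ co v σ x i ≤ 1) := by
      intro i hi
      rw [hcx, hfN]
      refine ⟨fun hqi => ?_, fun hqi => ?_⟩
      · simp only [N, hi, hqi, if_true]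
        have h1 := Nat.floor_le (hy2.nonneg i hi)
        have h2 := Nat.lt_floor_add_one (co v σ y i)
        constructor <;> linarith
      · simp only [N, hi, not_lt.2 hqi.le, if_true, if_false]
        have hpos : 0 < co v σ y i := by
          rcases hy2 i hi with h | h
          · exact h
          · linarith [h.2]
        have hc : 0 < ⌈co v σ y i⌉₊ := Nat.ceil_pos.2 hpos
        have h1 := Nat.le_ceil (co v σ y i)
        have h2 := Nat.ceil_lt_add_one hpos.le
        rw [Nat.cast_sub hc]
        push_cast
        constructor <;> linarith
    have hx0 : 0 ≤ deg x := by
      rw [deg_eq hdeg hσ]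
      apply Finset.sum_nonneg
      intro i _
      by_cases hi : i ∈ σ
      · rcases lt_or_gt_of_ne (hq σ hσ i hi) with h | h
        · exact ((hpar i hi).2 h).1.le
        · exact ((hpar i hi).1 h).1
      · exact (hσ.zero _ hi).ge
    obtain ⟨z, hz⟩ := hdegΛ x hxΛ
    have hz0 : 0 ≤ z := by rw [hz] at hx0; exact_mod_cast hx0
    obtain ⟨a, rfl⟩ := Int.eq_ofNat_of_zero_le hz0
    have hdy : deg y = deg x + ∑ i ∈ σ, (f i : ℝ) := by
      rw [← hxy, map_add, map_sum]
      simp only [map_smul, hdeg, smul_eq_mul, mul_one]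
      congr 1
      symm
      apply Finset.sum_subset (Finset.subset_univ _)
      intro i _ hi
      have : i ∉ f.support := fun h => hi (hf2 h)
      simpa using this
    refine ⟨⟨(a, ∑ i ∈ σ, f i), x, f⟩, ?_, hxy⟩
    simp only [Finset.mem_sigma, Finset.HasAntidiagonal.mem_antidiagonal, Finset.mem_product,
      Set.Finite.mem_toFinset, Finset.mem_finsuppAntidiag]
    refine ⟨?_, ⟨hxΛ, hpar, by simpa using hz⟩, trivial, hf2⟩
    rw [hy3, hz] at hdy
    exact_mod_cast hdy.symm

/-- reflection of the half open parallelepiped -/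
lemma par_reflect (hdeg : ∀ i, deg (v i) = 1) (hvΛ : ∀ i, v i ∈ Λ)
    (hσ : IsB v σ) (q : E) (i : ℕ) (hi : i ≤ Module.finrank ℝ E) :
    (parSet v Λ deg (-q) σ i).ncard = (parSet v Λ deg q σ (Module.finrank ℝ E - i)).ncard := by
  classical
  let s : E := ∑ j, (if j ∈ σ then (1:ℝ) else 0) • v j
  have hs : co v σ s = fun j => if j ∈ σ then (1:ℝ) else 0 := by
    apply hσ.co_sum
    intro j hj; simp [hj]
  have hsΛ : s ∈ Λ := by
    refine Λ.sum_mem fun j _ => ?_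
    split_ifs
    · simpa using hvΛ j
    · simp
  have hsd : deg s = Module.finrank ℝ E := by
    simp [s, map_sum, hdeg, hσ.card]
  apply Set.ncard_congr (fun x _ => s - x)
  · rintro x ⟨h1, h2, h3⟩
    refine ⟨Λ.sub_mem hsΛ h1, fun j hj => ?_, ?_⟩
    · have := h2 j hj
      simp only [map_neg, Pi.neg_apply, neg_pos, neg_lt_zero, map_sub, Pi.sub_apply, hs, hj,
        if_true] at this ⊢
      refine ⟨fun h => ?_, fun h => ?_⟩
      · have := this.2 h; constructor <;> linarith
      · have := this.1 h; constructor <;> linarith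
    · rw [map_sub, h3, hsd, Nat.cast_sub hi]
  · intro x y _ _ h; simpa using h
  · rintro y ⟨h1, h2, h3⟩
    refine ⟨s - y, ⟨Λ.sub_mem hsΛ h1, fun j hj => ?_, ?_⟩, by simp⟩
    · have := h2 j hj
      simp only [map_neg, Pi.neg_apply, neg_pos, neg_lt_zero, map_sub, Pi.sub_apply, hs, hj,
        if_true] at this ⊢
      refine ⟨fun h => ?_, fun h => ?_⟩
      · have := this.2 h; constructor <;> linarith
      · have := this.1 h; constructor <;> linarith
    · rw [map_sub, h3, hsd, Nat.cast_sub hi]; ring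

lemma par_zero (hdeg : ∀ i, deg (v i) = 1) (hσ : IsB v σ) (hq : GenQ v q) (i : ℕ)
    (hi : Module.finrank ℝ E < i) : parSet v Λ deg q σ i = ∅ := by
  by_contra hne
  obtain ⟨x, hx⟩ := Set.nonempty_iff_ne_empty.2 hne
  have h1 : deg x ≤ Module.finrank ℝ E := by
    rw [deg_eq hdeg hσ, ← hσ.card]
    have : ∑ j ∈ σ, co v σ x j = ∑ j, co v σ x j :=
      Finset.sum_subset (Finset.subset_univ _) fun j _ hj => hσ.zero x hj
    rw [← this]
    have : ∑ j ∈ σ, co v σ x j ≤ ∑ j ∈ σ, (1:ℝ) := by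
      apply Finset.sum_le_sum
      intro j hj
      rcases lt_or_gt_of_ne (hq σ hσ j hj) with h | h
      · exact ((hx.2.1 j hj).2 h).2
      · exact ((hx.2.1 j hj).1 h).2.le
    simpa using this
  rw [hx.2.2] at h1
  have : i ≤ Module.finrank ℝ E := by exact_mod_cast h1
  omega

/-- Lattice points of degree `k` in the perturbed cone. -/
def pertSet (v : ι → E) (Λ : AddSubgroup E) (deg : E →ₗ[ℝ] ℝ) (q : E) (k : ℕ) :
    Set E := {x | x ∈ Λ ∧ (∀ᶠ ε in nhdsWithin (0:ℝ) (Set.Ioi 0), x + ε • q ∈ coneOf v) ∧ deg x = k}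

open Classical in
/-- The h-vector. -/
def hvec (v : ι → E) (Λ : AddSubgroup E) (deg : E →ₗ[ℝ] ℝ) (w : ι → ℝ) (q : E) (i : ℕ) : ℕ :=
  ∑ σ : Finset ι, if IsCell v w σ then (parSet v Λ deg q σ i).ncard else 0

lemma pert_card (hv : ∀ x, x ∈ Submodule.span ℝ (Set.range v)) (hdeg : ∀ i, deg (v i) = 1)
    (hvΛ : ∀ i, v i ∈ Λ)
    (hdegΛ : ∀ x ∈ Λ, ∃ k : ℤ, deg x = k) (hfin : ∀ k, (coneSet v Λ deg k).Finite)
    {w : ι → ℝ} (hw : GenW v w) (hq : GenQ v q) (k : ℕ) :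
    (pertSet v Λ deg q k).ncard = ∑ p ∈ Finset.HasAntidiagonal.antidiagonal k,
      hvec v Λ deg w q p.1 * (Module.finrank ℝ E).multichoose p.2 := by
  classical
  have hfo : ∀ σ, IsB v σ → (ownSet v Λ deg q σ k).Finite :=
    fun σ hσ => (hfin k).subset (ownSet_sub hσ k)
  let S : Finset (Finset ι) := Finset.univ.filter fun σ => IsCell v w σ
  have e1 : pertSet v Λ deg q k = ⋃ σ ∈ S, ownSet v Λ deg q σ k := by
    ext x
    simp only [Set.mem_iUnion, S, Finset.mem_filter, Finset.mem_univ, true_and, exists_prop]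
    constructor
    · rintro ⟨h1, h2, h3⟩
      obtain ⟨σ, hσ, hx⟩ := exists_owns hv hw deg hdeg hq h2.frequently
      exact ⟨σ, hσ, h1, hx, h3⟩
    · rintro ⟨σ, hσ, h1, h2, h3⟩
      refine ⟨h1, ?_, h3⟩
      filter_upwards [h2.ev] with ε hε
      exact mem_cone_of_co hσ.1 fun i hi => (hε i hi).le
  have e2 : (pertSet v Λ deg q k).ncard = ∑ σ ∈ S, (ownSet v Λ deg q σ k).ncard := by
    have hS : ∀ σ ∈ S, IsCell v w σ := fun σ hσ => (Finset.mem_filter.1 hσ).2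
    let T : Finset ι → Finset E := fun σ =>
      if h : IsB v σ then (hfo σ h).toFinset else ∅
    have hT : ∀ σ ∈ S, (T σ : Set E) = ownSet v Λ deg q σ k := by
      intro σ hσ
      simp [T, (hS σ hσ).1]
    have : pertSet v Λ deg q k = (S.biUnion T : Finset E) := by
      rw [e1, Finset.coe_biUnion]
      ext x
      simp only [Set.mem_iUnion, exists_prop, Finset.mem_coe]
      constructor
      · rintro ⟨σ, hσ, hx⟩
        exact ⟨σ, hσ, by rw [← hT σ hσ] at hx; simpa using hx⟩
      · rintro ⟨σ, hσ, hx⟩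
        exact ⟨σ, hσ, by rw [← hT σ hσ]; simpa using hx⟩
    rw [this, Set.ncard_coe_finset, Finset.card_biUnion]
    · apply Finset.sum_congr rfl
      intro σ hσ
      rw [← hT σ hσ, Set.ncard_coe_finset]
    · intro σ hσ τ hτ hne
      rw [Function.onFun, Finset.disjoint_left]
      intro x hx hx'
      have hx : x ∈ (T σ : Set E) := hx
      have hx' : x ∈ (T τ : Set E) := hx'
      rw [hT σ hσ] at hx
      rw [hT τ hτ] at hx'
      exact hne (owns_unique (hS σ hσ) (hS τ hτ) hx.2.1 hx'.2.1)
  rw [e2]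
  simp only [hvec, Finset.sum_mul]
  rw [Finset.sum_comm, Finset.sum_filter]
  apply Finset.sum_congr rfl
  intro σ _
  split_ifs with h
  · exact own_card hdeg hvΛ hdegΛ hfin h.1 hq k
  · simp

/-- Ehrhart's theorem and reciprocity in generating function form. -/
theorem ehrhart_cone (hv : ∀ x, x ∈ Submodule.span ℝ (Set.range v)) (hdeg : ∀ i, deg (v i) = 1)
    (hvΛ : ∀ i, v i ∈ Λ)
    (hdegΛ : ∀ x ∈ Λ, ∃ k : ℤ, deg x = k) (hfin : ∀ k, (coneSet v Λ deg k).Finite) :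
    ∃ (t : ι → ℝ) (h : ℕ → ℕ), (∀ i, 0 < t i) ∧ (∀ i, Module.finrank ℝ E < i → h i = 0) ∧
      (∀ k, (coneSet v Λ deg k).ncard = ∑ p ∈ Finset.HasAntidiagonal.antidiagonal k,
        h p.1 * (Module.finrank ℝ E).multichoose p.2) ∧
      (∀ k, (pertSet v Λ deg (-∑ i, t i • v i) k).ncard = ∑ p ∈ Finset.HasAntidiagonal.antidiagonal k,
        (if p.1 ≤ Module.finrank ℝ E then h (Module.finrank ℝ E - p.1) else 0) *
          (Module.finrank ℝ E).multichoose p.2) := by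
  classical
  obtain ⟨w, hw⟩ := exists_genW v
  obtain ⟨t, ht, hq⟩ := exists_genQ v hv
  refine ⟨t, hvec v Λ deg w (∑ i, t i • v i), ht, ?_, ?_, ?_⟩
  · intro i hi
    unfold hvec
    apply Finset.sum_eq_zero
    intro σ _
    split_ifs with h
    · rw [par_zero hdeg h.1 hq i hi]; simp
    · rfl
  · intro k
    rw [← pert_card hv hdeg hvΛ hdegΛ hfin hw hq k]
    congr 1
    ext x
    constructor
    · rintro ⟨h1, ⟨l, hl0, hl⟩, h3⟩
      refine ⟨h1, ?_, h3⟩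
      filter_upwards [self_mem_nhdsWithin] with ε hε
      have hε : (0:ℝ) < ε := hε
      refine ⟨fun i => l i + ε * t i, fun i => ?_, ?_⟩
      · have := mul_pos hε (ht i)
        linarith [hl0 i]
      · simp only [add_smul, mul_smul, Finset.sum_add_distrib, ← Finset.smul_sum, hl]
    · rintro ⟨h1, h2, h3⟩
      obtain ⟨σ, hσ, hx⟩ := exists_owns hv hw deg hdeg hq h2.frequently
      exact ⟨h1, mem_cone_of_co hσ.1 hx.nonneg, h3⟩
  · intro k
    rw [pert_card hv hdeg hvΛ hdegΛ hfin hw hq.neg k]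
    apply Finset.sum_congr rfl
    intro p _
    congr 1
    split_ifs with hp
    · unfold hvec
      apply Finset.sum_congr rfl
      intro σ _
      split_ifs with h
      · exact par_reflect hdeg hvΛ h.1 _ _ hp
      · rfl
    · unfold hvec
      apply Finset.sum_eq_zero
      intro σ _
      split_ifs with h
      · rw [par_zero hdeg h.1 hq.neg _ (by omega)]; simp
      · rfl

end count

section lp
variable {d : ℕ}

lemma coeLat_inj {a b : Fin d → ℤ} (h : coeLat a = coeLat b) : a = b := by
  funext i
  have := congrFun h i
  simpa [coeLat] using this

lemma conv_mem_iff (V : Finset (Fin d → ℤ)) (x : Fin d → ℝ) :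
    x ∈ convexHull ℝ (coeLat '' (V : Set (Fin d → ℤ))) ↔
      ∃ l : V → ℝ, (∀ i, 0 ≤ l i) ∧ ∑ i, l i = 1 ∧ ∑ i, l i • coeLat (i : Fin d → ℤ) = x := by
  classical
  constructor
  · intro hx
    let T : Set (Fin d → ℝ) := {x | ∃ l : V → ℝ, (∀ i, 0 ≤ l i) ∧ ∑ i, l i = 1 ∧
      ∑ i, l i • coeLat (i : Fin d → ℤ) = x}
    have hT : Convex ℝ T := by
      rintro x ⟨l, h1, h2, h3⟩ y ⟨l', h1', h2', h3'⟩ a b ha hb hab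
      refine ⟨fun i => a * l i + b * l' i, fun i => ?_, ?_, ?_⟩
      · have := mul_nonneg ha (h1 i)
        have := mul_nonneg hb (h1' i)
        positivity
      · rw [Finset.sum_add_distrib, ← Finset.mul_sum, ← Finset.mul_sum, h2, h2']; linarith
      · simp only [add_smul, mul_smul, Finset.sum_add_distrib, ← Finset.smul_sum, h3, h3']
    have hsub : coeLat '' (V : Set (Fin d → ℤ)) ⊆ T := by
      rintro _ ⟨v, hv, rfl⟩
      have hv : v ∈ V := hv
      refine ⟨fun i => if i = ⟨v, hv⟩ then 1 else 0, fun i => ?_, ?_, ?_⟩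
      · dsimp only; split_ifs <;> norm_num
      · simp
      · simp
    exact convexHull_min hsub hT hx
  · rintro ⟨l, h1, h2, rfl⟩
    refine (convex_convexHull ℝ _).sum_mem (fun i _ => h1 i) h2 fun i _ => ?_
    exact subset_convexHull ℝ _ ⟨i, i.2, rfl⟩

/-- homogenized vertices -/
def hv (V : Finset (Fin d → ℤ)) (i : V) : ℝ × (Fin d → ℝ) := (1, coeLat (i : Fin d → ℤ))

/-- the homogenized cone -/
def inCone (V : Finset (Fin d → ℤ)) (x : ℝ × (Fin d → ℝ)) : Prop :=
  ∃ l : V → ℝ, (∀ i, 0 ≤ l i) ∧ ∑ i, l i • hv V i = x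

lemma sum_hv (V : Finset (Fin d → ℤ)) (l : V → ℝ) :
    ∑ i, l i • hv V i = (∑ i, l i, ∑ i, l i • coeLat (i : Fin d → ℤ)) := by
  ext
  · simp [hv, Prod.fst_sum]
  · simp [hv, Prod.snd_sum]

lemma inCone_iff (V : Finset (Fin d → ℤ)) (hV : V.Nonempty) (k : ℕ) (x : Fin d → ℝ) :
    inCone V ((k:ℝ), x) ↔ x ∈ (k:ℝ) • convexHull ℝ (coeLat '' (V : Set (Fin d → ℤ))) := by
  classical
  rw [Set.mem_smul_set]
  simp only [conv_mem_iff]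
  unfold inCone
  simp only [sum_hv, Prod.mk.injEq]
  constructor
  · rintro ⟨l, h1, h2, h3⟩
    rcases Nat.eq_zero_or_pos k with hk | hk
    · subst hk
      have hl : ∀ i, l i = 0 := by
        intro i
        have := (Finset.sum_eq_zero_iff_of_nonneg (fun i _ => h1 i)).1 (by simpa using h2)
        exact this i (Finset.mem_univ _)
      obtain ⟨v, hv⟩ := hV
      refine ⟨coeLat v, ⟨fun i => if i = ⟨v, hv⟩ then 1 else 0, fun i => ?_, ?_, ?_⟩, ?_⟩
      · dsimp only; split_ifs <;> norm_num
      · simp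
      · simp
      · rw [← h3]; simp [hl]
    · have hk' : (0:ℝ) < k := by exact_mod_cast hk
      refine ⟨(k:ℝ)⁻¹ • x, ⟨fun i => (k:ℝ)⁻¹ * l i, fun i => ?_, ?_, ?_⟩, ?_⟩
      · have := h1 i; positivity
      · rw [← Finset.mul_sum, h2]; field_simp
      · simp only [mul_smul, ← Finset.smul_sum, h3]
      · rw [smul_smul, mul_inv_cancel₀ hk'.ne', one_smul]
  · rintro ⟨y, ⟨l, h1, h2, h3⟩, rfl⟩
    refine ⟨fun i => k * l i, fun i => ?_, ?_, ?_⟩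
    · have := h1 i; positivity
    · rw [← Finset.mul_sum, h2, mul_one]
    · simp only [mul_smul, ← Finset.smul_sum, h3]

lemma conv_bounded (V : Finset (Fin d → ℤ)) :
    Bornology.IsBounded (convexHull ℝ (coeLat '' (V : Set (Fin d → ℤ)))) :=
  isBounded_convexHull.2 (V.finite_toSet.image _).isBounded

lemma latticePoints_finite {S : Set (Fin d → ℝ)} (hS : Bornology.IsBounded S) :
    (latticePoints S).Finite := by
  obtain ⟨C, hC⟩ := hS.exists_norm_le
  apply (Set.finite_Icc (fun _ : Fin d => -⌈C⌉) (fun _ => ⌈C⌉)).subset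
  intro n hn
  have h := hC _ hn
  have h2 : ∀ i, |(n i : ℝ)| ≤ C := fun i => (norm_le_pi_norm (coeLat n) i).trans h
  constructor
  · intro i
    have := (abs_le.1 (h2 i)).1
    have h3 := Int.le_ceil C
    have : (-⌈C⌉ : ℝ) ≤ n i := by linarith
    exact_mod_cast this
  · intro i
    have := (abs_le.1 (h2 i)).2
    have h3 := Int.le_ceil C
    have : (n i : ℝ) ≤ ⌈C⌉ := by linarith
    exact_mod_cast this

lemma finrank_span_hv (V : Finset (Fin d → ℤ)) (hV : V.Nonempty) :
    Module.finrank ℝ (Submodule.span ℝ (Set.range (hv V))) =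
      dimSet (convexHull ℝ (coeLat '' (V : Set (Fin d → ℤ)))) + 1 := by
  obtain ⟨v0, hv0⟩ := hV
  unfold dimSet
  rw [affineSpan_convexHull, direction_affineSpan]
  have h0 : coeLat v0 ∈ coeLat '' (V : Set (Fin d → ℤ)) := ⟨v0, hv0, rfl⟩
  set D := vectorSpan ℝ (coeLat '' (V : Set (Fin d → ℤ))) with hD
  let I : (Fin d → ℝ) →ₗ[ℝ] ℝ × (Fin d → ℝ) := LinearMap.inr ℝ ℝ (Fin d → ℝ)
  let p0 : ℝ × (Fin d → ℝ) := (1, coeLat v0)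
  have e : Submodule.span ℝ (Set.range (hv V)) = Submodule.span ℝ {p0} ⊔ D.map I := by
    apply le_antisymm
    · rw [Submodule.span_le]
      rintro _ ⟨i, rfl⟩
      have : hv V i = p0 + I (coeLat (i : Fin d → ℤ) - coeLat v0) := by
        ext <;> simp [hv, p0, I]
      rw [this]
      refine Submodule.add_mem_sup (Submodule.mem_span_singleton_self _)
        (Submodule.mem_map_of_mem ?_)
      exact vsub_mem_vectorSpan ℝ ⟨i, i.2, rfl⟩ h0
    · apply sup_le
      · rw [Submodule.span_singleton_le_iff_mem]
        exact Submodule.subset_span ⟨⟨v0, hv0⟩, rfl⟩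
      · rw [hD, vectorSpan_eq_span_vsub_set_right ℝ h0, Submodule.map_span, Submodule.span_le]
        rintro _ ⟨_, ⟨_, ⟨v, hv', rfl⟩, rfl⟩, rfl⟩
        have : I (coeLat v -ᵥ coeLat v0) = hv V ⟨v, hv'⟩ - hv V ⟨v0, hv0⟩ := by
          ext <;> simp [hv, I]
        show I (coeLat v -ᵥ coeLat v0) ∈ _
        rw [this]
        exact Submodule.sub_mem _ (Submodule.subset_span ⟨_, rfl⟩) (Submodule.subset_span ⟨_, rfl⟩)
  have hp0 : p0 ≠ 0 := by
    intro h
    have := congrArg Prod.fst h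
    simp [p0] at this
  have hinf : Submodule.span ℝ {p0} ⊓ D.map I = ⊥ := by
    rw [Submodule.eq_bot_iff]
    rintro x ⟨h1, h2⟩
    obtain ⟨c, rfl⟩ := Submodule.mem_span_singleton.1 h1
    obtain ⟨y, _, hy⟩ := h2
    have := congrArg Prod.fst hy
    simp [I, p0] at this
    rw [← this]; simp
  have h1 := Submodule.finrank_sup_add_finrank_inf_eq (Submodule.span ℝ {p0}) (D.map I)
  rw [hinf, finrank_bot, add_zero, finrank_span_singleton hp0] at h1
  rw [e, h1, ← (Submodule.equivMapOfInjective I LinearMap.inr_injective D).finrank_eq, add_comm]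

theorem ehrhart_lp (V : Finset (Fin d → ℤ)) (hV : V.Nonempty) (n : ℕ)
    (hn : n = dimSet (convexHull ℝ (coeLat '' (V : Set (Fin d → ℤ)))) + 1) :
    ∃ (t : V → ℝ) (h : ℕ → ℕ), (∀ i, 0 < t i) ∧ (∀ i, n < i → h i = 0) ∧
      (∀ k : ℕ, (latticePoints ((k:ℝ) • convexHull ℝ (coeLat '' (V : Set (Fin d → ℤ))))).ncard =
        ∑ p ∈ Finset.HasAntidiagonal.antidiagonal k, h p.1 * n.multichoose p.2) ∧
      (∀ k : ℕ, {x : Fin d → ℤ | ∀ᶠ ε in nhdsWithin (0:ℝ) (Set.Ioi 0),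
          inCone V (((k:ℝ), coeLat x) + ε • (-∑ i, t i • hv V i))}.ncard =
        ∑ p ∈ Finset.HasAntidiagonal.antidiagonal k,
          (if p.1 ≤ n then h (n - p.1) else 0) * n.multichoose p.2) := by
  classical
  rw [← finrank_span_hv V hV] at hn
  subst hn
  let E := Submodule.span ℝ (Set.range (hv V))
  let v : V → E := fun i => ⟨hv V i, Submodule.subset_span ⟨i, rfl⟩⟩
  let J : (ℤ × (Fin d → ℤ)) →+ ℝ × (Fin d → ℝ) :=
    { toFun := fun p => ((p.1 : ℝ), coeLat p.2)
      map_zero' := by ext <;> simp [coeLat]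
      map_add' := by intro a b; ext <;> simp [coeLat] }
  let Λ : AddSubgroup E := J.range.comap E.subtype.toAddMonoidHom
  let deg : E →ₗ[ℝ] ℝ := (LinearMap.fst ℝ ℝ (Fin d → ℝ)).comp E.subtype
  have hspan : ∀ x, x ∈ Submodule.span ℝ (Set.range v) := by
    have : Submodule.span ℝ (Set.range v) = ⊤ := by
      rw [← Submodule.map_injective_of_injective E.subtype_injective |>.eq_iff, Submodule.map_span,
        Submodule.map_top, Submodule.range_subtype, ← Set.range_comp]
      rfl
    intro x; rw [this]; trivial
  have hdeg : ∀ i, deg (v i) = 1 := fun i => rfl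
  have hvΛ : ∀ i, v i ∈ Λ := by
    intro i
    exact ⟨(1, i), by simp [J, v, hv]⟩
  have hdegΛ : ∀ x ∈ Λ, ∃ k : ℤ, deg x = k := by
    rintro x ⟨p, hp⟩
    refine ⟨p.1, ?_⟩
    show (x : ℝ × (Fin d → ℝ)).1 = _
    have : J p = (x : ℝ × (Fin d → ℝ)) := hp
    rw [← this]; rfl
  have hcone : ∀ x : E, x ∈ coneOf v ↔ inCone V (x : ℝ × (Fin d → ℝ)) := by
    intro x
    unfold coneOf inCone
    constructor
    · rintro ⟨l, h1, h2⟩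
      refine ⟨l, h1, ?_⟩
      rw [← h2]; simp [v]
    · rintro ⟨l, h1, h2⟩
      refine ⟨l, h1, ?_⟩
      apply Subtype.ext
      rw [← h2]; simp [v]
  have hinE : ∀ x, inCone V x → x ∈ E := by
    rintro x ⟨l, _, rfl⟩
    exact Submodule.sum_mem _ fun i _ => Submodule.smul_mem _ _ (Submodule.subset_span ⟨i, rfl⟩)
  have key : ∀ k : ℕ, (fun x : Fin d → ℤ => ((k:ℝ), coeLat x)) ''
      latticePoints ((k:ℝ) • convexHull ℝ (coeLat '' (V : Set (Fin d → ℤ)))) =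
      (Subtype.val : E → _) '' coneSet v Λ deg k := by
    intro k
    ext y
    constructor
    · rintro ⟨x, hx, rfl⟩
      have hx : coeLat x ∈ (k:ℝ) • convexHull ℝ (coeLat '' (V : Set (Fin d → ℤ))) := hx
      rw [← inCone_iff V hV] at hx
      refine ⟨⟨_, hinE _ hx⟩, ⟨⟨((k:ℤ), x), by simp [J]⟩, (hcone _).2 hx, rfl⟩, rfl⟩
    · rintro ⟨⟨y, hy⟩, ⟨⟨p, hp⟩, h2, h3⟩, rfl⟩
      have hp : J p = y := hp
      have h3 : y.1 = k := h3
      rw [hcone] at h2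
      have e : y = ((k:ℝ), coeLat p.2) := by
        rw [← h3, ← hp]; rfl
      refine ⟨p.2, ?_, e.symm⟩
      have h2 : inCone V y := h2
      rw [e] at h2
      exact (inCone_iff V hV _ _).1 h2
  have hinj : ∀ k : ℕ, Function.Injective (fun x : Fin d → ℤ => ((k:ℝ), coeLat x)) := by
    intro k a b h
    exact coeLat_inj (congrArg Prod.snd h)
  have hfin : ∀ k, (coneSet v Λ deg k).Finite := by
    intro k
    apply Set.Finite.of_finite_image _ Subtype.val_injective.injOn
    rw [← key k]
    exact (latticePoints_finite ((conv_bounded V).smul₀ _)).image _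
  obtain ⟨t, h, ht, h0, h1, h2⟩ := ehrhart_cone hspan hdeg hvΛ hdegΛ hfin
  refine ⟨t, h, ht, h0, fun k => ?_, fun k => ?_⟩
  · rw [← h1 k, ← Set.ncard_image_of_injective _ (hinj k), key k,
      Set.ncard_image_of_injective _ Subtype.val_injective]
  · rw [← h2 k, ← Set.ncard_image_of_injective _ (hinj k),
      ← Set.ncard_image_of_injective (pertSet _ _ _ _ _) (Subtype.val_injective)]
    congr 1
    have hq : ((-∑ i, t i • v i : E) : ℝ × (Fin d → ℝ)) = -∑ i, t i • hv V i := by simp [v]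
    ext y
    constructor
    · rintro ⟨x, hx, rfl⟩
      have hx : ∀ᶠ ε in nhdsWithin (0:ℝ) (Set.Ioi 0),
          inCone V (((k:ℝ), coeLat x) + ε • (-∑ i, t i • hv V i)) := hx
      obtain ⟨ε, hε⟩ := hx.exists
      have hE : ((k:ℝ), coeLat x) ∈ E := by
        have h3 := hinE _ hε
        have h4 : ε • (-∑ i, t i • hv V i) ∈ E := by
          rw [← hq]; exact Submodule.smul_mem _ _ (Subtype.prop _)
        have := Submodule.sub_mem _ h3 h4
        simpa using this
      refine ⟨⟨_, hE⟩, ⟨⟨((k:ℤ), x), by simp [J]⟩, ?_, rfl⟩, rfl⟩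
      filter_upwards [hx] with ε hε
      rw [hcone]
      rw [Submodule.coe_add, Submodule.coe_smul, hq]
      exact hε
    · rintro ⟨⟨y, hy⟩, ⟨⟨p, hp⟩, h2, h3⟩, rfl⟩
      have hp : J p = y := hp
      have h3 : y.1 = k := h3
      have e : y = ((k:ℝ), coeLat p.2) := by
        rw [← h3, ← hp]; rfl
      refine ⟨p.2, ?_, e.symm⟩
      show ∀ᶠ ε in nhdsWithin (0:ℝ) (Set.Ioi 0),
          inCone V (((k:ℝ), coeLat p.2) + ε • (-∑ i, t i • hv V i))
      filter_upwards [h2] with ε hε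
      rw [hcone, Submodule.coe_add, Submodule.coe_smul, hq] at hε
      rw [← e]
      exact hε

end lp

lemma tendsto_choose_div (i q : ℕ) :
    Tendsto (fun k : ℕ => (((q + 1).multichoose (k - i) : ℕ) : ℝ) / (k:ℝ) ^ q) atTop
      (nhds (1 / (q.factorial : ℝ))) := by
  have hm : ∀ q j : ℕ, (q+1).multichoose j = (q + j).choose q := by
    intro q j
    rw [Nat.multichoose_eq, show q + 1 + j - 1 = q + j by omega]
    rw [← Nat.choose_symm_add]
  simp only [hm]
  induction q with
  | zero => simp
  | succ q ih =>
    have h1 : Tendsto (fun k : ℕ => ((q + 1 + (k - i) : ℕ) : ℝ) / k / (q+1)) atTop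
        (nhds (1 / (q+1))) := by
      apply Tendsto.div_const
      have h2 : Tendsto (fun k : ℕ => 1 + ((q:ℝ) + 1 - i) / k) atTop (nhds (1 + 0)) :=
        tendsto_const_nhds.add (tendsto_const_div_atTop_nhds_zero_nat _)
      rw [add_zero] at h2
      refine h2.congr' ?_
      filter_upwards [eventually_ge_atTop (i+1)] with k hk
      have hk0 : (0:ℝ) < k := by exact_mod_cast (by omega : 0 < k)
      rw [Nat.cast_add, Nat.cast_sub (by omega)]
      field_simp
      push_cast
      ring
    have h3 := ih.mul h1
    rw [show (1 / ((q + 1).factorial : ℝ)) = 1 / (q.factorial : ℝ) * (1 / (q + 1)) by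
      rw [Nat.factorial_succ]; push_cast; field_simp]
    refine h3.congr fun k => ?_
    have h4 : (q + 1 + (k - i)) * (q + (k-i)).choose q = (q + 1 + (k-i)).choose (q+1) * (q+1) := by
      have := Nat.add_one_mul_choose_eq (q + (k-i)) q
      rw [show q + (k - i) + 1 = q + 1 + (k-i) by ring] at this
      exact this
    have h5 : ((q + 1 + (k - i) : ℕ) : ℝ) * ((q + (k-i)).choose q : ℕ) =
        ((q + 1 + (k-i)).choose (q+1) : ℕ) * (q+1) := by exact_mod_cast h4
    have : (0:ℝ) < q + 1 := by positivity
    rw [div_mul_eq_mul_div, mul_div_assoc', mul_div_assoc', mul_comm, h5, pow_succ]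
    field_simp

lemma sum_antidiag_eq (n N : ℕ) (h : ℕ → ℕ) (h0 : ∀ i, N < i → h i = 0) (k : ℕ) (hk : N ≤ k) :
    ∑ p ∈ Finset.HasAntidiagonal.antidiagonal k, h p.1 * n.multichoose p.2 =
      ∑ i ∈ Finset.range (N+1), h i * n.multichoose (k - i) := by
  have := Finset.Nat.sum_antidiagonal_eq_sum_range_succ (fun i j => h i * n.multichoose j) k
  refine Eq.trans ?_ (this.trans ?_)
  · rfl
  · symm
    apply Finset.sum_subset
    · intro i hi; simp at hi ⊢; omega
    · intro i _ hi
      rw [h0 i (by simpa using hi), zero_mul]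

lemma ehrhart_limit (q N : ℕ) (h : ℕ → ℕ) (h0 : ∀ i, N < i → h i = 0) (E : ℕ → ℕ)
    (hE : ∀ k, E k = ∑ p ∈ Finset.HasAntidiagonal.antidiagonal k, h p.1 * (q+1).multichoose p.2) :
    Tendsto (fun k : ℕ => (E k : ℝ) / (k:ℝ)^q) atTop
      (nhds ((∑ i ∈ Finset.range (N+1), (h i : ℝ)) / q.factorial)) := by
  have h1 : Tendsto (fun k : ℕ => ∑ i ∈ Finset.range (N+1),
      (h i : ℝ) * ((((q + 1).multichoose (k - i) : ℕ) : ℝ) / (k:ℝ) ^ q)) atTop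
      (nhds (∑ i ∈ Finset.range (N+1), (h i : ℝ) * (1 / (q.factorial : ℝ)))) :=
    tendsto_finsetSum _ fun i _ => (tendsto_choose_div i q).const_mul _
  rw [← Finset.sum_mul, mul_one_div] at h1
  refine h1.congr' ?_
  filter_upwards [eventually_ge_atTop N] with k hk
  rw [hE, sum_antidiag_eq _ N h h0 k hk]
  push_cast
  rw [Finset.sum_div]
  apply Finset.sum_congr rfl
  intro i _
  rw [mul_div_assoc]

/-- Existence of the normalized volume limits. -/
lemma lp_limit {d : ℕ} (V : Finset (Fin d → ℤ)) (hV : V.Nonempty) (p : ℕ)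
    (hp : dimSet (convexHull ℝ (coeLat '' (V : Set (Fin d → ℤ)))) ≤ p) :
    ∃ L : ℝ, Tendsto (fun k : ℕ =>
      ((latticePoints ((k:ℝ) • convexHull ℝ (coeLat '' (V : Set (Fin d → ℤ))))).ncard : ℝ) /
        (k:ℝ)^p) atTop (nhds L) ∧
      (dimSet (convexHull ℝ (coeLat '' (V : Set (Fin d → ℤ)))) < p → L = 0) := by
  obtain ⟨t, h, -, h0, h1, -⟩ := ehrhart_lp V hV _ rfl
  set q := dimSet (convexHull ℝ (coeLat '' (V : Set (Fin d → ℤ))))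
  have h2 := ehrhart_limit q (q+1) h h0 _ h1
  rcases hp.lt_or_eq with hlt | heq
  · refine ⟨0, ?_, fun _ => rfl⟩
    obtain ⟨e, rfl⟩ : ∃ e, p = q + (e + 1) := ⟨p - q - 1, by omega⟩
    have h3 : Tendsto (fun k : ℕ => (1:ℝ) / (k:ℝ)^(e+1)) atTop (nhds 0) := by
      have : Tendsto (fun k : ℕ => (k:ℝ)^(e+1)) atTop atTop :=
        (tendsto_pow_atTop (by omega)).comp tendsto_natCast_atTop_atTop
      simp only [one_div]
      exact this.inv_tendsto_atTop
    have h4 := h2.mul h3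
    rw [mul_zero] at h4
    refine h4.congr fun k => ?_
    rw [pow_add _ q, div_mul_div_comm, mul_one]
  · subst heq
    exact ⟨_, h2, fun h => absurd h (lt_irrefl _)⟩

lemma normVol_eq_of_tendsto {d : ℕ} (k : ℕ) (θ : Set (Fin d → ℝ)) (L : ℝ)
    (h : Tendsto (fun m : ℕ => ((latticePoints ((m : ℝ) • θ)).ncard : ℝ) / (m : ℝ) ^ k) atTop
      (nhds L)) : normVol k θ = k.factorial * L := by
  unfold normVol
  apply Tendsto.limUnder_eq
  refine (h.const_mul (k.factorial : ℝ)).congr fun m => ?_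
  rw [mul_div_assoc]

/-- cancellation of the denominator of the Ehrhart series -/
lemma h_unique (n : ℕ) (f g : ℕ → ℕ)
    (hfg : ∀ k, ∑ p ∈ Finset.HasAntidiagonal.antidiagonal k, f p.1 * n.multichoose p.2 =
      ∑ p ∈ Finset.HasAntidiagonal.antidiagonal k, g p.1 * n.multichoose p.2) : f = g := by
  funext k
  induction k using Nat.strong_induction_on with
  | _ k ih =>
    have h1 := Finset.Nat.sum_antidiagonal_eq_sum_range_succ (fun i j => f i * n.multichoose j) k
    have h2 := Finset.Nat.sum_antidiagonal_eq_sum_range_succ (fun i j => g i * n.multichoose j) k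
    have h3 := (h1.symm.trans (hfg k)).trans h2
    rw [Finset.sum_range_succ, Finset.sum_range_succ] at h3
    have h4 : ∑ i ∈ Finset.range k, f i * n.multichoose (k - i) =
        ∑ i ∈ Finset.range k, g i * n.multichoose (k - i) := by
      apply Finset.sum_congr rfl
      intro i hi
      rw [ih i (Finset.mem_range.1 hi)]
    rw [h4] at h3
    simpa using h3

/-- shift of a series -/
lemma sum_antidiag_shift (n r : ℕ) (h : ℕ → ℕ) (k : ℕ) :
    ∑ p ∈ Finset.HasAntidiagonal.antidiagonal k, (if r ≤ p.1 then h (p.1 - r) else 0) * n.multichoose p.2 =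
      if r ≤ k then ∑ p ∈ Finset.HasAntidiagonal.antidiagonal (k - r), h p.1 * n.multichoose p.2 else 0 := by
  have h1 := Finset.Nat.sum_antidiagonal_eq_sum_range_succ
    (fun i j => (if r ≤ i then h (i - r) else 0) * n.multichoose j) k
  have h2 := Finset.Nat.sum_antidiagonal_eq_sum_range_succ (fun i j => h i * n.multichoose j) (k - r)
  refine Eq.trans h1 ?_
  split_ifs with hk
  · refine Eq.trans ?_ h2.symm
    obtain ⟨j, rfl⟩ := Nat.exists_eq_add_of_le hk
    rw [show (r + j).succ = r + (j+1) by omega, Finset.sum_range_add,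
      show r + j - r = j by omega]
    rw [Finset.sum_eq_zero, zero_add]
    · apply Finset.sum_congr rfl
      intro i _
      rw [if_pos (by omega), show r + i - r = i by omega, show r + j - (r + i) = j - i by omega]
    · intro i hi
      rw [if_neg (by simpa using hi), zero_mul]
  · apply Finset.sum_eq_zero
    intro i hi
    rw [if_neg (by simp at hi; omega), zero_mul]

section geom
variable {d : ℕ}

lemma coe_dot (u v : Fin d → ℤ) : coeLat u ⬝ᵥ coeLat v = ((u ⬝ᵥ v : ℤ) : ℝ) := by
  simp [dotProduct, coeLat]

lemma coeLat_sub (u v : Fin d → ℤ) : coeLat (u - v) = coeLat u - coeLat v := by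
  ext i; simp [coeLat]

lemma coeLat_add (u v : Fin d → ℤ) : coeLat (u + v) = coeLat u + coeLat v := by
  ext i; simp [coeLat]

lemma mem_polar_iff (P : Set (Fin d → ℝ)) (y : Fin d → ℝ) :
    y ∈ polarDual P ↔ ∀ x ∈ P, -1 ≤ y ⬝ᵥ x := Iff.rfl

/-- a linear inequality extends to convex hulls -/
lemma conv_ge {S : Set (Fin d → ℝ)} {y : Fin d → ℝ} {c : ℝ} (h : ∀ x ∈ S, c ≤ y ⬝ᵥ x) :
    ∀ x ∈ convexHull ℝ S, c ≤ y ⬝ᵥ x := by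
  intro x hx
  have hc : Convex ℝ {x : Fin d → ℝ | c ≤ y ⬝ᵥ x} := by
    intro a ha b hb s t hs ht hst
    have ha : c ≤ y ⬝ᵥ a := ha
    have hb : c ≤ y ⬝ᵥ b := hb
    show c ≤ y ⬝ᵥ (s • a + t • b)
    rw [dotProduct_add, dotProduct_smul, dotProduct_smul, smul_eq_mul, smul_eq_mul]
    have h1 := mul_le_mul_of_nonneg_left ha hs
    have h2 := mul_le_mul_of_nonneg_left hb ht
    calc c = s * c + t * c := by rw [← add_mul, hst, one_mul]
      _ ≤ _ := add_le_add h1 h2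
  exact convexHull_min h hc hx

lemma lp_compact {P : Set (Fin d → ℝ)} (hP : IsLatticePolytope P) : IsCompact P := by
  obtain ⟨V, rfl⟩ := hP
  exact (V.finite_toSet.image coeLat).isCompact_convexHull (𝕜 := ℝ)

lemma lp_convex {P : Set (Fin d → ℝ)} (hP : IsLatticePolytope P) : Convex ℝ P := by
  obtain ⟨V, rfl⟩ := hP
  exact convex_convexHull ℝ _

lemma dot_le_bound (y x : Fin d → ℝ) : |y ⬝ᵥ x| ≤ d * (‖y‖ * ‖x‖) := by
  unfold dotProduct
  calc |∑ i, y i * x i| ≤ ∑ i, |y i * x i| := Finset.abs_sum_le_sum_abs _ _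
    _ ≤ ∑ i : Fin d, ‖y‖ * ‖x‖ := by
        apply Finset.sum_le_sum
        intro i _
        rw [abs_mul]
        exact mul_le_mul (norm_le_pi_norm y i) (norm_le_pi_norm x i) (abs_nonneg _) (norm_nonneg _)
    _ = _ := by simp

/-- Existence of the finite set of vertices of the dual with all needed properties. -/
theorem reflexive_data (hd : 0 < d) {P : Set (Fin d → ℝ)} (hP : IsReflexive P) :
    ∃ U : Finset (Fin d → ℤ),
      polarDual P = convexHull ℝ (coeLat '' (U : Set (Fin d → ℤ))) ∧
      (∀ u ∈ U, coeLat u ∈ (polarDual P).extremePoints ℝ) ∧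
      (∀ x, x ∈ P ↔ ∀ u ∈ U, -1 ≤ coeLat u ⬝ᵥ x) ∧
      (∀ S : Set (Fin d → ℝ), S.Finite → P = convexHull ℝ S →
        ∀ u ∈ U, ∃ x ∈ S, coeLat u ⬝ᵥ x = -1) := by
  classical
  obtain ⟨hP1, hP0, hQ⟩ := hP
  obtain ⟨VQ, hVQ⟩ := id hQ
  let U : Finset (Fin d → ℤ) := VQ.filter fun u => coeLat u ∈ (polarDual P).extremePoints ℝ
  have hUext : ∀ u ∈ U, coeLat u ∈ (polarDual P).extremePoints ℝ :=
    fun u hu => (Finset.mem_filter.1 hu).2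
  have himg : coeLat '' (U : Set (Fin d → ℤ)) = (polarDual P).extremePoints ℝ := by
    ext y
    constructor
    · rintro ⟨u, hu, rfl⟩; exact hUext u hu
    · intro hy
      have hy' := hy
      rw [hVQ] at hy'
      obtain ⟨u, hu, rfl⟩ := extremePoints_convexHull_subset hy'
      exact ⟨u, by simpa [U] using ⟨hu, hy⟩, rfl⟩
  have hQU : polarDual P = convexHull ℝ (coeLat '' (U : Set (Fin d → ℤ))) := by
    have h1 := closure_convexHull_extremePoints (lp_compact hQ) (lp_convex hQ)
    rw [← himg] at h1
    rw [← h1]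
    exact ((U.finite_toSet.image coeLat).isCompact_convexHull (𝕜 := ℝ)).isClosed.closure_eq
  have hbip : ∀ x, x ∈ P ↔ ∀ u ∈ U, -1 ≤ coeLat u ⬝ᵥ x := by
    intro x
    constructor
    · intro hx u hu
      exact (hUext u hu).1 x hx
    · intro hx
      have hxQ : ∀ y ∈ polarDual P, -1 ≤ y ⬝ᵥ x := by
        intro y hy
        rw [hQU] at hy
        rw [dotProduct_comm]
        apply conv_ge _ y hy
        rintro _ ⟨u, hu, rfl⟩
        rw [dotProduct_comm]
        exact hx u hu
      by_contra hxP
      obtain ⟨f, c, h1, h2⟩ := geometric_hahn_banach_closed_point (lp_convex hP1)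
        (lp_compact hP1).isClosed hxP
      have hc : 0 < c := by simpa using h1 0 (interior_subset hP0)
      let w : Fin d → ℝ := fun i => f (Pi.single i 1)
      have hf : ∀ z, f z = w ⬝ᵥ z := by
        intro z
        have := LinearMap.pi_apply_eq_sum_univ (f : (Fin d → ℝ) →ₗ[ℝ] ℝ) z
        have h3 : f z = ∑ i, z i • f (fun j => if i = j then 1 else 0) := this
        rw [h3]
        unfold dotProduct
        apply Finset.sum_congr rfl
        intro i _
        rw [smul_eq_mul, mul_comm]
        congr 2
        ext j
        simp [Pi.single_apply, eq_comm]
      have hy : (-(c⁻¹)) • w ∈ polarDual P := by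
        rw [mem_polar_iff]
        intro z hz
        have h3 := h1 z hz
        rw [hf] at h3
        rw [smul_dotProduct, smul_eq_mul]
        have : c⁻¹ * (w ⬝ᵥ z) ≤ c⁻¹ * c := mul_le_mul_of_nonneg_left h3.le (by positivity)
        rw [inv_mul_cancel₀ hc.ne'] at this
        linarith
      have h4 := hxQ _ hy
      rw [smul_dotProduct, smul_eq_mul, ← hf] at h4
      have : c⁻¹ * c < c⁻¹ * f x := mul_lt_mul_of_pos_left h2 (by positivity)
      rw [inv_mul_cancel₀ hc.ne'] at this
      linarith
  refine ⟨U, hQU, hUext, hbip, ?_⟩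
  intro S hS hPS u hu
  by_contra hcon
  push Not at hcon
  have hge : ∀ x ∈ S, -1 < coeLat u ⬝ᵥ x := by
    intro x hx
    refine lt_of_le_of_ne ?_ (hcon x hx).symm
    exact (hUext u hu).1 x (by rw [hPS]; exact subset_convexHull ℝ _ hx)
  have hev : ∀ᶠ ε in nhdsWithin (0:ℝ) (Set.Ioi 0), ∀ x ∈ S,
      0 < (1 + coeLat u ⬝ᵥ x) + ε * (coeLat u ⬝ᵥ x) :=
    (Set.Finite.eventually_all hS).2 fun x hx => ev_pos _ _ (Or.inl (by linarith [hge x hx]))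
  obtain ⟨ε, hε, hε0⟩ := (hev.and self_mem_nhdsWithin).exists
  have hε0 : 0 < ε := hε0
  have hbig : (1 + ε) • coeLat u ∈ polarDual P := by
    rw [mem_polar_iff, hPS]
    apply conv_ge
    intro x hx
    have := hε x hx
    rw [smul_dotProduct, smul_eq_mul]
    linarith
  have hzero : (0 : Fin d → ℝ) ∈ polarDual P := by
    rw [mem_polar_iff]; intro x _; simp
  have hu0 : coeLat u = 0 := by
    have h1 : coeLat u ∈ openSegment ℝ (0 : Fin d → ℝ) ((1 + ε) • coeLat u) := by
      refine ⟨ε / (1+ε), 1 / (1+ε), by positivity, by positivity, by field_simp; ring, ?_⟩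
      rw [smul_zero, zero_add, smul_smul]
      have : 1 / (1 + ε) * (1 + ε) = 1 := by field_simp
      rw [this, one_smul]
    exact ((hUext u hu).2 hzero hbig h1).symm
  obtain ⟨C, hC⟩ := (lp_compact hP1).isBounded.exists_norm_le
  have hC0 : 0 ≤ C := (norm_nonneg _).trans (hC 0 (interior_subset hP0))
  let y : Fin d → ℝ := fun _ => 1 / (d * (C + 1))
  have hd' : (0:ℝ) < d := by exact_mod_cast hd
  have hyn : ‖y‖ ≤ 1 / (d * (C+1)) := by
    rw [pi_norm_le_iff_of_nonneg (by positivity)]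
    intro i
    rw [Real.norm_of_nonneg (by positivity)]
  have hyb : ∀ x ∈ P, |y ⬝ᵥ x| ≤ 1 := by
    intro x hx
    refine (dot_le_bound y x).trans ?_
    calc (d:ℝ) * (‖y‖ * ‖x‖) ≤ d * (1 / (d * (C+1)) * C) := by
          gcongr
          exact hC x hx
      _ ≤ 1 := by
          rw [show (d:ℝ) * (1 / (d * (C+1)) * C) = C / (C+1) by field_simp]
          rw [div_le_one (by positivity)]; linarith
  have hy1 : y ∈ polarDual P := fun x hx => (abs_le.1 (hyb x hx)).1
  have hy2 : -y ∈ polarDual P := by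
    rw [mem_polar_iff]; intro x hx
    rw [neg_dotProduct]; linarith [(abs_le.1 (hyb x hx)).2]
  have h0ext := hUext u hu
  rw [hu0] at h0ext
  have h2 : (0 : Fin d → ℝ) ∈ openSegment ℝ y (-y) :=
    ⟨1/2, 1/2, by norm_num, by norm_num, by norm_num, by simp⟩
  have h3 := h0ext.2 hy1 hy2 h2
  have h4 := congrFun h3 ⟨0, hd⟩
  simp only [y, Pi.zero_apply] at h4
  have : (0:ℝ) < 1 / (d * (C + 1)) := by positivity
  linarith

end geom

section gor
variable {d : ℕ}

lemma affine_image_hull (r : ℝ) (m : Fin d → ℝ) (S : Set (Fin d → ℝ)) :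
    (fun x => r • x - m) '' (convexHull ℝ S) = convexHull ℝ ((fun x => r • x - m) '' S) := by
  let f : (Fin d → ℝ) →ᵃ[ℝ] (Fin d → ℝ) :=
    r • AffineMap.id ℝ (Fin d → ℝ) - AffineMap.const ℝ (Fin d → ℝ) m
  exact f.image_convexHull S

/-- a bounded polytope given by inequalities has no recession direction -/
lemma no_recession {P : Set (Fin d → ℝ)} {U : Finset (Fin d → ℤ)} (hb : Bornology.IsBounded P)
    (hU : ∀ x, x ∈ P ↔ ∀ u ∈ U, -1 ≤ coeLat u ⬝ᵥ x) (y : Fin d → ℝ)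
    (hy : ∀ u ∈ U, 0 ≤ coeLat u ⬝ᵥ y) : y = 0 := by
  obtain ⟨C, hC⟩ := hb.exists_norm_le
  by_contra hne
  have hn : 0 < ‖y‖ := norm_pos_iff.2 hne
  have h1 : ((|C| + 1) / ‖y‖) • y ∈ P := by
    rw [hU]
    intro u hu
    rw [dotProduct_smul, smul_eq_mul]
    have := mul_nonneg (by positivity : 0 ≤ (|C| + 1) / ‖y‖) (hy u hu)
    linarith
  have h2 := hC _ h1
  rw [norm_smul, Real.norm_of_nonneg (by positivity), div_mul_cancel₀ _ hn.ne'] at h2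
  linarith [le_abs_self C]

theorem gorenstein_ehrhart (r : ℕ) (hr : 1 ≤ r) (hd : d = r + 2) (V : Finset (Fin d → ℤ))
    (Δ : Set (Fin d → ℝ)) (hΔ : Δ = convexHull ℝ (coeLat '' (V : Set (Fin d → ℤ))))
    (hdim : dimSet Δ = d) (m : Fin d → ℤ) (P : Set (Fin d → ℝ))
    (hP : P = (fun x => (r : ℝ) • x - coeLat m) '' Δ) (hPr : IsReflexive P) :
    ∃ h : ℕ → ℕ, h 0 = 1 ∧ h 2 = h 1 ∧ h 3 = 1 ∧ (∀ i, 3 < i → h i = 0) ∧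
      ∀ k : ℕ, (latticePoints ((k:ℝ) • Δ)).ncard =
        ∑ p ∈ Finset.HasAntidiagonal.antidiagonal k, h p.1 * (d+1).multichoose p.2 := by
  classical
  have hr' : (0:ℝ) < r := by exact_mod_cast hr
  obtain ⟨U, hQU, hUext, hU, hUS⟩ := reflexive_data (by omega) hPr
  have h0P : (0 : Fin d → ℝ) ∈ P := interior_subset hPr.2.1
  have hV : V.Nonempty := by
    rw [hP, hΔ] at h0P
    obtain ⟨x, hx, -⟩ := h0P
    have := convexHull_nonempty_iff.1 ⟨x, hx⟩
    simpa using this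
  have hUne : U.Nonempty := by
    have : (0 : Fin d → ℝ) ∈ polarDual P := by
      rw [mem_polar_iff]; intro x _; simp
    rw [hQU] at this
    have := convexHull_nonempty_iff.1 ⟨_, this⟩
    simpa using this
  have hPS : P = convexHull ℝ ((fun x => (r : ℝ) • x - coeLat m) '' (coeLat '' (V : Set (Fin d → ℤ)))) := by
    rw [hP, hΔ, affine_image_hull]
  have hc : ∀ u ∈ U, ∃ c : ℤ, r * c = 1 - u ⬝ᵥ m := by
    intro u hu
    obtain ⟨x, ⟨_, ⟨v, hv, rfl⟩, rfl⟩, hx⟩ := hUS _ ((V.finite_toSet.image _).image _) hPS u hu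
    refine ⟨-(u ⬝ᵥ v), ?_⟩
    simp only at hx
    rw [dotProduct_sub, dotProduct_smul, coe_dot, coe_dot, smul_eq_mul] at hx
    have : (r : ℤ) * (u ⬝ᵥ v) - u ⬝ᵥ m = -1 := by exact_mod_cast hx
    linarith
  choose! c hc using hc
  have hcR : ∀ u ∈ U, (r:ℝ) * c u = 1 - coeLat u ⬝ᵥ coeLat m := by
    intro u hu
    rw [coe_dot]; exact_mod_cast hc u hu
  have hbd : Bornology.IsBounded P := (lp_compact hPr.1).isBounded
  -- membership in the dilates
  have hmem : ∀ (k : ℝ), 0 < k → ∀ x : Fin d → ℝ, x ∈ k • Δ ↔ ∀ u ∈ U, 0 ≤ coeLat u ⬝ᵥ x + c u * k := by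
    intro k hk x
    have h1 : x ∈ k • Δ ↔ (r : ℝ) • (k⁻¹ • x) - coeLat m ∈ P := by
      rw [Set.mem_smul_set_iff_inv_smul_mem₀ hk.ne', hP]
      constructor
      · intro h; exact ⟨_, h, rfl⟩
      · rintro ⟨y, hy, hyx⟩
        have : (r:ℝ) • y = (r:ℝ) • (k⁻¹ • x) := by
          have := congrArg (· + coeLat m) hyx
          simpa using this
        have := smul_right_injective _ hr'.ne' this
        rwa [← this]
    rw [h1, hU]
    apply forall₂_congr
    intro u hu
    rw [dotProduct_sub, dotProduct_smul, dotProduct_smul, smul_eq_mul, smul_eq_mul]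
    have h2 := hcR u hu
    have h3 : (r:ℝ) * (k⁻¹ * coeLat u ⬝ᵥ x) - coeLat u ⬝ᵥ coeLat m + 1 =
        (r * k⁻¹) * (coeLat u ⬝ᵥ x + c u * k) := by
      have : (r:ℝ) * k⁻¹ * (coeLat u ⬝ᵥ x + c u * k) = r * (k⁻¹ * coeLat u ⬝ᵥ x) + (r * c u) * (k⁻¹ * k) := by ring
      rw [this, inv_mul_cancel₀ hk.ne', h2]; ring
    have h4 : 0 < r * k⁻¹ := by positivity
    constructor
    · intro h
      have : 0 ≤ (r * k⁻¹) * (coeLat u ⬝ᵥ x + c u * k) := by linarith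
      exact nonneg_of_mul_nonneg_right this h4
    · intro h
      have := mul_nonneg h4.le h
      linarith
  have hcone : ∀ (k : ℝ), 0 < k → ∀ x : Fin d → ℝ, inCone V (k, x) ↔
      ∀ u ∈ U, 0 ≤ coeLat u ⬝ᵥ x + c u * k := by
    intro k hk x
    rw [← hmem k hk, hΔ, Set.mem_smul_set_iff_inv_smul_mem₀ hk.ne', conv_mem_iff]
    unfold inCone
    simp only [sum_hv, Prod.mk.injEq]
    constructor
    · rintro ⟨l, h1, h2, h3⟩
      refine ⟨fun i => k⁻¹ * l i, fun i => ?_, ?_, ?_⟩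
      · have := h1 i; positivity
      · rw [← Finset.mul_sum, h2]; field_simp
      · simp only [mul_smul, ← Finset.smul_sum, h3]
    · rintro ⟨l, h1, h2, h3⟩
      refine ⟨fun i => k * l i, fun i => ?_, ?_, ?_⟩
      · have := h1 i; positivity
      · rw [← Finset.mul_sum, h2]; field_simp
      · simp only [mul_smul, ← Finset.smul_sum, h3]
        rw [smul_smul, mul_inv_cancel₀ hk.ne', one_smul]
  obtain ⟨t, h, ht, h0, h1, h2⟩ := ehrhart_lp V hV (d+1) (by rw [← hΔ, hdim])
  rw [← hΔ] at h1
  have hE0 : (latticePoints (((0:ℕ):ℝ) • Δ)).ncard = 1 := by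
    have : latticePoints (((0:ℕ):ℝ) • Δ) = {0} := by
      ext x
      have hne : Δ.Nonempty := by
        rw [hP] at h0P; obtain ⟨y, hy, -⟩ := h0P; exact ⟨y, hy⟩
      show coeLat x ∈ ((0:ℕ):ℝ) • Δ ↔ _
      rw [Nat.cast_zero, Set.zero_smul_set hne]
      constructor
      · intro hx
        have hx : coeLat x = 0 := hx
        apply coeLat_inj
        rw [hx]; ext i; simp [coeLat]
      · rintro rfl
        ext i; simp [coeLat]
    rw [this, Set.ncard_singleton]
  -- the functionals on the vertices
  let q1 : ℝ := ∑ i, t i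
  let q2 : Fin d → ℝ := ∑ i, t i • coeLat (i : Fin d → ℤ)
  have hq : ∑ i, t i • hv V i = (q1, q2) := sum_hv V t
  have hq1 : 0 < q1 := by
    obtain ⟨v, hv⟩ := hV
    exact Finset.sum_pos (fun i _ => ht i) ⟨⟨v, hv⟩, Finset.mem_univ _⟩
  have hvpos : ∀ u ∈ U, ∀ v ∈ V, 0 ≤ coeLat u ⬝ᵥ coeLat v + c u := by
    intro u hu v hv
    have h3 : coeLat v ∈ (1:ℝ) • Δ := by
      rw [one_smul, hΔ]; exact subset_convexHull ℝ _ ⟨v, hv, rfl⟩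
    have := (hmem 1 one_pos _).1 h3 u hu
    simpa using this
  have hUq : ∀ u ∈ U, 0 < coeLat u ⬝ᵥ q2 + c u * q1 := by
    intro u hu
    have e : coeLat u ⬝ᵥ q2 + c u * q1 = ∑ i : V, t i * (coeLat u ⬝ᵥ coeLat (i : Fin d → ℤ) + c u) := by
      simp only [q1, q2, dotProduct_sum, dotProduct_smul, smul_eq_mul, mul_add,
        Finset.sum_add_distrib, Finset.mul_sum]
      congr 1
      exact Finset.sum_congr rfl fun i _ => mul_comm _ _
    have hnn : ∀ i : V, 0 ≤ t i * (coeLat u ⬝ᵥ coeLat (i : Fin d → ℤ) + c u) :=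
      fun i => mul_nonneg (ht i).le (hvpos u hu i i.2)
    rw [e]
    refine lt_of_le_of_ne (Finset.sum_nonneg fun i _ => hnn i) fun hz => ?_
    have hz' := (Finset.sum_eq_zero_iff_of_nonneg fun i _ => hnn i).1 hz.symm
    have h3 : ∀ x ∈ P, 1 ≤ (-coeLat u) ⬝ᵥ x := by
      rw [hPS]
      apply conv_ge
      rintro _ ⟨_, ⟨v, hv, rfl⟩, rfl⟩
      have h4 := hz' ⟨v, hv⟩ (Finset.mem_univ _)
      have h5 : coeLat u ⬝ᵥ coeLat v + c u = 0 := by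
        rcases mul_eq_zero.1 h4 with h | h
        · exact absurd h (ht _).ne'
        · exact h
      rw [neg_dotProduct, dotProduct_sub, dotProduct_smul, smul_eq_mul]
      have h6 := hcR u hu
      have h7 : (r:ℝ) * (coeLat u ⬝ᵥ coeLat v + c u) = 0 := by rw [h5, mul_zero]
      linarith
    have := h3 0 h0P
    simp at this
    linarith
  -- perturbed sets
  have hpert : ∀ k : ℕ, {x : Fin d → ℤ | ∀ᶠ ε in nhdsWithin (0:ℝ) (Set.Ioi 0),
      inCone V (((k:ℝ), coeLat x) + ε • (-∑ i, t i • hv V i))} =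
      {x | 1 ≤ k ∧ ∀ u ∈ U, 1 ≤ u ⬝ᵥ x + c u * k} := by
    intro k
    ext x
    simp only [Set.mem_ofPred_eq, hq]
    have e : ∀ ε : ℝ, ((k:ℝ), coeLat x) + ε • (-(q1, q2)) = ((k:ℝ) - ε * q1, coeLat x - ε • q2) := by
      intro ε
      ext <;> simp [sub_eq_add_neg]
    simp only [e]
    have hval : ∀ u ∈ U, coeLat u ⬝ᵥ coeLat x + c u * k = ((u ⬝ᵥ x + c u * k : ℤ) : ℝ) := by
      intro u _; rw [coe_dot]; push_cast; rfl
    have hval2 : ∀ (ε : ℝ) u, coeLat u ⬝ᵥ (coeLat x - ε • q2) + c u * ((k:ℝ) - ε * q1) =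
        (coeLat u ⬝ᵥ coeLat x + c u * k) + ε * (-(coeLat u ⬝ᵥ q2 + c u * q1)) := by
      intro ε u
      rw [dotProduct_sub, dotProduct_smul, smul_eq_mul]; ring
    rcases Nat.eq_zero_or_pos k with hk | hk
    · subst hk
      refine iff_of_false ?_ (by rintro ⟨h, -⟩; omega)
      intro hcon
      obtain ⟨ε, ⟨l, hl0, hl⟩, hε⟩ := (hcon.and self_mem_nhdsWithin).exists
      have hε : 0 < ε := hε
      rw [sum_hv] at hl
      have := congrArg Prod.fst hl
      simp only at this
      have h5 : 0 ≤ ∑ i, l i := Finset.sum_nonneg fun i _ => hl0 i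
      have h6 := mul_pos hε hq1
      rw [this] at h5
      simp at h5
      linarith
    · have hk' : (0:ℝ) < k := by exact_mod_cast hk
      have hkpos : ∀ᶠ ε in nhdsWithin (0:ℝ) (Set.Ioi 0), 0 < (k:ℝ) - ε * q1 := by
        filter_upwards [ev_pos (k:ℝ) (-q1) (Or.inl hk')] with ε hε
        linarith
      simp only [Nat.succ_le_of_lt hk, true_and]
      constructor
      · intro hx u hu
        obtain ⟨ε, ⟨hx, hkp⟩, hε⟩ := ((hx.and hkpos).and self_mem_nhdsWithin).exists
        have hε : 0 < ε := hε
        have h5 := (hcone _ hkp _).1 hx u hu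
        rw [hval2, hval u hu] at h5
        have h6 := mul_pos hε (hUq u hu)
        have h7 : (0:ℝ) < ((u ⬝ᵥ x + c u * k : ℤ) : ℝ) := by linarith
        have : 0 < u ⬝ᵥ x + c u * k := by exact_mod_cast h7
        linarith
      · intro hx
        have h5 : ∀ᶠ ε in nhdsWithin (0:ℝ) (Set.Ioi 0), ∀ u ∈ U,
            0 < (coeLat u ⬝ᵥ coeLat x + c u * k) + ε * (-(coeLat u ⬝ᵥ q2 + c u * q1)) := by
          rw [Finset.eventually_all]
          intro u hu
          apply ev_pos
          left
          rw [hval u hu]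
          have := hx u hu
          exact_mod_cast (by linarith : 0 < u ⬝ᵥ x + c u * k)
        filter_upwards [h5, hkpos] with ε h5 h6
        rw [hcone _ h6]
        intro u hu
        rw [hval2]
        exact (h5 u hu).le
  have hpc : ∀ k : ℕ, {x : Fin d → ℤ | 1 ≤ k ∧ ∀ u ∈ U, 1 ≤ u ⬝ᵥ x + c u * k}.ncard =
      if r ≤ k then (latticePoints (((k - r : ℕ):ℝ) • Δ)).ncard else 0 := by
    intro k
    have hsh : ∀ x : Fin d → ℤ, ∀ u ∈ U, 1 ≤ u ⬝ᵥ x + c u * k ↔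
        0 ≤ u ⬝ᵥ (x - m) + c u * ((k:ℤ) - r) := by
      intro x u hu
      rw [dotProduct_sub]
      have := hc u hu
      constructor <;> intro h <;> nlinarith
    split_ifs with hk
    · rcases hk.lt_or_eq with hk | hk
      · symm
        apply Set.ncard_congr (fun x _ => x + m)
        · intro x hx
          refine ⟨by omega, fun u hu => ?_⟩
          rw [hsh _ u hu, add_sub_cancel_right]
          have hx : coeLat x ∈ ((k - r : ℕ):ℝ) • Δ := hx
          have := (hmem _ (by exact_mod_cast (by omega : 0 < k - r)) _).1 hx u hu
          rw [coe_dot, Nat.cast_sub hk.le] at this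
          exact_mod_cast this
        · intro x y _ _ hxy; simpa using hxy
        · rintro y ⟨-, hy⟩
          refine ⟨y - m, ?_, by simp⟩
          show coeLat (y - m) ∈ ((k - r : ℕ):ℝ) • Δ
          rw [hmem _ (by exact_mod_cast (by omega : 0 < k - r))]
          intro u hu
          have := (hsh _ u hu).1 (hy u hu)
          rw [coe_dot, Nat.cast_sub hk.le]
          exact_mod_cast this
      · subst hk
        rw [Nat.sub_self, hE0]
        rw [Set.ncard_eq_one]
        refine ⟨m, ?_⟩
        ext x
        constructor
        · rintro ⟨-, hx⟩
          have : coeLat (x - m) = 0 := by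
            apply no_recession hbd hU
            intro u hu
            have := (hsh _ u hu).1 (hx u hu)
            rw [coe_dot]
            simp only [sub_self, mul_zero, add_zero] at this
            exact_mod_cast this
          rw [coeLat_sub] at this
          exact coeLat_inj (sub_eq_zero.1 this)
        · rintro rfl
          refine ⟨hr, fun u hu => ?_⟩
          rw [hsh _ u hu]
          simp
    · have : {x : Fin d → ℤ | 1 ≤ k ∧ ∀ u ∈ U, 1 ≤ u ⬝ᵥ x + c u * k} = ∅ := by
        rw [Set.eq_empty_iff_forall_notMem]
        rintro x ⟨-, hx⟩
        have hkr : k < r := by omega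
        have hu1 : ∀ u ∈ U, (r:ℤ) - k ≤ u ⬝ᵥ ((r:ℤ) • (x - m) + ((r:ℤ) - k) • m) := by
          intro u hu
          have h3 := (hsh _ u hu).1 (hx u hu)
          have h4 := hc u hu
          rw [dotProduct_add, dotProduct_smul, dotProduct_smul, smul_eq_mul, smul_eq_mul]
          have h5 : 0 ≤ (r:ℤ) * (u ⬝ᵥ (x - m) + c u * ((k:ℤ) - r)) := mul_nonneg (by positivity) h3
          have h6 : (r:ℤ) * (u ⬝ᵥ (x - m) + c u * ((k:ℤ) - r)) =
            r * (u ⬝ᵥ (x - m)) + (r * c u) * ((k:ℤ) - r) := by ring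
          rw [h6, h4] at h5
          nlinarith
        have hz : coeLat ((r:ℤ) • (x - m) + ((r:ℤ) - k) • m) = 0 := by
          apply no_recession hbd hU
          intro u hu
          rw [coe_dot]
          have := hu1 u hu
          have : 0 ≤ u ⬝ᵥ ((r:ℤ) • (x - m) + ((r:ℤ) - k) • m) := by omega
          exact_mod_cast this
        obtain ⟨u, hu⟩ := hUne
        have h8 := hu1 u hu
        have hz' : ((r:ℤ) • (x - m) + ((r:ℤ) - k) • m) = 0 := by
          apply coeLat_inj; rw [hz]; ext i; simp [coeLat]
        rw [hz', dotProduct_zero] at h8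
        omega
      rw [this, Set.ncard_empty]
  have hhh : (fun j => if j ≤ d + 1 then h (d + 1 - j) else 0) =
      fun j => if r ≤ j then h (j - r) else 0 := by
    apply h_unique (d+1)
    intro k
    refine (h2 k).symm.trans ?_
    rw [hpert k, hpc k]
    refine Eq.trans ?_ (sum_antidiag_shift (d+1) r h k).symm
    split_ifs with hk
    · exact h1 _
    · rfl
  have hsym : ∀ i, i ≤ d + 1 → h i = if i ≤ 3 then h (3 - i) else 0 := by
    intro i hi
    have := congrFun hhh (d + 1 - i)
    rw [if_pos (by omega), show d + 1 - (d + 1 - i) = i by omega] at this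
    rw [this]
    by_cases h3 : i ≤ 3
    · rw [if_pos (by omega), if_pos h3]; congr 1; omega
    · rw [if_neg (by omega), if_neg h3]
  have hh0 : h 0 = 1 := by
    have := h1 0
    rw [hE0] at this
    have h3 := Finset.Nat.sum_antidiagonal_eq_sum_range_succ (fun i j => h i * (d+1).multichoose j) 0
    have h4 := this.trans h3
    simpa using h4.symm
  refine ⟨h, hh0, ?_, ?_, ?_, h1⟩
  · rw [hsym 2 (by omega)]; simp
  · rw [hsym 3 (by omega)]; simpa using hh0
  · intro i hi
    rcases Nat.lt_or_ge (d+1) i with h3 | h3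
    · exact h0 i h3
    · rw [hsym i h3, if_neg (by omega)]

end gor

/-- one dimensional local contribution (times 16) -/
def psi (q s : ℤ) : ℤ := 9 * (max (2*s-q) 0 + max (2*s+q) 0) - (max (2*s-3*q) 0 + max (2*s+3*q) 0)
  - 32 * max s 0

lemma psi_neg_right (q s : ℤ) : psi q (-s) = psi q s := by
  unfold psi; omega

lemma psi_neg_left (q s : ℤ) : psi (-q) s = psi q s := by
  unfold psi; omega

lemma psi_zero (q s : ℤ) (h : 3 * |q| ≤ 2 * |s|) : psi q s = 0 := by
  unfold psi
  simp only [abs_eq_max_neg] at h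
  omega

lemma psi_bound (q s : ℤ) : |psi q s| ≤ 100 * |q| := by
  unfold psi
  simp only [abs_eq_max_neg]
  omega

lemma psi_mul (l q s : ℤ) (hl : 0 ≤ l) : psi (l * q) (l * s) = l * psi q s := by
  unfold psi
  have h : ∀ x : ℤ, max (l * x) 0 = l * max x 0 := by
    intro x
    rw [mul_max_of_nonneg _ _ hl, mul_zero]
  rw [show 2 * (l * s) - l * q = l * (2*s-q) by ring, show 2 * (l * s) + l * q = l * (2*s+q) by ring,
    show 2 * (l * s) - 3 * (l * q) = l * (2*s-3*q) by ring,
    show 2 * (l * s) + 3 * (l * q) = l * (2*s+3*q) by ring, h, h, h, h, h]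
  ring

lemma sum_abs_Icc (N : ℕ) : ∑ s ∈ Finset.Icc (-(N:ℤ)) N, |s| = N * (N+1) := by
  induction N with
  | zero => simp
  | succ N ih =>
    have e : Finset.Icc (-((N+1:ℕ):ℤ)) ((N+1:ℕ):ℤ) =
        insert (-((N:ℤ)+1)) (insert ((N:ℤ)+1) (Finset.Icc (-(N:ℤ)) N)) := by
      ext x; simp; omega
    rw [e, Finset.sum_insert, Finset.sum_insert, ih, abs_neg, abs_of_nonneg (by positivity)]
    · push_cast; ring
    · simp
    · simp; omega

/-- symmetric second difference sum -/
lemma sum_phi (n N : ℕ) (h : n ≤ 2 * N + 1) :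
    ∑ s ∈ Finset.Icc (-(N:ℤ)) N, (|2*s - n| + |2*s+n| - 4*|s|) =
      n^2 + (if Odd n then 1 else 0) := by
  have hM : n = 2 * (n/2) ∨ n = 2 * (n/2) + 1 := by omega
  set M := n/2
  have e : ∑ s ∈ Finset.Icc (-(N:ℤ)) N, (|2*s - n| + |2*s+n| - 4*|s|) =
      ∑ s ∈ Finset.Icc (-(M:ℤ)) M, (2*(n:ℤ) - 4*|s|) := by
    rw [← Finset.sum_subset (s₁ := Finset.Icc (-(M:ℤ)) M) (s₂ := Finset.Icc (-(N:ℤ)) N)]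
    · apply Finset.sum_congr rfl
      intro s hs
      rw [Finset.mem_Icc] at hs
      simp only [abs_eq_max_neg]
      omega
    · intro s hs; rw [Finset.mem_Icc] at hs ⊢; omega
    · intro s hs hs'
      rw [Finset.mem_Icc] at hs hs'
      simp only [abs_eq_max_neg]
      omega
  rw [e, Finset.sum_sub_distrib, ← Finset.mul_sum _ (fun x => |x|), sum_abs_Icc, Finset.sum_const, Int.card_Icc]
  have hc : ((M:ℤ) + 1 - -(M:ℤ)).toNat = 2*M+1 := by omega
  rw [hc, nsmul_eq_mul]
  rcases hM with hM | hM
  · have : ¬ Odd n := by rw [hM]; simp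
    rw [if_neg this, hM]; push_cast; ring
  · have : Odd n := ⟨M, hM⟩
    rw [if_pos this, hM]; push_cast; ring

lemma psi_sum (q : ℤ) (N : ℕ) (h : 3 * |q| ≤ 2 * N) :
    ∑ s ∈ Finset.Icc (-(N:ℤ)) N, psi q s = if Odd q then 4 else 0 := by
  wlog hq : 0 ≤ q generalizing q
  · have := this (-q) (by rwa [abs_neg]) (by omega)
    simpa [psi_neg_left] using this
  obtain ⟨n, rfl⟩ := Int.eq_ofNat_of_zero_le hq
  rw [abs_of_nonneg hq] at h
  have h1 := sum_phi n N (by omega)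
  have h2 := sum_phi (3*n) N (by omega)
  have e : ∀ s, 2 * psi n s = 9 * (|2*s - n| + |2*s+n| - 4*|s|) -
      (|2*s - (3*n:ℕ)| + |2*s+(3*n:ℕ)| - 4*|s|) := by
    intro s; unfold psi; push_cast; simp only [abs_eq_max_neg]; omega
  have h3 : 2 * ∑ s ∈ Finset.Icc (-(N:ℤ)) N, psi n s = 9 * (n^2 + (if Odd n then 1 else 0)) -
      ((3*n:ℕ)^2 + (if Odd (3*n) then 1 else 0)) := by
    rw [Finset.mul_sum, ← h1, ← h2, Finset.mul_sum, ← Finset.sum_sub_distrib]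
    exact Finset.sum_congr rfl fun s _ => e s
  have ho : Odd (3*n) ↔ Odd n := by rw [Nat.odd_mul]; simp [show Odd 3 by decide]
  have ho' : Odd (n:ℤ) ↔ Odd n := Int.odd_coe_nat n
  simp only [ho] at h3
  simp only [ho']
  push_cast at h3
  split_ifs at h3 ⊢ <;> linarith

section par
variable {d : ℕ}

/-- `0/1` vectors -/
def rv (ρ : Fin d → Fin 2) : Fin d → ℤ := fun i => ((ρ i : ℕ) : ℤ)

lemma parity_sum (ν b : Fin d → ℤ) (hb : ν ⬝ᵥ b = 1) :
    2 * ∑ ρ : Fin d → Fin 2, (if Odd (ν ⬝ᵥ rv ρ) then (4:ℤ) else 0) = 4 * 2^d := by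
  classical
  have hodd : ∃ i, Odd (ν i) := by
    by_contra hcon
    push Not at hcon
    have : Even (ν ⬝ᵥ b) := by
      unfold dotProduct
      apply Finset.even_sum
      intro i _
      exact (Int.not_odd_iff_even.1 (hcon i)).mul_right _
    rw [hb] at this
    exact absurd this (by decide)
  obtain ⟨i, hi⟩ := hodd
  let e : (Fin d → Fin 2) → (Fin d → Fin 2) := fun ρ => Function.update ρ i (1 - ρ i)
  have he : Function.Involutive e := by
    intro ρ
    simp [e]
  have hval : ∀ ρ, ν ⬝ᵥ rv (e ρ) = ν ⬝ᵥ rv ρ + ν i * (1 - 2 * rv ρ i) := by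
    intro ρ
    have : rv (e ρ) = rv ρ + Pi.single i (1 - 2 * rv ρ i) := by
      ext j
      by_cases hj : j = i
      · subst hj
        simp only [rv, e, Function.update_self, Pi.add_apply, Pi.single_eq_same]
        have : ∀ x : Fin 2, (((1 - x : Fin 2) : ℕ) : ℤ) = (x:ℕ) + (1 - 2 * ((x:ℕ):ℤ)) := by decide
        exact this _
      · simp [rv, e, hj]
    rw [this, dotProduct_add, dotProduct_single]
  have hpar : ∀ ρ, Odd (ν ⬝ᵥ rv (e ρ)) ↔ ¬ Odd (ν ⬝ᵥ rv ρ) := by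
    intro ρ
    rw [hval, Int.odd_add, Int.not_odd_iff_even]
    have : ¬ Even (ν i * (1 - 2 * rv ρ i)) := by
      rw [Int.not_even_iff_odd]
      exact hi.mul (by rw [Int.odd_sub]; simp)
    simp only [this, iff_false, Int.not_odd_iff_even]
  have h1 : ∑ ρ : Fin d → Fin 2, (if Odd (ν ⬝ᵥ rv ρ) then (4:ℤ) else 0) =
      ∑ ρ : Fin d → Fin 2, (if Odd (ν ⬝ᵥ rv ρ) then (0:ℤ) else 4) := by
    rw [← (Equiv.sum_comp he.toPerm)]
    apply Finset.sum_congr rfl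
    intro ρ _
    show (if Odd (ν ⬝ᵥ rv (e ρ)) then (4:ℤ) else 0) = _
    simp only [hpar]
    split_ifs <;> simp_all
  rw [two_mul]
  nth_rewrite 2 [h1]
  rw [← Finset.sum_add_distrib]
  rw [Finset.sum_congr rfl (g := fun _ => (4:ℤ))]
  · simp; ring
  · intro ρ _; split_ifs <;> simp

/-- decomposition of `ℤ^d` modulo 2 -/
def divTwo : (Fin d → ℤ) ≃ (Fin d → ℤ) × (Fin d → Fin 2) :=
  (Equiv.piCongrRight fun _ => Int.divModEquiv 2).trans (Equiv.arrowProdEquivProdArrow _ _ _)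

lemma divTwo_symm (z : Fin d → ℤ) (ρ : Fin d → Fin 2) :
    divTwo.symm (z, ρ) = (2:ℤ) • z + rv ρ := by
  ext i
  simp [divTwo, Int.divModEquiv, rv, Equiv.arrowProdEquivProdArrow]
  ring

/-- The doubling identity. -/
lemma doubling (f1 f2 : (Fin d → ℤ) → ℤ) (h1 : (Function.support f1).Finite)
    (h2 : (Function.support f2).Finite) (h12 : ∀ z, f2 ((2:ℤ) • z) = 2 * f1 z) :
    16 * (∑ᶠ z, f2 z - 2^(d+1) * ∑ᶠ z, f1 z) = ∑ ρ : Fin d → Fin 2, ∑ᶠ z : Fin d → ℤ,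
      (9 * (f2 ((2:ℤ) • z + rv ρ) + f2 ((2:ℤ) • z - rv ρ)) -
        (f2 ((2:ℤ) • z + (3:ℤ) • rv ρ) + f2 ((2:ℤ) • z - (3:ℤ) • rv ρ)) - 16 * f2 ((2:ℤ) • z)) := by
  classical
  have hinj : ∀ w : Fin d → ℤ, Function.Injective fun z : Fin d → ℤ => (2:ℤ) • z + w := by
    intro w a b h
    have h : (2:ℤ) • a + w = (2:ℤ) • b + w := h
    have := add_right_cancel h
    exact smul_right_injective _ two_ne_zero this
  have hfs : ∀ w : Fin d → ℤ, (Function.support fun z : Fin d → ℤ => f2 ((2:ℤ) • z + w)).Finite := by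
    intro w
    exact (h2.preimage (hinj w).injOn)
  have hshift : ∀ ρ : Fin d → Fin 2, ∀ e : ℤ, ∑ᶠ z : Fin d → ℤ, f2 ((2:ℤ) • z + (2*e+1) • rv ρ) =
      ∑ᶠ z : Fin d → ℤ, f2 ((2:ℤ) • z + rv ρ) := by
    intro ρ e
    rw [← finsum_comp_equiv (Equiv.addRight (e • rv ρ)) (f := fun z => f2 ((2:ℤ) • z + rv ρ))]
    apply finsum_congr
    intro z
    congr 1
    simp only [Equiv.coe_addRight]
    module
  have hρ : ∀ ρ : Fin d → Fin 2, ∑ᶠ z : Fin d → ℤ,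
      (9 * (f2 ((2:ℤ) • z + rv ρ) + f2 ((2:ℤ) • z - rv ρ)) -
        (f2 ((2:ℤ) • z + (3:ℤ) • rv ρ) + f2 ((2:ℤ) • z - (3:ℤ) • rv ρ)) - 16 * f2 ((2:ℤ) • z)) =
      16 * ∑ᶠ z : Fin d → ℤ, f2 ((2:ℤ) • z + rv ρ) - 32 * ∑ᶠ z, f1 z := by
    intro ρ
    have a1 := hshift ρ (-1)
    have a2 := hshift ρ 1
    have a3 := hshift ρ (-2)
    obtain ⟨S, hS⟩ : ∃ S : Finset (Fin d → ℤ),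
        (Function.support fun z : Fin d → ℤ => f2 ((2:ℤ) • z + rv ρ)) ⊆ S ∧
        (Function.support fun z : Fin d → ℤ => f2 ((2:ℤ) • z + (2*(-1)+1:ℤ) • rv ρ)) ⊆ S ∧
        (Function.support fun z : Fin d → ℤ => f2 ((2:ℤ) • z + (2*1+1:ℤ) • rv ρ)) ⊆ S ∧
        (Function.support fun z : Fin d → ℤ => f2 ((2:ℤ) • z + (2*(-2)+1:ℤ) • rv ρ)) ⊆ S ∧
        Function.support f1 ⊆ S := by
      refine ⟨(((((hfs (rv ρ)).union (hfs ((2*(-1)+1:ℤ) • rv ρ))).union (hfs ((2*1+1:ℤ) • rv ρ))).union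
        (hfs ((2*(-2)+1:ℤ) • rv ρ))).union h1).toFinset, ?_⟩
      rw [Set.Finite.coe_toFinset]
      refine ⟨fun x hx => ?_, fun x hx => ?_, fun x hx => ?_, fun x hx => ?_, fun x hx => ?_⟩ <;>
      simp only [Set.mem_union, hx, true_or, or_true]
    obtain ⟨s1, s2, s3, s4, s5⟩ := hS
    rw [finsum_eq_sum_of_support_subset _ s1] at a1 a2 a3 ⊢
    rw [finsum_eq_sum_of_support_subset _ s2] at a1
    rw [finsum_eq_sum_of_support_subset _ s3] at a2
    rw [finsum_eq_sum_of_support_subset _ s4] at a3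
    rw [finsum_eq_sum_of_support_subset _ s5]
    have e1 : ∀ z : Fin d → ℤ, (2:ℤ) • z - rv ρ = (2:ℤ) • z + (2*(-1)+1:ℤ) • rv ρ := by
      intro z; module
    have e2 : ∀ z : Fin d → ℤ, (2:ℤ) • z + (3:ℤ) • rv ρ = (2:ℤ) • z + (2*1+1:ℤ) • rv ρ := by
      intro z; module
    have e3 : ∀ z : Fin d → ℤ, (2:ℤ) • z - (3:ℤ) • rv ρ = (2:ℤ) • z + (2*(-2)+1:ℤ) • rv ρ := by
      intro z; module
    simp only [e1, e2, e3, h12]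
    rw [finsum_eq_sum_of_support_subset (s := S)]
    · simp only [Finset.sum_sub_distrib, ← Finset.mul_sum, Finset.sum_add_distrib]
      rw [a1, a2, a3]; ring
    · intro z hz
      by_contra hzS
      have n1 := Function.notMem_support.1 (fun h => hzS (s1 h))
      have n2 := Function.notMem_support.1 (fun h => hzS (s2 h))
      have n3 := Function.notMem_support.1 (fun h => hzS (s3 h))
      have n4 := Function.notMem_support.1 (fun h => hzS (s4 h))
      have n5 := Function.notMem_support.1 (fun h => hzS (s5 h))
      apply hz
      simp only [n1, n2, n3, n4, n5]; norm_num
  have htot : ∑ᶠ z, f2 z = ∑ ρ : Fin d → Fin 2, ∑ᶠ z : Fin d → ℤ, f2 ((2:ℤ) • z + rv ρ) := by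
    rw [← finsum_comp_equiv (divTwo.symm.trans (Equiv.refl _)) (f := f2)]
    rw [← finsum_comp_equiv (Equiv.prodComm (Fin d → Fin 2) (Fin d → ℤ)), finsum_curry,
      finsum_eq_sum_of_fintype]
    · apply Finset.sum_congr rfl
      intro ρ _
      apply finsum_congr
      intro z
      show f2 (divTwo.symm (z, ρ)) = _
      rw [divTwo_symm]
    · exact h2.preimage (f := ((Equiv.prodComm (Fin d → Fin 2) (Fin d → ℤ)).trans
        (divTwo.symm.trans (Equiv.refl _)))) ((Equiv.injective _).injOn)
  rw [Finset.sum_congr rfl (fun ρ _ => hρ ρ), Finset.sum_sub_distrib, ← Finset.mul_sum, ← htot]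
  simp
  ring

end par

section cnt
variable {d : ℕ}

/-- Data of a support function of finitely many lattice vectors. -/
structure WD (d : ℕ) where
  A : Finset (Fin d → ℤ)
  g : (Fin d → ℤ) → ℤ
  C : ℕ
  le : ∀ a ∈ A, ∀ z, a ⬝ᵥ z ≤ g z
  ex : ∀ z, ∃ a ∈ A, a ⬝ᵥ z = g z
  bd : ∀ z i, |z i| ≤ C * g z
  nn : ∀ z, 0 ≤ g z

/-- linear independence through a minor -/
def Ind (a b : Fin d → ℤ) : Prop := ∃ i j, a i * b j ≠ a j * b i

/-- families of finite sets of polynomial growth -/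
def OO {α : Type*} (p : ℕ) (X : ℕ → Set α) : Prop :=
  ∃ C : ℕ, ∀ᶠ K in atTop, (X K).Finite ∧ (X K).ncard ≤ C * K^p

lemma OO.mono {α : Type*} {p : ℕ} {X Y : ℕ → Set α} (hY : OO p Y)
    (h : ∀ᶠ K in atTop, X K ⊆ Y K) : OO p X := by
  obtain ⟨C, hC⟩ := hY
  refine ⟨C, ?_⟩
  filter_upwards [hC, h] with K h1 h2
  exact ⟨h1.1.subset h2, (Set.ncard_le_ncard h2 h1.1).trans h1.2⟩

lemma OO.union {α : Type*} {p : ℕ} {X Y : ℕ → Set α} (hX : OO p X) (hY : OO p Y) :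
    OO p fun K => X K ∪ Y K := by
  obtain ⟨C, hC⟩ := hX
  obtain ⟨C', hC'⟩ := hY
  refine ⟨C + C', ?_⟩
  filter_upwards [hC, hC'] with K h1 h2
  refine ⟨h1.1.union h2.1, (Set.ncard_union_le _ _).trans ?_⟩
  rw [add_mul]
  exact add_le_add h1.2 h2.2

lemma OO.biUnion {α ι : Type*} {p : ℕ} (T : Finset ι) {Y : ι → ℕ → Set α}
    (hY : ∀ t ∈ T, OO p (Y t)) : OO p fun K => ⋃ t ∈ T, Y t K := by
  classical
  induction T using Finset.induction_on with
  | empty => exact ⟨0, by simp⟩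
  | insert t T ht ih =>
    have h1 := ih fun s hs => hY s (Finset.mem_insert_of_mem hs)
    have h2 := (hY t (Finset.mem_insert_self _ _)).union h1
    refine h2.mono (Eventually.of_forall fun K => ?_)
    rw [Finset.set_biUnion_insert]

lemma OO.empty {α : Type*} {p : ℕ} {X : ℕ → Set α} (h : ∀ᶠ K in atTop, X K = ∅) : OO p X := by
  refine ⟨0, ?_⟩
  filter_upwards [h] with K hK
  rw [hK]; simp

lemma count2 {p : ℕ} (hd : d = p + 2) (a b : Fin d → ℤ) (hab : Ind a b) (R N : ℕ)
    (α β : ℤ) :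
    {z : Fin d → ℤ | (∀ i, |z i| ≤ N) ∧ |a ⬝ᵥ z - α| ≤ R ∧ |b ⬝ᵥ z - β| ≤ R}.Finite ∧
    {z : Fin d → ℤ | (∀ i, |z i| ≤ N) ∧ |a ⬝ᵥ z - α| ≤ R ∧ |b ⬝ᵥ z - β| ≤ R}.ncard ≤
      (2*R+1)^2 * (2*N+1)^p := by
  classical
  set S := {z : Fin d → ℤ | (∀ i, |z i| ≤ N) ∧ |a ⬝ᵥ z - α| ≤ R ∧ |b ⬝ᵥ z - β| ≤ R}
  obtain ⟨i, j, hij⟩ := hab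
  have hne : i ≠ j := by rintro rfl; exact hij (by ring)
  let φ : (Fin d → ℤ) → (Fin d → ℤ) := fun z k =>
    if k = i then a ⬝ᵥ z - α else if k = j then b ⬝ᵥ z - β else z k
  let T : Finset (Fin d → ℤ) := Fintype.piFinset fun k =>
    if k = i then Finset.Icc (-(R:ℤ)) R else if k = j then Finset.Icc (-(R:ℤ)) R
      else Finset.Icc (-(N:ℤ)) N
  have hmaps : ∀ z ∈ S, φ z ∈ (T : Set (Fin d → ℤ)) := by
    rintro z ⟨h1, h2, h3⟩
    simp only [T, Finset.mem_coe, Fintype.mem_piFinset]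
    intro k
    simp only [φ]
    split_ifs
    · exact Finset.mem_Icc.2 (abs_le.1 h2)
    · exact Finset.mem_Icc.2 (abs_le.1 h3)
    · exact Finset.mem_Icc.2 (abs_le.1 (h1 k))
  have hinj : Set.InjOn φ S := by
    intro z _ w _ hzw
    have e1 : a ⬝ᵥ z = a ⬝ᵥ w := by
      have := congrFun hzw i
      simpa [φ] using this
    have e2 : b ⬝ᵥ z = b ⬝ᵥ w := by
      have := congrFun hzw j
      simpa [φ, hne.symm] using this
    have e3 : ∀ k, k ≠ i → k ≠ j → z k = w k := by
      intro k h1 h2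
      have := congrFun hzw k
      simpa [φ, h1, h2] using this
    have hs : ∀ c : Fin d → ℤ, c ⬝ᵥ z = c ⬝ᵥ w → c i * (z i - w i) + c j * (z j - w j) = 0 := by
      intro c hc
      have h0 : c ⬝ᵥ (z - w) = 0 := by rw [dotProduct_sub, hc, sub_self]
      unfold dotProduct at h0
      rw [← Finset.sum_subset (Finset.subset_univ {i, j})] at h0
      · rw [Finset.sum_pair hne] at h0
        simpa using h0
      · intro k _ hk
        simp only [Finset.mem_insert, Finset.mem_singleton, not_or] at hk
        rw [Pi.sub_apply, e3 k hk.1 hk.2, sub_self, mul_zero]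
    have f1 := hs a e1
    have f2 := hs b e2
    have hdet : a i * b j - a j * b i ≠ 0 := sub_ne_zero.2 hij
    have g1 : (a i * b j - a j * b i) * (z i - w i) = 0 := by linear_combination b j * f1 - a j * f2
    have g2 : (a i * b j - a j * b i) * (z j - w j) = 0 := by linear_combination a i * f2 - b i * f1
    have g1 := (mul_eq_zero.1 g1).resolve_left hdet
    have g2 := (mul_eq_zero.1 g2).resolve_left hdet
    ext k
    by_cases hki : k = i
    · rw [hki]; linarith
    by_cases hkj : k = j
    · rw [hkj]; linarith
    exact e3 k hki hkj
  have hfin : S.Finite := Set.Finite.of_finite_image (T.finite_toSet.subset (Set.image_subset_iff.2 hmaps)) hinj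
  refine ⟨hfin, ?_⟩
  have h1 : S.ncard ≤ (T : Set (Fin d → ℤ)).ncard :=
    Set.ncard_le_ncard_of_injOn φ hmaps hinj T.finite_toSet
  refine h1.trans ?_
  rw [Set.ncard_coe_finset, Fintype.card_piFinset]
  have hcard : ∀ M : ℕ, (Finset.Icc (-(M:ℤ)) M).card = 2*M+1 := by
    intro M; rw [Int.card_Icc]; omega
  rw [← Finset.mul_prod_erase _ _ (Finset.mem_univ i),
    ← Finset.mul_prod_erase _ _ (Finset.mem_erase.2 ⟨hne.symm, Finset.mem_univ j⟩)]
  have : ∏ k ∈ (Finset.univ.erase i).erase j, (if k = i then Finset.Icc (-(R:ℤ)) R else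
      if k = j then Finset.Icc (-(R:ℤ)) R else Finset.Icc (-(N:ℤ)) N).card = (2*N+1)^p := by
    rw [Finset.prod_congr rfl (g := fun _ => 2*N+1)]
    · rw [Finset.prod_const]
      congr 1
      rw [Finset.card_erase_of_mem (Finset.mem_erase.2 ⟨hne.symm, Finset.mem_univ j⟩),
        Finset.card_erase_of_mem (Finset.mem_univ i), Finset.card_univ, Fintype.card_fin]
      omega
    · intro k hk
      simp only [Finset.mem_erase, Finset.mem_univ, and_true] at hk
      rw [if_neg hk.2, if_neg hk.1, hcard]
  rw [this]
  simp only [if_true, if_neg hne.symm, hcard]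
  apply le_of_eq
  ring

variable (W : WD d)

lemma WD.lev_finite (N : ℤ) : {z | W.g z ≤ N}.Finite := by
  apply (Set.finite_Icc (fun _ : Fin d => -(W.C * N)) (fun _ => W.C * N)).subset
  intro z hz
  have hz : W.g z ≤ N := hz
  have h : ∀ i, |z i| ≤ W.C * N := fun i =>
    (W.bd z i).trans (mul_le_mul_of_nonneg_left hz (by positivity))
  exact ⟨fun i => (abs_le.1 (h i)).1, fun i => (abs_le.1 (h i)).2⟩

/-- basic growth estimate -/
lemma WD.oo2 {p : ℕ} (hd : d = p + 2) (a b : Fin d → ℤ) (hab : Ind a b) (R : ℕ) (α β : ℕ → ℤ) :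
    OO p fun K : ℕ => {z : Fin d → ℤ | W.g z ≤ K + R ∧ |a ⬝ᵥ z - α K| ≤ R ∧ |b ⬝ᵥ z - β K| ≤ R} := by
  refine ⟨(2*R+1)^2 * (3 * ((W.C+1) * (1 + R)))^p, ?_⟩
  filter_upwards [eventually_ge_atTop 1] with K hK
  have h := count2 hd a b hab R ((W.C+1) * (1 + R) * K) (α K) (β K)
  have hsub : {z : Fin d → ℤ | W.g z ≤ K + R ∧ |a ⬝ᵥ z - α K| ≤ R ∧ |b ⬝ᵥ z - β K| ≤ R} ⊆
      {z : Fin d → ℤ | (∀ i, |z i| ≤ ((W.C+1) * (1 + R) * K : ℕ)) ∧ |a ⬝ᵥ z - α K| ≤ R ∧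
        |b ⬝ᵥ z - β K| ≤ R} := by
    rintro z ⟨h1, h2⟩
    refine ⟨fun i => ?_, h2⟩
    refine (W.bd z i).trans ?_
    have h3 : (W.g z) ≤ (1 + R) * K := by
      have : (R:ℤ) ≤ R * K := by
        have : (1:ℤ) ≤ K := by exact_mod_cast hK
        nlinarith
      linarith
    have h4 := W.nn z
    push_cast
    have h5 : (W.C : ℤ) * W.g z ≤ (W.C+1) * W.g z := by linarith
    have h6 : ((W.C:ℤ)+1) * W.g z ≤ (W.C+1) * ((1 + R) * K) :=
      mul_le_mul_of_nonneg_left h3 (by positivity)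
    linarith
  refine ⟨h.1.subset hsub, (Set.ncard_le_ncard hsub h.1).trans (h.2.trans ?_)⟩
  rw [mul_assoc ((2*R+1)^2)]
  apply Nat.mul_le_mul_left
  rw [← mul_pow]
  apply Nat.pow_le_pow_left
  have : 1 ≤ (W.C+1) * (1+R) * K := by
    have : 1 ≤ (W.C+1) * (1+R) := Nat.mul_pos (by omega) (by omega)
    exact Nat.mul_pos this hK
  linarith

/-- within distance `R` of the maximum -/
def WD.near (R : ℕ) (z a : Fin d → ℤ) : Prop := W.g z - R ≤ a ⬝ᵥ z

lemma WD.bad3 {p : ℕ} (hd : d = p + 2) (R : ℕ)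
    (h3 : ∀ a ∈ W.A, ∀ b ∈ W.A, ∀ c ∈ W.A, a ≠ b → a ≠ c → b ≠ c → Ind (a - b) (a - c)) :
    OO p fun K : ℕ => {z : Fin d → ℤ | W.g z ≤ K + R ∧ ∃ a ∈ W.A, ∃ b ∈ W.A, ∃ c ∈ W.A,
      a ≠ b ∧ a ≠ c ∧ b ≠ c ∧ W.near R z a ∧ W.near R z b ∧ W.near R z c} := by
  classical
  have h := OO.biUnion (p := p) ((W.A ×ˢ W.A ×ˢ W.A).filter fun t => t.1 ≠ t.2.1 ∧ t.1 ≠ t.2.2 ∧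
    t.2.1 ≠ t.2.2) (Y := fun t (K : ℕ) => {z : Fin d → ℤ | W.g z ≤ K + R ∧
      |(t.1 - t.2.1) ⬝ᵥ z - 0| ≤ R ∧ |(t.1 - t.2.2) ⬝ᵥ z - 0| ≤ R}) (by
    rintro ⟨a, b, c⟩ ht
    simp only [Finset.mem_filter, Finset.mem_product] at ht
    exact W.oo2 hd _ _ (h3 a ht.1.1 b ht.1.2.1 c ht.1.2.2 ht.2.1 ht.2.2.1 ht.2.2.2) R
      (fun _ => 0) (fun _ => 0))
  refine h.mono (Eventually.of_forall fun K => ?_)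
  rintro z ⟨h1, a, ha, b, hb, c, hc, hab, hac, hbc, na, nb, nc⟩
  rw [Set.mem_iUnion₂]
  refine ⟨(a, b, c), by simp [*], h1, ?_, ?_⟩
  · have := W.le a ha z
    have := W.le b hb z
    unfold WD.near at na nb
    rw [sub_dotProduct, abs_le]; constructor <;> linarith
  · have := W.le a ha z
    have := W.le c hc z
    unfold WD.near at na nc
    rw [sub_dotProduct, abs_le]; constructor <;> linarith

lemma WD.bad2 {p : ℕ} (hd : d = p + 2) (R : ℕ)
    (h2 : ∀ a ∈ W.A, ∀ b ∈ W.A, a ≠ b → b = -a ∨ Ind a b) :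
    OO p fun K : ℕ => {z : Fin d → ℤ | (K:ℤ) - R ≤ W.g z ∧ W.g z ≤ K + R ∧ ∃ a ∈ W.A, ∃ b ∈ W.A,
      a ≠ b ∧ W.near R z a ∧ W.near R z b} := by
  classical
  have h := OO.biUnion (p := p) ((W.A ×ˢ W.A).filter fun t => t.1 ≠ t.2)
    (Y := fun t (K : ℕ) => {z : Fin d → ℤ | W.g z ≤ K + (2*R:ℕ) ∧
      |t.1 ⬝ᵥ z - K| ≤ (2*R:ℕ) ∧ |t.2 ⬝ᵥ z - K| ≤ (2*R:ℕ)}) (by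
    rintro ⟨a, b⟩ ht
    simp only [Finset.mem_filter, Finset.mem_product] at ht
    rcases h2 a ht.1.1 b ht.1.2 ht.2 with h | h
    · apply OO.empty
      filter_upwards [eventually_gt_atTop (2*R)] with K hK
      rw [Set.eq_empty_iff_forall_notMem]
      rintro z ⟨-, h4, h5⟩
      simp only [h] at h5
      rw [neg_dotProduct, abs_le] at h5
      rw [abs_le] at h4
      push_cast at h4 h5
      have h6 : (2 * R : ℤ) < K := by exact_mod_cast hK
      linarith [h4.1, h5.1]
    · exact W.oo2 hd _ _ h (2*R) (fun K => K) (fun K => K))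
  refine h.mono (Eventually.of_forall fun K => ?_)
  rintro z ⟨h0, h1, a, ha, b, hb, hab, na, nb⟩
  rw [Set.mem_iUnion₂]
  have e1 := W.le a ha z
  have e2 := W.le b hb z
  unfold WD.near at na nb
  refine ⟨(a, b), by simp [*], ?_, ?_, ?_⟩
  · push_cast; linarith
  · rw [abs_le]; push_cast; constructor <;> linarith
  · rw [abs_le]; push_cast; constructor <;> linarith

end cnt

section loc
variable {d : ℕ} (W : WD d)

/-- tent functions -/
def WD.f (K : ℤ) (z : Fin d → ℤ) : ℤ := max (K - W.g z) 0

/-- the local defect -/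
def WD.D (K : ℤ) (w z : Fin d → ℤ) : ℤ :=
  9 * (W.f (2*K) ((2:ℤ) • z + w) + W.f (2*K) ((2:ℤ) • z - w)) -
        (W.f (2*K) ((2:ℤ) • z + (3:ℤ) • w) + W.f (2*K) ((2:ℤ) • z - (3:ℤ) • w)) -
        16 * W.f (2*K) ((2:ℤ) • z)

/-- only `a` is near -/
def WD.Na (R : ℕ) (a z : Fin d → ℤ) : Prop := ∀ b ∈ W.A, W.near R z b → b = a
/-- only the two are near, below level `K` -/
def WD.Nab (R : ℕ) (K : ℤ) (x : (Fin d → ℤ) × (Fin d → ℤ)) (z : Fin d → ℤ) : Prop :=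
  (∀ b ∈ W.A, W.near R z b → b = x.1 ∨ b = x.2) ∧ W.g z ≤ K

open Classical in
/-- the main term -/
def WD.M (R : ℕ) (K : ℤ) (w z : Fin d → ℤ) : ℤ :=
  2 * ∑ a ∈ W.A, (if W.Na R a z then psi (a ⬝ᵥ w) (K - a ⬝ᵥ z) else 0) -
    ∑ x ∈ W.A.offDiag, (if W.Nab R K x z then psi ((x.1 - x.2) ⬝ᵥ w) ((x.1 - x.2) ⬝ᵥ z) else 0)

variable {W}

lemma WD.g_le {y : Fin d → ℤ} {M : ℤ} (h : ∀ b ∈ W.A, b ⬝ᵥ y ≤ M) : W.g y ≤ M := by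
  obtain ⟨a, ha, h1⟩ := W.ex y
  rw [← h1]; exact h a ha

lemma WD.dot2 (a z w : Fin d → ℤ) (c : ℤ) : a ⬝ᵥ ((2:ℤ) • z + c • w) = 2 * (a ⬝ᵥ z) + c * (a ⬝ᵥ w) := by
  rw [dotProduct_add, dotProduct_smul, dotProduct_smul, smul_eq_mul, smul_eq_mul]

lemma WD.D_eq (K : ℤ) (w z : Fin d → ℤ) (G : ℤ → ℤ)
    (hG : ∀ c, |c| ≤ 3 → W.g ((2:ℤ) • z + c • w) = G c) :
    W.D K w z = 9 * (max (2*K - G 1) 0 + max (2*K - G (-1)) 0) -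
      (max (2*K - G 3) 0 + max (2*K - G (-3)) 0) - 16 * max (2*K - G 0) 0 := by
  have e1 := hG 1 (by norm_num)
  have e2 := hG (-1) (by norm_num)
  have e3 := hG 3 (by norm_num)
  have e4 := hG (-3) (by norm_num)
  have e5 := hG 0 (by norm_num)
  unfold WD.D WD.f
  rw [← e1, ← e2, ← e3, ← e4, ← e5]
  simp only [one_smul, neg_smul, zero_smul, add_zero, ← sub_eq_add_neg]

lemma mul_bd {c q : ℤ} {L : ℕ} (hc : |c| ≤ 3) (hq : |q| ≤ L) : -(3 * (L:ℤ)) ≤ c * q ∧ c * q ≤ 3 * L := by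
  apply abs_le.1
  rw [abs_mul]
  exact mul_le_mul hc hq (abs_nonneg _) (by norm_num)

lemma WD.caseI {K : ℤ} {w z : Fin d → ℤ} {L R : ℕ} (hL : ∀ a ∈ W.A, |a ⬝ᵥ w| ≤ L) (hR : 3 * L ≤ R)
    {a : Fin d → ℤ} (ha : a ∈ W.A) (h : W.Na R a z) : W.D K w z = psi (a ⬝ᵥ w) (K - a ⬝ᵥ z) := by
  have haz : W.g z = a ⬝ᵥ z := by
    obtain ⟨b, hb, h1⟩ := W.ex z
    have := h b hb (by unfold WD.near; omega)
    rw [← h1, this]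
  rw [WD.D_eq K w z fun c => 2 * (a ⬝ᵥ z) + c * (a ⬝ᵥ w)]
  · unfold psi; 
    generalize a ⬝ᵥ w = q
    generalize a ⬝ᵥ z = s
    omega
  · intro c hc
    apply le_antisymm
    · apply WD.g_le
      intro b hb
      rw [WD.dot2]
      by_cases hba : b = a
      · rw [hba]
      · have h1 : ¬ W.near R z b := fun h2 => hba (h b hb h2)
        unfold WD.near at h1
        have := mul_bd hc (hL b hb)
        have := mul_bd hc (hL a ha)
        omega
    · rw [← WD.dot2]; exact W.le a ha _

lemma WD.caseII {K : ℤ} {w z : Fin d → ℤ} {L R : ℕ} (hL : ∀ a ∈ W.A, |a ⬝ᵥ w| ≤ L) (hR : 3 * L ≤ R)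
    {a a' : Fin d → ℤ} (ha : a ∈ W.A) (ha' : a' ∈ W.A) (h : ∀ b ∈ W.A, W.near R z b → b = a ∨ b = a')
    (hg : W.g z ≤ K - R) : W.D K w z = - psi ((a - a') ⬝ᵥ w) ((a - a') ⬝ᵥ z) := by
  have haz : W.g z = a ⬝ᵥ z ∨ W.g z = a' ⬝ᵥ z := by
    obtain ⟨b, hb, h1⟩ := W.ex z
    rcases h b hb (by unfold WD.near; omega) with h | h
    · left; rw [← h1, h]
    · right; rw [← h1, h]
  have l1 := W.le a ha z
  have l2 := W.le a' ha' z
  have q1 := mul_bd (show |(1:ℤ)| ≤ 3 by norm_num) (hL a ha)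
  have q2 := mul_bd (show |(1:ℤ)| ≤ 3 by norm_num) (hL a' ha')
  have q3 := mul_bd (show |(3:ℤ)| ≤ 3 by norm_num) (hL a ha)
  have q4 := mul_bd (show |(3:ℤ)| ≤ 3 by norm_num) (hL a' ha')
  rw [WD.D_eq K w z fun c => max (2 * (a ⬝ᵥ z) + c * (a ⬝ᵥ w)) (2 * (a' ⬝ᵥ z) + c * (a' ⬝ᵥ w))]
  · unfold psi
    rw [sub_dotProduct, sub_dotProduct]
    generalize a ⬝ᵥ w = q at *
    generalize a ⬝ᵥ z = s at *
    generalize a' ⬝ᵥ w = q' at *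
    generalize a' ⬝ᵥ z = s' at *
    clear h hL
    have m1 : ∀ c : ℤ, max (2 * s + c * q) (2 * s' + c * q') = 2 * s' + c * q' + max (2 * (s - s') + c * (q - q')) 0 := by
      intro c
      have : 2 * s + c * q = 2 * s' + c * q' + (2 * (s - s') + c * (q - q')) := by ring
      rw [this]; omega
    have m2 : ∀ c : ℤ, -(3 * (L:ℤ)) ≤ c * q → c * q ≤ 3 * L → -(3 * (L:ℤ)) ≤ c * q' → c * q' ≤ 3 * L → 
        max (2*K - max (2 * s + c * q) (2 * s' + c * q')) 0 = 2 * K - max (2 * s + c * q) (2 * s' + c * q') := by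
      intro c _ _ _ _
      omega
    rw [m2 1 (by omega) (by omega) (by omega) (by omega), m2 (-1) (by omega) (by omega) (by omega) (by omega),
      m2 3 (by omega) (by omega) (by omega) (by omega), m2 (-3) (by omega) (by omega) (by omega) (by omega),
      m2 0 (by omega) (by omega) (by omega) (by omega), m1, m1, m1, m1, m1]
    clear m1 m2
    generalize s - s' = u
    generalize q - q' = v
    have e1 : max (2 * u + 0 * v) 0 = 2 * max u 0 := by omega
    rw [e1, show 2 * u + 1 * v = 2 * u + v by ring, show 2 * u + -1 * v = 2 * u - v by ring, show 2 * u + -3 * v = 2 * u - 3 * v by ring]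
    ring
  · intro c hc
    have r1 := mul_bd hc (hL a ha)
    have r2 := mul_bd hc (hL a' ha')
    apply le_antisymm
    · apply WD.g_le
      intro b hb
      rw [WD.dot2]
      by_cases hn : W.near R z b
      · rcases h b hb hn with h | h <;> rw [h]
        · exact le_max_left _ _
        · exact le_max_right _ _
      · unfold WD.near at hn
        have r3 := mul_bd hc (hL b hb)
        omega
    · apply max_le
      · rw [← WD.dot2]; exact W.le a ha _
      · rw [← WD.dot2]; exact W.le a' ha' _

lemma WD.caseIII {K : ℤ} {w z : Fin d → ℤ} {L R : ℕ} (hL : ∀ a ∈ W.A, |a ⬝ᵥ w| ≤ L) (hR : 3 * L ≤ R)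
    (hg : K + R ≤ W.g z) : W.D K w z = 0 := by
  have h : ∀ c : ℤ, |c| ≤ 3 → max (2 * K - W.g ((2:ℤ) • z + c • w)) 0 = 0 := by
    intro c hc
    obtain ⟨a, ha, h1⟩ := W.ex z
    have := W.le a ha ((2:ℤ) • z + c • w)
    rw [WD.dot2] at this
    have := mul_bd hc (hL a ha)
    omega
  rw [WD.D_eq K w z (fun c => W.g ((2:ℤ) • z + c • w)) (fun _ _ => rfl), h 1 (by norm_num), h (-1) (by norm_num),
    h 3 (by norm_num), h (-3) (by norm_num), h 0 (by norm_num)]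
  norm_num

/-- the bad set -/
def WD.Bad (W : WD d) (R : ℕ) (K : ℤ) : Set (Fin d → ℤ) :=
  {z : Fin d → ℤ | W.g z ≤ K + R ∧ ∃ a ∈ W.A, ∃ b ∈ W.A, ∃ c ∈ W.A,
      a ≠ b ∧ a ≠ c ∧ b ≠ c ∧ W.near R z a ∧ W.near R z b ∧ W.near R z c} ∪
  {z : Fin d → ℤ | K - R ≤ W.g z ∧ W.g z ≤ K + R ∧ ∃ a ∈ W.A, ∃ b ∈ W.A,
      a ≠ b ∧ W.near R z a ∧ W.near R z b}

lemma WD.local {K : ℤ} {w z : Fin d → ℤ} {L R : ℕ} (hL : ∀ a ∈ W.A, |a ⬝ᵥ w| ≤ L) (hR : 3 * L ≤ R)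
    (hz : W.g z ≤ K + R) (hbad : z ∉ W.Bad R K) : 2 * W.D K w z = W.M R K w z := by
  classical
  obtain ⟨a, ha, haz⟩ := W.ex z
  have hna : W.near R z a := by unfold WD.near; omega
  unfold WD.M
  by_cases h : W.Na R a z
  · rw [WD.caseI hL hR ha h, Finset.sum_eq_single a, if_pos h, Finset.sum_eq_zero]
    · ring
    · rintro ⟨x, y⟩ hx
      rw [Finset.mem_offDiag] at hx
      split_ifs with hN
      · apply psi_zero
        simp only [sub_dotProduct]
        have b1 := hL x hx.1
        have b2 := hL y hx.2.1
        simp only at hx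
        rcases hN.1 a ha hna with h1 | h1
        · have : ¬ W.near R z y := fun h2 => hx.2.2 ((h1.symm.trans (h y hx.2.1 h2).symm))
          unfold WD.near at this
          simp only at h1
          rw [h1] at haz
          simp only [abs_eq_max_neg] at *
          omega
        · have : ¬ W.near R z x := fun h2 => hx.2.2 ((h x hx.1 h2).trans h1)
          unfold WD.near at this
          simp only at h1
          rw [h1] at haz
          simp only [abs_eq_max_neg] at *
          omega
      · rfl
    · intro b hb hba
      rw [if_neg]
      intro hN
      exact hba (hN a ha hna).symm
    · intro h; exact absurd ha h
  · unfold WD.Na at h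
    push Not at h
    obtain ⟨a', ha', hna', hne⟩ := h
    have hu : ∀ b ∈ W.A, W.near R z b → b = a ∨ b = a' := by
      intro b hb hnb
      by_contra hcon
      push Not at hcon
      exact hbad (Or.inl ⟨hz, a, ha, a', ha', b, hb, hne.symm, hcon.1.symm, hcon.2.symm, hna, hna', hnb⟩)
    have hgz : W.g z ≤ K - R := by
      by_contra hcon
      exact hbad (Or.inr ⟨by omega, hz, a, ha, a', ha', hne.symm, hna, hna'⟩)
    rw [WD.caseII hL hR ha ha' hu hgz, Finset.sum_eq_zero, Finset.sum_eq_add_of_mem (a, a') (a', a)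
      (by rw [Finset.mem_offDiag]; exact ⟨ha, ha', hne.symm⟩) (by rw [Finset.mem_offDiag]; exact ⟨ha', ha, hne⟩),
      if_pos, if_pos]
    · simp only
      rw [show a' - a = -(a - a') by abel, neg_dotProduct, neg_dotProduct, psi_neg_left, psi_neg_right]
      ring
    · exact ⟨fun b hb h => (hu b hb h).symm, by omega⟩
    · exact ⟨fun b hb h => (hu b hb h), by omega⟩
    · intro h; exact hne (Prod.ext_iff.1 h).2
    · rintro ⟨x, y⟩ hx ⟨h1, h2⟩
      rw [if_neg]
      rintro ⟨h3, -⟩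
      have e1 := h3 a ha hna
      have e2 := h3 a' ha' hna'
      simp only at e1 e2
      rw [Finset.mem_offDiag] at hx
      rcases e1 with e1 | e1 <;> rcases e2 with e2 | e2
      · exact hne (e2.trans e1.symm)
      · exact h1 (by rw [e1, e2])
      · exact h2 (by rw [e1, e2])
      · exact hne (e2.trans e1.symm)
    · intro b hb
      rw [if_neg]
      intro hN
      exact hne ((hN a' ha' hna').trans (hN a ha hna).symm)

end loc

lemma tendsto_shift_ratio (c : ℤ) : Tendsto (fun K : ℕ => ((((K:ℤ) + c).toNat : ℕ) : ℝ) / K) atTop (nhds 1) := by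
  have h1 : Tendsto (fun K : ℕ => 1 + (c:ℝ) / K) atTop (nhds (1 + 0)) :=
    tendsto_const_nhds.add (tendsto_const_nhds.div_atTop tendsto_natCast_atTop_atTop)
  rw [add_zero] at h1
  refine h1.congr' ?_
  filter_upwards [eventually_ge_atTop (c.natAbs + 1)] with K hK
  have hK0 : (K:ℝ) ≠ 0 := by
    have : 0 < K := by omega
    positivity
  have : ((((K:ℤ) + c).toNat : ℕ) : ℝ) = K + c := by
    have h : ((((K:ℤ) + c).toNat : ℕ) : ℤ) = K + c := Int.toNat_of_nonneg (by omega)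
    exact_mod_cast h
  rw [this]
  field_simp

lemma tendsto_shift_atTop (c : ℤ) : Tendsto (fun K : ℕ => ((K:ℤ) + c).toNat) atTop atTop := by
  rw [tendsto_atTop]
  intro b
  filter_upwards [eventually_ge_atTop (c.natAbs + b)] with K hK
  omega

lemma tendsto_shift {u : ℕ → ℝ} {q : ℕ} {l : ℝ} (h : Tendsto (fun K : ℕ => u K / (K:ℝ)^q) atTop (nhds l))
    (c : ℤ) : Tendsto (fun K : ℕ => u ((K:ℤ)+c).toNat / (K:ℝ)^q) atTop (nhds l) := by
  have h1 := (h.comp (tendsto_shift_atTop c)).mul ((tendsto_shift_ratio c).pow q)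
  rw [one_pow, mul_one] at h1
  refine h1.congr' ?_
  filter_upwards [eventually_ge_atTop (c.natAbs + 1)] with K hK
  have hK0 : (K:ℝ) ≠ 0 := by
    have : 0 < K := by omega
    positivity
  have hm0 : ((((K:ℤ) + c).toNat : ℕ) : ℝ) ≠ 0 := by
    have : 0 < ((K:ℤ) + c).toNat := by omega
    positivity
  simp only [Function.comp]
  rw [div_pow]
  field_simp

lemma tendsto_pow_diff (p : ℕ) :
    Tendsto (fun t : ℕ => (((t:ℝ)+1)^(p+1) - (t:ℝ)^(p+1)) / (t:ℝ)^p) atTop (nhds (p+1)) := by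
  have h0 := tendsto_shift_ratio 1
  have h1 : Tendsto (fun t : ℕ => ∑ i ∈ Finset.range (p+1), ((((t:ℤ) + 1).toNat : ℝ) / t)^i) atTop
      (nhds (∑ i ∈ Finset.range (p+1), (1:ℝ)^i)) := tendsto_finsetSum _ fun i _ => h0.pow i
  simp only [one_pow, Finset.sum_const, Finset.card_range, nsmul_eq_mul, mul_one, Nat.cast_add, Nat.cast_one] at h1
  refine h1.congr' ?_
  filter_upwards [eventually_ge_atTop 1] with t ht
  have ht0 : (t:ℝ) ≠ 0 := by positivity
  have e : ((((t:ℤ) + 1).toNat : ℕ) : ℝ) = t + 1 := by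
    have h : ((t:ℤ) + 1).toNat = t + 1 := by omega
    rw [h]; push_cast; ring
  rw [e, eq_div_iff (pow_ne_zero _ ht0)]
  have := (Commute.all ((t:ℝ)+1) t).geom_sum₂_mul (p+1)
  rw [add_sub_cancel_left, mul_one] at this
  rw [← this, Finset.sum_mul]
  apply Finset.sum_congr rfl
  intro i hi
  rw [Finset.mem_range] at hi
  rw [div_pow, div_mul_eq_mul_div, div_eq_iff (pow_ne_zero _ ht0), mul_assoc, ← pow_add]
  congr 2
  omega

/-- Stolz-type lemma -/
lemma stolz (u : ℕ → ℝ) (p : ℕ) (c : ℝ)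
    (h : Tendsto (fun t : ℕ => (u (t+1) - u t) / (t:ℝ)^p) atTop (nhds c)) :
    Tendsto (fun K : ℕ => u K / (K:ℝ)^(p+1)) atTop (nhds (c / (p+1))) := by
  have hp : ((p:ℝ)+1) ≠ 0 := by positivity
  set D : ℕ → ℝ := fun t => ((t:ℝ)+1)^(p+1) - (t:ℝ)^(p+1) with hD
  have hDpos : ∀ t, 0 ≤ D t := by
    intro t
    simp only [hD, sub_nonneg]
    gcongr
    linarith
  have hsum : ∀ n, ∑ t ∈ Finset.range n, D t = (n:ℝ)^(p+1) := by
    intro n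
    have := Finset.sum_range_sub (fun t : ℕ => (t:ℝ)^(p+1)) n
    simp only [Nat.cast_add, Nat.cast_one, Nat.cast_zero] at this
    simp only [hD]
    rw [this]; simp
  have hlo : (fun t => (u (t+1) - u t) - c/(p+1) * D t) =o[atTop] D := by
    rw [Asymptotics.isLittleO_iff_tendsto']
    · have h1 := h.div (tendsto_pow_diff p) hp
      have h2 := h1.sub_const (c/(p+1))
      rw [sub_self] at h2
      refine h2.congr' ?_
      filter_upwards [eventually_ge_atTop 1] with t ht
      have ht0 : (t:ℝ) ≠ 0 := by positivity
      have hDt : 0 < D t := by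
        simp only [hD, sub_pos]
        apply pow_lt_pow_left₀ (by linarith) (by positivity) (by omega)
      have hpt : (t:ℝ)^p ≠ 0 := pow_ne_zero _ ht0
      simp only [hD] at hDt ⊢
      rw [Pi.div_apply]
      rw [div_div_div_cancel_right₀ hpt, sub_div (u (t+1) - u t), mul_div_cancel_right₀ _ hDt.ne']
    · filter_upwards [eventually_ge_atTop 1] with t ht h0
      exfalso
      have hDt : 0 < D t := by
        simp only [hD, sub_pos]
        apply pow_lt_pow_left₀ (by linarith) (by positivity) (by omega)
      exact hDt.ne' h0
  have hinf : Tendsto (fun n : ℕ => (n:ℝ)^(p+1)) atTop atTop :=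
    (tendsto_pow_atTop (by omega)).comp tendsto_natCast_atTop_atTop
  have h3 := hlo.sum_range hDpos (by simp only [hsum]; exact hinf)
  simp only [hsum, Finset.sum_sub_distrib, ← Finset.mul_sum] at h3
  simp only [← Finset.sum_sub_distrib, Finset.sum_range_sub] at h3
  have h4 := h3.tendsto_div_nhds_zero
  have h5 : Tendsto (fun n : ℕ => u 0 / (n:ℝ)^(p+1)) atTop (nhds 0) := tendsto_const_nhds.div_atTop hinf
  have h6 := (h4.add h5).add_const (c/(p+1))
  rw [zero_add, zero_add] at h6
  refine h6.congr' ?_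
  filter_upwards [eventually_ge_atTop 1] with t ht
  have ht0 : (t:ℝ) ≠ 0 := by positivity
  field_simp
  ring

lemma OO.tendsto {α : Type*} {p : ℕ} {X : ℕ → Set α} (h : OO p X) :
    Tendsto (fun K : ℕ => ((X K).ncard : ℝ) / (K:ℝ)^(p+1)) atTop (nhds 0) := by
  obtain ⟨C, hC⟩ := h
  have h1 : Tendsto (fun K : ℕ => (C:ℝ) / K) atTop (nhds 0) :=
    tendsto_const_nhds.div_atTop tendsto_natCast_atTop_atTop
  refine squeeze_zero' (Eventually.of_forall fun K => by positivity) ?_ h1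
  filter_upwards [hC, eventually_ge_atTop 1] with K hK hK1
  have hK0 : (0:ℝ) < K := by positivity
  have h2 : ((X K).ncard : ℝ) ≤ C * (K:ℝ)^p := by exact_mod_cast hK.2
  rw [div_le_div_iff₀ (by positivity) hK0, pow_succ]
  nlinarith

/-- count squeeze -/
lemma count_squeeze {α β : Type*} {p : ℕ} {X : ℕ → Set α} {E : ℕ → Set β} {lo hi : ℕ → ℝ} {l : ℝ}
    (hE : OO p E) (hlo : Tendsto (fun K : ℕ => lo K / (K:ℝ)^(p+1)) atTop (nhds l))
    (hhi : Tendsto (fun K : ℕ => hi K / (K:ℝ)^(p+1)) atTop (nhds l))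
    (h1 : ∀ᶠ K in atTop, lo K ≤ (X K).ncard + (E K).ncard)
    (h2 : ∀ᶠ K in atTop, ((X K).ncard : ℝ) ≤ hi K) :
    Tendsto (fun K : ℕ => ((X K).ncard : ℝ) / (K:ℝ)^(p+1)) atTop (nhds l) := by
  have hlo' := hlo.sub hE.tendsto
  rw [sub_zero] at hlo'
  refine tendsto_of_tendsto_of_tendsto_of_le_of_le' hlo' hhi ?_ ?_
  · filter_upwards [h1] with K hK
    rw [← sub_div]
    gcongr
    linarith
  · filter_upwards [h2] with K hK
    gcongr

/-- summation over fibres -/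
lemma sum_fib {α : Type*} (Z : Finset α) (P : α → Prop) [DecidablePred P] (t : α → ℤ) (φ : ℤ → ℤ)
    (S : Finset ℤ) (h0 : ∀ s, s ∉ S → φ s = 0) :
    ∑ z ∈ Z, (if P z then φ (t z) else 0) = ∑ s ∈ S, φ s * ((Z.filter fun z => P z ∧ t z = s).card : ℤ) := by
  classical
  have h1 : ∀ z ∈ Z, (if P z then φ (t z) else 0) = ∑ s ∈ S, if (P z ∧ t z = s) then φ s else 0 := by
    intro z _
    by_cases hP : P z
    · simp only [hP, true_and, if_true]
      rw [Finset.sum_ite_eq]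
      split_ifs with h
      · rfl
      · exact h0 _ h
    · simp [hP]
  rw [Finset.sum_congr rfl h1, Finset.sum_comm]
  apply Finset.sum_congr rfl
  intro s _
  rw [← Finset.sum_filter, Finset.sum_const, nsmul_eq_mul, mul_comm]

section lims
variable {d : ℕ} {W : WD d}

lemma WD.fin_sub (W : WD d) {X : Set (Fin d → ℤ)} (N : ℤ) (h : ∀ z ∈ X, W.g z ≤ N) : X.Finite :=
  (W.lev_finite N).subset h

/-- two maximisers, level exactly `K` -/
def WD.Fac (W : WD d) (x : (Fin d → ℤ) × (Fin d → ℤ)) (K : ℕ) : Set (Fin d → ℤ) :=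
  {z | x.1 ⬝ᵥ z = K ∧ x.2 ⬝ᵥ z = K ∧ W.g z = K}

/-- two maximisers, level up to `K` -/
def WD.Wall (W : WD d) (x : (Fin d → ℤ) × (Fin d → ℤ)) (K : ℕ) : Set (Fin d → ℤ) :=
  {z | x.1 ⬝ᵥ z = W.g z ∧ x.2 ⬝ᵥ z = W.g z ∧ W.g z ≤ K}

lemma WD.lim_Na {p : ℕ} (hd : d = p + 2) (h2 : ∀ a ∈ W.A, ∀ b ∈ W.A, a ≠ b → b = -a ∨ Ind a b)
    (R : ℕ) {a : Fin d → ℤ} (ha : a ∈ W.A) {β : ℝ}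
    (hβ : Tendsto (fun K : ℕ => ((W.Fac (a, a) K).ncard : ℝ) / (K:ℝ)^(p+1)) atTop (nhds β)) (s : ℤ) :
    Tendsto (fun K : ℕ => ({z | W.Na R a z ∧ (K:ℤ) - a ⬝ᵥ z = s}.ncard : ℝ) / (K:ℝ)^(p+1)) atTop (nhds β) := by
  have hE := W.bad2 hd (R + s.natAbs) h2
  have hsh := tendsto_shift hβ (-s)
  have key : ∀ z, W.Na R a z → W.g z = a ⬝ᵥ z := by
    intro z h
    obtain ⟨b, hb, h1⟩ := W.ex z
    have := h b hb (by unfold WD.near; omega)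
    rw [← h1, this]
  refine count_squeeze hE hsh hsh ?_ ?_
  · filter_upwards [eventually_ge_atTop s.natAbs] with K hK
    rw [← Nat.cast_add, Nat.cast_le]
    refine le_trans (Set.ncard_le_ncard (t := _ ∪ _) ?_ ?_) (Set.ncard_union_le _ _)
    · rintro z ⟨h3, -, h4⟩
      simp only at h3
      by_cases hz : W.Na R a z
      · left
        exact ⟨hz, by omega⟩
      · right
        unfold WD.Na at hz
        push Not at hz
        obtain ⟨b, hb, h5, h6⟩ := hz
        refine ⟨by omega, by omega, b, hb, a, ha, h6, ?_, ?_⟩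
        · unfold WD.near at *; omega
        · unfold WD.near at *; omega
    · apply Set.Finite.union
      · apply W.fin_sub (K - s)
        rintro z ⟨h3, h4⟩
        have := key z h3
        omega
      · exact W.fin_sub _ fun z h => h.2.1
  · filter_upwards [eventually_ge_atTop s.natAbs] with K hK
    rw [Nat.cast_le]
    apply Set.ncard_le_ncard
    · rintro z ⟨h3, h4⟩
      have := key z h3
      refine ⟨?_, ?_, ?_⟩ <;> (try simp only) <;> omega
    · apply W.fin_sub (K - s)
      rintro z ⟨-, -, h3⟩
      omega

lemma WD.lim_Wall {p : ℕ} (x : (Fin d → ℤ) × (Fin d → ℤ)) {τ : ℝ}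
    (hτ : Tendsto (fun K : ℕ => ((W.Fac x K).ncard : ℝ) / (K:ℝ)^p) atTop (nhds τ)) :
    Tendsto (fun K : ℕ => ((W.Wall x K).ncard : ℝ) / (K:ℝ)^(p+1)) atTop (nhds (τ/(p+1))) := by
  apply stolz
  refine (tendsto_shift hτ 1).congr fun K => ?_
  congr 1
  have e : W.Wall x (K+1) = W.Wall x K ∪ W.Fac x (K+1) := by
    ext z
    simp only [WD.Wall, WD.Fac, Set.mem_union]
    constructor
    · rintro ⟨h1, h2, h3⟩
      by_cases h : W.g z ≤ K
      · exact Or.inl ⟨h1, h2, h⟩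
      · right; push_cast at *; exact ⟨by omega, by omega, by omega⟩
    · rintro (⟨h1, h2, h3⟩ | ⟨h1, h2, h3⟩)
      · exact ⟨h1, h2, by push_cast; omega⟩
      · push_cast at *; exact ⟨by omega, by omega, by push_cast; omega⟩
  have e2 : ((K:ℤ)+1).toNat = K + 1 := by omega
  have hdis : Disjoint (W.Wall x K) (W.Fac x (K+1)) := by
    rw [Set.disjoint_left]
    rintro z ⟨-, -, h1⟩ ⟨-, -, h2⟩
    push_cast at h2; omega
  rw [e, Set.ncard_union_eq hdis (W.fin_sub _ fun z h => h.2.2) (W.fin_sub _ fun z h => h.2.2.le), e2]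
  push_cast; ring

lemma WD.lim_Nab {p : ℕ} (hd : d = p + 2)
    (h3 : ∀ a ∈ W.A, ∀ b ∈ W.A, ∀ c ∈ W.A, a ≠ b → a ≠ c → b ≠ c → Ind (a - b) (a - c))
    (R : ℕ) {x : (Fin d → ℤ) × (Fin d → ℤ)} (hx1 : x.1 ∈ W.A) (hx2 : x.2 ∈ W.A) (hx : x.1 ≠ x.2) {τ : ℝ}
    (hτ : Tendsto (fun K : ℕ => ((W.Fac x K).ncard : ℝ) / (K:ℝ)^p) atTop (nhds τ))
    {l : ℤ} {ν b : Fin d → ℤ} (hl : x.1 - x.2 = l • ν) (hb : ν ⬝ᵥ b = 1) (j : ℤ) (c0 : ℕ)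
    (hc0 : ∀ c ∈ W.A, |c ⬝ᵥ (j • b)| ≤ c0) (hR : 2 * c0 ≤ R) :
    Tendsto (fun K : ℕ => ({z | W.Nab R K x z ∧ ν ⬝ᵥ z = j}.ncard : ℝ) / (K:ℝ)^(p+1)) atTop
      (nhds (τ/(p+1))) := by
  have hl0 : l ≠ 0 := by
    rintro rfl
    rw [zero_smul, sub_eq_zero] at hl
    exact hx hl
  have hν : ∀ z, x.1 ⬝ᵥ z = x.2 ⬝ᵥ z ↔ ν ⬝ᵥ z = 0 := by
    intro z
    rw [← sub_eq_zero, ← sub_dotProduct, hl, smul_dotProduct, smul_eq_mul, mul_eq_zero]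
    simp [hl0]
  have hνj : ν ⬝ᵥ (j • b) = j := by rw [dotProduct_smul, hb, smul_eq_mul, mul_one]
  set w := j • b with hw
  have hE := W.bad3 hd (R + 2 * c0) h3
  have hWl := W.lim_Wall x hτ
  refine count_squeeze hE (tendsto_shift hWl (-(c0:ℤ))) (tendsto_shift hWl c0) ?_ ?_
  · filter_upwards [eventually_ge_atTop c0] with K hK
    rw [← Nat.cast_add, Nat.cast_le]
    set E := {z : Fin d → ℤ | W.g z ≤ K + (R + 2 * c0 : ℕ) ∧ ∃ a ∈ W.A, ∃ b ∈ W.A, ∃ c ∈ W.A,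
      a ≠ b ∧ a ≠ c ∧ b ≠ c ∧ W.near (R + 2 * c0) z a ∧ W.near (R + 2 * c0) z b ∧ W.near (R + 2 * c0) z c} with hEdef
    have hXf : {z | W.Nab R K x z ∧ ν ⬝ᵥ z = j}.Finite := W.fin_sub _ fun z h => h.1.2
    have hEf : E.Finite := W.fin_sub _ fun z h => h.1
    refine le_trans (Set.ncard_le_ncard_sdiff_add_ncard _ E hEf) ?_
    apply Nat.add_le_add_right
    apply Set.ncard_le_ncard_of_injOn (fun z => z + w) _ (fun _ _ _ _ h => add_right_cancel h) hXf
    rintro z ⟨⟨e1, e2, e3⟩, hzE⟩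
    have e3 : W.g z ≤ K - c0 := by omega
    refine ⟨⟨?_, ?_⟩, ?_⟩
    · intro c hc hn
      by_contra hcon
      push Not at hcon
      apply hzE
      refine ⟨by omega, x.1, hx1, x.2, hx2, c, hc, hx, hcon.1.symm, hcon.2.symm, ?_, ?_, ?_⟩
      · unfold WD.near; omega
      · unfold WD.near; omega
      · unfold WD.near at *
        have f1 := hc0 c hc
        have f2 := hc0 x.1 hx1
        have f3 := W.le x.1 hx1 (z + w)
        rw [dotProduct_add] at f3 hn
        rw [abs_le] at f1 f2
        push_cast; omega
    · apply WD.g_le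
      intro c hc
      have f1 := hc0 c hc
      have f2 := W.le c hc z
      rw [abs_le] at f1
      rw [dotProduct_add]
      omega
    · show ν ⬝ᵥ (z + w) = j
      rw [dotProduct_add, hνj, (hν z).1 (e1.trans e2.symm), zero_add]
  · filter_upwards [eventually_ge_atTop 0] with K hK
    rw [Nat.cast_le]
    apply Set.ncard_le_ncard_of_injOn (fun z => z - w) _ (fun _ _ _ _ h => sub_left_injective h)
      (W.fin_sub _ fun z h => h.2.2)
    rintro z ⟨⟨e1, e2⟩, e3⟩
    have g1 : x.1 ⬝ᵥ (z - w) = x.2 ⬝ᵥ (z - w) := by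
      rw [hν, dotProduct_sub, e3, hνj, sub_self]
    have f1 := hc0 x.1 hx1
    have f2 := hc0 x.2 hx2
    rw [abs_le] at f1 f2
    have l1 := W.le _ hx1 z
    have gz : W.g z = x.1 ⬝ᵥ z ∨ W.g z = x.2 ⬝ᵥ z := by
      obtain ⟨b, hb, h1⟩ := W.ex z
      rcases e1 b hb (by unfold WD.near; omega) with h | h
      · left; rw [← h1, h]
      · right; rw [← h1, h]
    have g2 : W.g (z - w) = x.1 ⬝ᵥ (z - w) := by
      apply le_antisymm
      · apply WD.g_le
        intro c hc
        by_cases hn : W.near R z c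
        · rcases e1 c hc hn with h | h
          · rw [h]
          · rw [h, g1]
        · unfold WD.near at hn
          have f3 := hc0 c hc
          rw [abs_le] at f3
          rw [dotProduct_sub, dotProduct_sub] at *
          omega
      · exact W.le _ hx1 _
    refine ⟨g2.symm, by rw [g2, g1], ?_⟩
    rw [g2, dotProduct_sub]
    omega

end lims

section asym
variable {d : ℕ} {W : WD d}

lemma WD.D_bd {K : ℤ} {w z : Fin d → ℤ} {L : ℕ} (hL : ∀ a ∈ W.A, |a ⬝ᵥ w| ≤ L) :
    |W.D K w z| ≤ 60 * L := by
  have h : ∀ c : ℤ, |c| ≤ 3 → W.g ((2:ℤ) • z + c • w) ≤ W.g ((2:ℤ) • z) + 3 * L ∧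
      W.g ((2:ℤ) • z) ≤ W.g ((2:ℤ) • z + c • w) + 3 * L := by
    intro c hc
    have e : ∀ a : Fin d → ℤ, a ⬝ᵥ ((2:ℤ) • z + c • w) = a ⬝ᵥ ((2:ℤ) • z) + c * (a ⬝ᵥ w) := by
      intro a
      rw [dotProduct_add, dotProduct_smul c, smul_eq_mul]
    constructor
    · apply WD.g_le
      intro b hb
      have := mul_bd hc (hL b hb)
      have := W.le b hb ((2:ℤ) • z)
      rw [e]; omega
    · apply WD.g_le
      intro b hb
      have := mul_bd hc (hL b hb)
      have := W.le b hb ((2:ℤ) • z + c • w)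
      rw [e] at this; omega
  rw [WD.D_eq K w z (fun c => W.g ((2:ℤ) • z + c • w)) (fun _ _ => rfl)]
  have h1 := h 1 (by norm_num)
  have h2 := h (-1) (by norm_num)
  have h3 := h 3 (by norm_num)
  have h4 := h (-3) (by norm_num)
  rw [zero_smul, add_zero]
  generalize W.g ((2:ℤ) • z + (1:ℤ) • w) = x1 at *
  generalize W.g ((2:ℤ) • z + (-1:ℤ) • w) = x2 at *
  generalize W.g ((2:ℤ) • z + (3:ℤ) • w) = x3 at *
  generalize W.g ((2:ℤ) • z + (-3:ℤ) • w) = x4 at *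
  generalize W.g ((2:ℤ) • z) = x0 at *
  rw [abs_le]
  omega

lemma WD.M_bd {K : ℤ} {R : ℕ} {w z : Fin d → ℤ} {L : ℕ} (hL : ∀ a ∈ W.A, |a ⬝ᵥ w| ≤ L) :
    |W.M R K w z| ≤ 2 * (W.A.card * (100 * L)) + W.A.offDiag.card * (200 * L) := by
  classical
  unfold WD.M
  refine (abs_sub _ _).trans (add_le_add ?_ ?_)
  · rw [abs_mul, abs_two]
    refine mul_le_mul_of_nonneg_left ?_ (by norm_num)
    refine (Finset.abs_sum_le_sum_abs _ _).trans ?_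
    rw [← nsmul_eq_mul]
    apply Finset.sum_le_card_nsmul
    intro a ha
    split_ifs
    · have := psi_bound (a ⬝ᵥ w) (K - a ⬝ᵥ z)
      have := hL a ha
      linarith
    · simp
  · refine (Finset.abs_sum_le_sum_abs _ _).trans ?_
    rw [← nsmul_eq_mul]
    apply Finset.sum_le_card_nsmul
    rintro x hx
    rw [Finset.mem_offDiag] at hx
    split_ifs
    · have := psi_bound ((x.1 - x.2) ⬝ᵥ w) ((x.1 - x.2) ⬝ᵥ z)
      have h1 := hL _ hx.1
      have h2 := hL _ hx.2.1
      have h3 : |(x.1 - x.2) ⬝ᵥ w| ≤ |x.1 ⬝ᵥ w| + |x.2 ⬝ᵥ w| := by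
        rw [sub_dotProduct]; exact abs_sub _ _
      linarith
    · simp

/-- all hypotheses for the asymptotic analysis -/
structure WD.Hyp (W : WD d) (p : ℕ) (β : (Fin d → ℤ) → ℝ) (τ : (Fin d → ℤ) × (Fin d → ℤ) → ℝ)
    (l : (Fin d → ℤ) × (Fin d → ℤ) → ℤ) (ν b : (Fin d → ℤ) × (Fin d → ℤ) → (Fin d → ℤ)) : Prop where
  hd : d = p + 2
  h2 : ∀ a ∈ W.A, ∀ b ∈ W.A, a ≠ b → b = -a ∨ Ind a b
  h3 : ∀ a ∈ W.A, ∀ b ∈ W.A, ∀ c ∈ W.A, a ≠ b → a ≠ c → b ≠ c → Ind (a - b) (a - c)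
  hβ : ∀ a ∈ W.A, Tendsto (fun K : ℕ => ((W.Fac (a, a) K).ncard : ℝ) / (K:ℝ)^(p+1)) atTop (nhds (β a))
  hτ : ∀ x ∈ W.A.offDiag, Tendsto (fun K : ℕ => ((W.Fac x K).ncard : ℝ) / (K:ℝ)^p) atTop (nhds (τ x))
  hl : ∀ x ∈ W.A.offDiag, x.1 - x.2 = l x • ν x
  hl0 : ∀ x ∈ W.A.offDiag, 0 ≤ l x
  hb : ∀ x ∈ W.A.offDiag, ν x ⬝ᵥ b x = 1
  prim : ∀ a ∈ W.A, ∃ b, a ⬝ᵥ b = 1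

lemma WD.sumM {K : ℕ} {R N : ℕ} {w : Fin d → ℤ} {l : (Fin d → ℤ) × (Fin d → ℤ) → ℤ}
    {ν : (Fin d → ℤ) × (Fin d → ℤ) → (Fin d → ℤ)} (hl : ∀ x ∈ W.A.offDiag, x.1 - x.2 = l x • ν x)
    (hl0 : ∀ x ∈ W.A.offDiag, 0 ≤ l x)
    (hN1 : ∀ a ∈ W.A, 3 * |a ⬝ᵥ w| ≤ 2 * N) (hN2 : ∀ x ∈ W.A.offDiag, 3 * |ν x ⬝ᵥ w| ≤ 2 * N) (hNR : N ≤ R) :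
    ∑ z ∈ (W.lev_finite (K + R)).toFinset, W.M R K w z =
      2 * ∑ a ∈ W.A, ∑ s ∈ Finset.Icc (-(N:ℤ)) N, psi (a ⬝ᵥ w) s *
        ({z | W.Na R a z ∧ (K:ℤ) - a ⬝ᵥ z = s}.ncard : ℤ) -
      ∑ x ∈ W.A.offDiag, ∑ j ∈ Finset.Icc (-(N:ℤ)) N, (l x * psi (ν x ⬝ᵥ w) j) *
        ({z | W.Nab R K x z ∧ ν x ⬝ᵥ z = j}.ncard : ℤ) := by
  classical
  have hv : ∀ q s : ℤ, 3 * |q| ≤ 2 * N → s ∉ Finset.Icc (-(N:ℤ)) N → psi q s = 0 := by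
    intro q s h hs
    apply psi_zero
    rw [Finset.mem_Icc] at hs
    simp only [abs_eq_max_neg] at *
    omega
  unfold WD.M
  rw [Finset.sum_sub_distrib, ← Finset.mul_sum, Finset.sum_comm, Finset.sum_comm (t := W.A.offDiag)]
  congr 1
  · congr 1
    apply Finset.sum_congr rfl
    intro a ha
    rw [sum_fib _ (fun z => W.Na R a z) (fun z => K - a ⬝ᵥ z) (psi (a ⬝ᵥ w)) (Finset.Icc (-(N:ℤ)) N)
      (fun s hs => hv _ s (hN1 a ha) hs)]
    apply Finset.sum_congr rfl
    intro s hs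
    rw [← Set.ncard_coe_finset]
    congr 3
    ext z
    simp only [Finset.coe_filter, Set.Finite.mem_toFinset, Set.mem_ofPred_eq, and_iff_right_iff_imp]
    rintro ⟨h1, h2⟩
    rw [Finset.mem_Icc] at hs
    obtain ⟨b, hb, h3⟩ := W.ex z
    have := h1 b hb (by unfold WD.near; omega)
    subst this
    omega
  · apply Finset.sum_congr rfl
    intro x hx
    have e : ∀ z, psi ((x.1 - x.2) ⬝ᵥ w) ((x.1 - x.2) ⬝ᵥ z) = l x * psi (ν x ⬝ᵥ w) (ν x ⬝ᵥ z) := by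
      intro z
      rw [hl x hx, smul_dotProduct, smul_dotProduct, smul_eq_mul, smul_eq_mul, psi_mul _ _ _ (hl0 x hx)]
    simp only [e]
    rw [sum_fib _ (fun z => W.Nab R K x z) (fun z => ν x ⬝ᵥ z) (fun j => l x * psi (ν x ⬝ᵥ w) j) (Finset.Icc (-(N:ℤ)) N)
      (fun s hs => by rw [hv _ s (hN2 x hx) hs, mul_zero])]
    apply Finset.sum_congr rfl
    intro s hs
    rw [← Set.ncard_coe_finset]
    congr 3
    ext z
    simp only [Finset.coe_filter, Set.Finite.mem_toFinset, Set.mem_ofPred_eq, and_iff_right_iff_imp]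
    rintro ⟨h1, h2⟩
    have := h1.2
    omega

lemma exists_nat_bd {ι : Type*} (s : Finset ι) (F : ι → ℤ) : ∃ N : ℕ, ∀ i ∈ s, |F i| ≤ N := by
  refine ⟨s.sup fun i => (F i).natAbs, fun i hi => ?_⟩
  have := Finset.le_sup (f := fun i => (F i).natAbs) hi
  rw [Int.abs_eq_natAbs]
  exact_mod_cast this

/-- the `ρ`-summand -/
lemma WD.lim_rho {p : ℕ} {β : (Fin d → ℤ) → ℝ} {τ : (Fin d → ℤ) × (Fin d → ℤ) → ℝ}
    {l : (Fin d → ℤ) × (Fin d → ℤ) → ℤ} {ν b : (Fin d → ℤ) × (Fin d → ℤ) → (Fin d → ℤ)}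
    (H : W.Hyp p β τ l ν b) (w : Fin d → ℤ) :
    Tendsto (fun K : ℕ => ((∑ᶠ z, W.D K w z : ℤ) : ℝ) / (K:ℝ)^(p+1)) atTop
      (nhds (∑ a ∈ W.A, β a * ((if Odd (a ⬝ᵥ w) then 4 else 0 : ℤ):ℝ) -
        1/2 * ∑ x ∈ W.A.offDiag, (l x * τ x / (p+1)) * ((if Odd (ν x ⬝ᵥ w) then 4 else 0 : ℤ):ℝ))) := by
  classical
  obtain ⟨L, hL⟩ := exists_nat_bd W.A (fun a => a ⬝ᵥ w)
  obtain ⟨N2, hN2⟩ := exists_nat_bd W.A.offDiag (fun x => ν x ⬝ᵥ w)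
  set N := 2 * L + 2 * N2 with hN
  obtain ⟨c0, hc0⟩ := exists_nat_bd (W.A ×ˢ W.A.offDiag ×ˢ Finset.Icc (-(N:ℤ)) N)
    (fun t => t.1 ⬝ᵥ (t.2.2 • b t.2.1))
  set R := 3 * L + N + 2 * c0 with hR
  have hsum := fun K : ℕ => WD.sumM (W := W) (K := K) (R := R) (N := N) (w := w) H.hl H.hl0
    (fun a ha => by have := hL a ha; rw [hN]; push_cast; linarith)
    (fun x hx => by have := hN2 x hx; rw [hN]; push_cast; linarith) (by omega)
  have hOO : OO p fun K : ℕ => W.Bad R K := (W.bad3 H.hd R H.h3).union (W.bad2 H.hd R H.h2)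
  set B : ℤ := 2 * (60 * L) + (2 * (W.A.card * (100 * L)) + W.A.offDiag.card * (200 * L)) with hB
  have hB0 : 0 ≤ B := by positivity
  have hDsum : ∀ K : ℕ, ∑ᶠ z, W.D K w z = ∑ z ∈ (W.lev_finite (K + R)).toFinset, W.D K w z := by
    intro K
    apply finsum_eq_sum_of_support_subset
    intro z hz
    rw [Function.mem_support] at hz
    rw [Finset.mem_coe, Set.Finite.mem_toFinset]
    by_contra hcon
    apply hz
    simp only [Set.mem_ofPred_eq, not_le] at hcon
    exact WD.caseIII hL (R := R) (by omega) (by omega)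
  have herr : ∀ K : ℕ, |2 * ∑ᶠ z, W.D K w z - ∑ z ∈ (W.lev_finite (K + R)).toFinset, W.M R K w z| ≤
      B * (W.Bad R K).ncard := by
    intro K
    have hbf : (W.Bad R K).Finite := W.fin_sub (K + R) fun z hz => by
      rcases hz with h | h
      · exact h.1
      · exact h.2.1
    rw [hDsum, Finset.mul_sum, ← Finset.sum_sub_distrib]
    rw [← Finset.sum_subset (s₁ := hbf.toFinset)]
    · refine (Finset.abs_sum_le_sum_abs _ _).trans ?_
      rw [Set.ncard_eq_toFinset_card _ hbf, mul_comm, ← nsmul_eq_mul]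
      apply Finset.sum_le_card_nsmul
      intro z _
      refine (abs_sub _ _).trans ?_
      rw [abs_mul, abs_two, hB]
      exact add_le_add (mul_le_mul_of_nonneg_left (WD.D_bd hL) (by norm_num)) (WD.M_bd hL)
    · intro z hz
      rw [Set.Finite.mem_toFinset] at *
      rcases hz with h | h
      · exact h.1
      · exact h.2.1
    · intro z hz hnz
      rw [Set.Finite.mem_toFinset] at *
      rw [WD.local hL (R := R) (by omega) hz hnz, sub_self]
  have hM : Tendsto (fun K : ℕ => ((∑ z ∈ (W.lev_finite (K + R)).toFinset, W.M R K w z : ℤ):ℝ) / (K:ℝ)^(p+1)) atTop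
      (nhds (2 * ∑ a ∈ W.A, ∑ s ∈ Finset.Icc (-(N:ℤ)) N, (psi (a ⬝ᵥ w) s : ℝ) * β a -
        ∑ x ∈ W.A.offDiag, ∑ j ∈ Finset.Icc (-(N:ℤ)) N, (l x * psi (ν x ⬝ᵥ w) j : ℝ) * (τ x / (p+1)))) := by
    have := ((tendsto_finsetSum W.A fun a ha => tendsto_finsetSum (Finset.Icc (-(N:ℤ)) N) fun s _ =>
      (WD.lim_Na H.hd H.h2 R ha (H.hβ a ha) s).const_mul (psi (a ⬝ᵥ w) s : ℝ)).const_mul 2).sub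
      (tendsto_finsetSum W.A.offDiag fun x hx => tendsto_finsetSum (Finset.Icc (-(N:ℤ)) N) fun j hj =>
      (WD.lim_Nab H.hd H.h3 R (Finset.mem_offDiag.1 hx).1 (Finset.mem_offDiag.1 hx).2.1
        (Finset.mem_offDiag.1 hx).2.2 (H.hτ x hx) (H.hl x hx) (H.hb x hx) j c0
        (fun c hc => hc0 (c, x, j) (by simp only [Finset.mem_product]; exact ⟨hc, hx, hj⟩))
        (by omega)).const_mul (l x * psi (ν x ⬝ᵥ w) j : ℝ))
    refine this.congr fun K => ?_
    rw [hsum K]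
    push_cast
    rw [sub_div, mul_div_assoc, Finset.sum_div, Finset.sum_div]
    simp only [Finset.sum_div, mul_div_assoc]
  have hE : Tendsto (fun K : ℕ => (((2 * ∑ᶠ z, W.D K w z - ∑ z ∈ (W.lev_finite (K + R)).toFinset, W.M R K w z : ℤ)):ℝ)
      / (K:ℝ)^(p+1)) atTop (nhds 0) := by
    have h1 := hOO.tendsto.const_mul (B:ℝ)
    rw [mul_zero] at h1
    refine squeeze_zero_norm (fun K => ?_) h1
    rw [norm_div, Real.norm_eq_abs, Real.norm_of_nonneg (by positivity : (0:ℝ) ≤ (K:ℝ)^(p+1)), ← mul_div_assoc]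
    gcongr
    exact_mod_cast herr K
  have hfin := (hE.add hM).const_mul (1/2)
  rw [zero_add] at hfin
  convert hfin using 2
  · rw [← add_div]
    push_cast
    ring
  · have p1 : ∀ a ∈ W.A, ∑ s ∈ Finset.Icc (-(N:ℤ)) N, (psi (a ⬝ᵥ w) s : ℝ) * β a =
        β a * ((if Odd (a ⬝ᵥ w) then 4 else 0 : ℤ):ℝ) := by
      intro a ha
      rw [← Finset.sum_mul, mul_comm, ← psi_sum (a ⬝ᵥ w) N (by have := hL a ha; rw [hN]; push_cast; linarith)]
      push_cast; rfl
    have p2 : ∀ x ∈ W.A.offDiag, ∑ j ∈ Finset.Icc (-(N:ℤ)) N, (l x * psi (ν x ⬝ᵥ w) j : ℝ) * (τ x / (p+1)) =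
        (l x * τ x / (p+1)) * ((if Odd (ν x ⬝ᵥ w) then 4 else 0 : ℤ):ℝ) := by
      intro x hx
      rw [← Finset.sum_mul, ← Finset.mul_sum, ← psi_sum (ν x ⬝ᵥ w) N (by have := hN2 x hx; rw [hN]; push_cast; linarith)]
      push_cast; ring
    rw [Finset.sum_congr rfl p1, Finset.sum_congr rfl p2]
    ring

lemma WD.g_two (z : Fin d → ℤ) : W.g ((2:ℤ) • z) = 2 * W.g z := by
  apply le_antisymm
  · apply WD.g_le
    intro b hb
    have := W.le b hb z
    rw [dotProduct_smul, smul_eq_mul]; linarith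
  · obtain ⟨a, ha, h⟩ := W.ex z
    have := W.le a ha ((2:ℤ) • z)
    rw [dotProduct_smul, smul_eq_mul, h] at this
    exact this

lemma WD.f_supp (K : ℤ) : (Function.support (W.f K)).Finite := by
  apply W.fin_sub K
  intro z hz
  rw [Function.mem_support, WD.f] at hz
  omega

/-- main asymptotic formula -/
theorem WD.asymp {p : ℕ} {β : (Fin d → ℤ) → ℝ} {τ : (Fin d → ℤ) × (Fin d → ℤ) → ℝ}
    {l : (Fin d → ℤ) × (Fin d → ℤ) → ℤ} {ν b : (Fin d → ℤ) × (Fin d → ℤ) → (Fin d → ℤ)}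
    (H : W.Hyp p β τ l ν b) :
    Tendsto (fun K : ℕ => ((∑ᶠ z, W.f (2*K) z - 2^(d+1) * ∑ᶠ z, W.f K z : ℤ) : ℝ) / (K:ℝ)^(p+1)) atTop
      (nhds (2^d / 8 * (∑ a ∈ W.A, β a - 1/2 * ∑ x ∈ W.A.offDiag, l x * τ x / (p+1)))) := by
  have h1 := (tendsto_finsetSum (Finset.univ : Finset (Fin d → Fin 2)) fun ρ _ => WD.lim_rho H (rv ρ)).const_mul (1/16)
  convert h1 using 2 with K
  · have h2 := doubling (W.f K) (W.f (2*K)) (W.f_supp _) (W.f_supp _) (fun z => by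
      unfold WD.f; rw [W.g_two]; omega)
    have h3 : ∑ ρ : Fin d → Fin 2, ∑ᶠ z : Fin d → ℤ, W.D K (rv ρ) z =
      16 * (∑ᶠ z, W.f (2*K) z - 2^(d+1) * ∑ᶠ z, W.f K z) := h2.symm
    rw [← Finset.sum_div, ← Int.cast_sum, h3]
    push_cast
    ring
  · rw [Finset.sum_sub_distrib, Finset.sum_comm, ← Finset.mul_sum, Finset.sum_comm (t := W.A.offDiag)]
    have key : ∀ a b : Fin d → ℤ, a ⬝ᵥ b = 1 →
        ∑ ρ : Fin d → Fin 2, ((if Odd (a ⬝ᵥ rv ρ) then 4 else 0 : ℤ):ℝ) = 2 * 2^d := by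
      intro a b hab
      have := parity_sum a b hab
      have h4 : (2:ℝ) * ∑ ρ : Fin d → Fin 2, ((if Odd (a ⬝ᵥ rv ρ) then 4 else 0 : ℤ):ℝ) = 4 * 2^d := by
        exact_mod_cast this
      linarith
    have p1 : ∀ a ∈ W.A, ∑ ρ : Fin d → Fin 2, β a * ((if Odd (a ⬝ᵥ rv ρ) then 4 else 0 : ℤ):ℝ) = β a * (2 * 2^d) := by
      intro a ha
      obtain ⟨b, hb⟩ := H.prim a ha
      rw [← Finset.mul_sum, key a b hb]
    have p2 : ∀ x ∈ W.A.offDiag, ∑ ρ : Fin d → Fin 2, (l x * τ x / (p+1)) * ((if Odd (ν x ⬝ᵥ rv ρ) then 4 else 0 : ℤ):ℝ)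
        = (l x * τ x / (p+1)) * (2 * 2^d) := by
      intro x hx
      rw [← Finset.mul_sum, key _ _ (H.hb x hx)]
    rw [Finset.sum_congr rfl p1, Finset.sum_congr rfl p2, ← Finset.sum_mul, ← Finset.sum_mul]
    ring

/-- level count is the sum of facet counts -/
lemma WD.lim_level {p : ℕ} {β : (Fin d → ℤ) → ℝ} {τ : (Fin d → ℤ) × (Fin d → ℤ) → ℝ}
    {l : (Fin d → ℤ) × (Fin d → ℤ) → ℤ} {ν b : (Fin d → ℤ) × (Fin d → ℤ) → (Fin d → ℤ)}
    (H : W.Hyp p β τ l ν b) :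
    Tendsto (fun K : ℕ => ({z | W.g z = K}.ncard : ℝ) / (K:ℝ)^(p+1)) atTop (nhds (∑ a ∈ W.A, β a)) := by
  classical
  have hb := W.bad2 H.hd 0 H.h2
  have hlim : Tendsto (fun K : ℕ => (∑ a ∈ W.A, ((W.Fac (a, a) K).ncard : ℝ)) / (K:ℝ)^(p+1)) atTop
      (nhds (∑ a ∈ W.A, β a)) := by
    refine (tendsto_finsetSum W.A H.hβ).congr fun K => ?_
    rw [Finset.sum_div]
  have hNa : Tendsto (fun K : ℕ => (∑ a ∈ W.A, ({z | W.Na 0 a z ∧ (K:ℤ) - a ⬝ᵥ z = 0}.ncard : ℝ)) / (K:ℝ)^(p+1)) atTop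
      (nhds (∑ a ∈ W.A, β a)) := by
    refine (tendsto_finsetSum W.A fun a ha => WD.lim_Na H.hd H.h2 0 ha (H.hβ a ha) 0).congr fun K => ?_
    rw [Finset.sum_div]
  refine tendsto_of_tendsto_of_tendsto_of_le_of_le hNa hlim (fun K => ?_) (fun K => ?_)
  · simp only
    gcongr
    have hfin : ∀ a : Fin d → ℤ, {z | W.Na 0 a z ∧ (K:ℤ) - a ⬝ᵥ z = 0} ⊆ {z | W.g z = K} := by
      rintro a z ⟨h1, h2⟩
      obtain ⟨b, hb, h3⟩ := W.ex z
      have := h1 b hb (by unfold WD.near; omega)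
      subst this
      show W.g z = K
      omega
    have hf : {z | W.g z = K}.Finite := W.fin_sub K fun z (h : W.g z = K) => h.le
    norm_cast
    rw [Set.ncard_eq_toFinset_card _ hf]
    have : ∀ a ∈ W.A, {z | W.Na 0 a z ∧ (K:ℤ) - a ⬝ᵥ z = 0}.ncard = (hf.toFinset.filter fun z => W.Na 0 a z ∧ (K:ℤ) - a ⬝ᵥ z = 0).card := by
      intro a _
      rw [← Set.ncard_coe_finset]
      congr 1
      ext z
      simp only [Finset.coe_filter, Set.Finite.mem_toFinset]
      exact ⟨fun h => ⟨hfin a h, h⟩, fun h => h.2⟩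
    rw [Finset.sum_congr rfl this, ← Finset.card_biUnion]
    · apply Finset.card_le_card
      intro z hz
      rw [Finset.mem_biUnion] at hz
      obtain ⟨a, -, hz⟩ := hz
      exact (Finset.mem_filter.1 hz).1
    · intro a ha b hb hab
      rw [Function.onFun, Finset.disjoint_left]
      intro z h1 h2
      rw [Finset.mem_filter] at h1 h2
      obtain ⟨c, hc, h3⟩ := W.ex z
      have e1 := h1.2.1 c hc (by unfold WD.near; omega)
      have e2 := h2.2.1 c hc (by unfold WD.near; omega)
      exact hab (e1.symm.trans e2)
  · simp only
    gcongr
    norm_cast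
    have hsub : {z | W.g z = K} ⊆ ⋃ a ∈ W.A, W.Fac (a, a) K := by
      intro z hz
      have hz : W.g z = K := hz
      obtain ⟨a, ha, h⟩ := W.ex z
      rw [Set.mem_iUnion₂]
      exact ⟨a, ha, by show a ⬝ᵥ z = K; omega, by show a ⬝ᵥ z = K; omega, hz⟩
    refine (Set.ncard_le_ncard hsub ?_).trans (Finset.set_ncard_biUnion_le _ _)
    apply Set.Finite.biUnion W.A.finite_toSet
    intro a _
    exact W.fin_sub _ fun z h => h.2.2.le

end asym

section fin
variable {d : ℕ} {W : WD d}

lemma WD.F_diff (K : ℤ) : ∑ᶠ z, W.f (K+1) z - ∑ᶠ z, W.f K z = ({z | W.g z ≤ K}.ncard : ℤ) := by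
  classical
  rw [finsum_eq_sum_of_support_subset (s := (W.lev_finite K).toFinset) (W.f (K+1)),
    finsum_eq_sum_of_support_subset (s := (W.lev_finite K).toFinset) (W.f K), ← Finset.sum_sub_distrib,
    Set.ncard_eq_toFinset_card _ (W.lev_finite K), Finset.card_eq_sum_ones]
  · push_cast
    apply Finset.sum_congr rfl
    intro z hz
    rw [Set.Finite.mem_toFinset] at hz
    have hz : W.g z ≤ K := hz
    unfold WD.f
    omega
  · intro z hz
    rw [Function.mem_support, WD.f] at hz
    rw [Finset.mem_coe, Set.Finite.mem_toFinset]
    show W.g z ≤ K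
    omega
  · intro z hz
    rw [Function.mem_support, WD.f] at hz
    rw [Finset.mem_coe, Set.Finite.mem_toFinset]
    show W.g z ≤ K
    omega

theorem WD.main {p : ℕ} {β : (Fin d → ℤ) → ℝ} {τ : (Fin d → ℤ) × (Fin d → ℤ) → ℝ}
    {l : (Fin d → ℤ) × (Fin d → ℤ) → ℤ} {ν b : (Fin d → ℤ) × (Fin d → ℤ) → (Fin d → ℤ)}
    (H : W.Hyp p β τ l ν b) (E : ℕ → ℝ) (hE : ∀ K : ℕ, E K = ({z | W.g z ≤ K}.ncard : ℝ)) {c σ : ℝ}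
    (hc : Tendsto (fun K : ℕ => (E (2*K) + E (2*K+1) - 2^(d+1) * E K) / (K:ℝ)^p) atTop (nhds c))
    (hσ : Tendsto (fun K : ℕ => (E (K+1) - E K) / (K:ℝ)^(p+1)) atTop (nhds σ)) :
    c = 2^d / 8 * ((p+1) * σ - 1/2 * ∑ x ∈ W.A.offDiag, l x * τ x) := by
  have hs : ∑ a ∈ W.A, β a = σ := by
    have h1 := tendsto_shift (WD.lim_level H) 1
    refine tendsto_nhds_unique h1 (hσ.congr fun K => ?_)
    have e2 : ((K:ℤ)+1).toNat = K + 1 := by omega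
    congr 1
    rw [hE, hE, e2]
    have e : {z | W.g z ≤ ((K+1:ℕ):ℤ)} = {z | W.g z ≤ K} ∪ {z | W.g z = ((K+1:ℕ):ℤ)} := by
      ext z
      simp only [Set.mem_union, Set.mem_ofPred_eq]
      omega
    have hdis : Disjoint {z | W.g z ≤ K} {z | W.g z = ((K+1:ℕ):ℤ)} := by
      rw [Set.disjoint_left]
      intro z h1 h2
      simp only [Set.mem_ofPred_eq] at h1 h2
      omega
    rw [e, Set.ncard_union_eq hdis (W.lev_finite _) (W.fin_sub ((K+1:ℕ):ℤ) fun z h => le_of_eq h)]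
    push_cast; ring
  have h1 := WD.asymp H
  set T : ℕ → ℝ := fun K => ((∑ᶠ z, W.f (2*K) z - 2^(d+1) * ∑ᶠ z, W.f K z : ℤ) : ℝ) with hT
  have h2 : Tendsto (fun K : ℕ => (T (K+1) - T K) / (K:ℝ)^p) atTop (nhds c) := by
    refine hc.congr fun K => ?_
    congr 1
    have f1 := W.F_diff (2*K)
    have f2 := W.F_diff (2*K+1)
    have f3 := W.F_diff K
    rw [hE, hE, hE]
    simp only [hT]
    rw [← Int.cast_sub]
    have : (((∑ᶠ z, W.f (2*(K+1:ℕ)) z - 2^(d+1) * ∑ᶠ z, W.f (K+1:ℕ) z) - (∑ᶠ z, W.f (2*K) z - 2^(d+1) * ∑ᶠ z, W.f K z) : ℤ))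
      = ({z | W.g z ≤ 2*K}.ncard : ℤ) + ({z | W.g z ≤ 2*K+1}.ncard : ℤ) - 2^(d+1) * ({z | W.g z ≤ K}.ncard : ℤ) := by
      rw [← f1, ← f2, ← f3, show (2 * ((K+1:ℕ):ℤ)) = 2*K+1+1 by push_cast; ring]
      push_cast; ring
    rw [this]
    push_cast
    ring
  have h3 := tendsto_nhds_unique (stolz T p c h2) h1
  have hp : ((p:ℝ)+1) ≠ 0 := by positivity
  rw [hs, div_eq_iff hp] at h3
  rw [h3]
  have : ∑ x ∈ W.A.offDiag, (l x : ℝ) * τ x / (p+1) = (∑ x ∈ W.A.offDiag, (l x : ℝ) * τ x) / (p+1) := by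
    rw [Finset.sum_div]
  rw [this]
  field_simp

end fin

/-- second order expansion in `1/K` -/
def Exp3 (u : ℕ → ℝ) (c0 c1 c2 : ℝ) : Prop :=
  ∃ e : ℕ → ℝ, Tendsto e atTop (nhds 0) ∧ ∀ᶠ K : ℕ in atTop, u K = c0 + c1 / K + (c2 + e K) / (K:ℝ)^2

lemma Exp3.add {u v : ℕ → ℝ} {a0 a1 a2 b0 b1 b2 : ℝ} (hu : Exp3 u a0 a1 a2) (hv : Exp3 v b0 b1 b2) :
    Exp3 (fun K => u K + v K) (a0 + b0) (a1 + b1) (a2 + b2) := by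
  obtain ⟨e, he, h1⟩ := hu
  obtain ⟨f, hf, h2⟩ := hv
  refine ⟨fun K => e K + f K, by simpa using he.add hf, ?_⟩
  filter_upwards [h1, h2] with K h1 h2
  rw [h1, h2]; ring

lemma Exp3.const_mul {u : ℕ → ℝ} {a0 a1 a2 : ℝ} (hu : Exp3 u a0 a1 a2) (t : ℝ) :
    Exp3 (fun K => t * u K) (t * a0) (t * a1) (t * a2) := by
  obtain ⟨e, he, h1⟩ := hu
  refine ⟨fun K => t * e K, by simpa using he.const_mul t, ?_⟩
  filter_upwards [h1] with K h1
  rw [h1]; ring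

lemma Exp3.mul_lin {u : ℕ → ℝ} {a0 a1 a2 : ℝ} (hu : Exp3 u a0 a1 a2) (α β : ℝ) :
    Exp3 (fun K => u K * (α + β / K)) (a0 * α) (a1 * α + a0 * β) (a2 * α + a1 * β) := by
  obtain ⟨e, he, h1⟩ := hu
  have hinv : Tendsto (fun K : ℕ => (1:ℝ) / K) atTop (nhds 0) :=
    tendsto_const_nhds.div_atTop tendsto_natCast_atTop_atTop
  refine ⟨fun K => α * e K + β * (a2 + e K) * (1 / K), ?_, ?_⟩
  · have := (he.const_mul α).add (((he.const_add a2).const_mul β).mul hinv)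
    simpa using this
  · filter_upwards [h1, eventually_ge_atTop 1] with K h1 hK
    have : (K:ℝ) ≠ 0 := by positivity
    rw [h1]; field_simp; ring

lemma Exp3.congr {u v : ℕ → ℝ} {a0 a1 a2 : ℝ} (hu : Exp3 u a0 a1 a2) (h : ∀ᶠ K in atTop, u K = v K) :
    Exp3 v a0 a1 a2 := by
  obtain ⟨e, he, h1⟩ := hu
  refine ⟨e, he, ?_⟩
  filter_upwards [h1, h] with K h1 h2
  rw [← h2, h1]

lemma Exp3.const : Exp3 (fun _ => 1) 1 0 0 := ⟨fun _ => 0, tendsto_const_nhds, by simp⟩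

lemma Exp3.lim1 {u : ℕ → ℝ} {a1 a2 : ℝ} (hu : Exp3 u 0 a1 a2) :
    Tendsto (fun K : ℕ => (K:ℝ) * u K) atTop (nhds a1) := by
  obtain ⟨e, he, h1⟩ := hu
  have hinv : Tendsto (fun K : ℕ => (1:ℝ) / K) atTop (nhds 0) :=
    tendsto_const_nhds.div_atTop tendsto_natCast_atTop_atTop
  have h2 : Tendsto (fun K : ℕ => a1 + (a2 + e K) * (1 / K)) atTop (nhds a1) := by
    simpa using (((he.const_add a2).mul hinv)).const_add a1
  refine h2.congr' ?_
  filter_upwards [h1, eventually_ge_atTop 1] with K h1 hK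
  have : (K:ℝ) ≠ 0 := by positivity
  rw [h1]; field_simp; ring

lemma Exp3.lim2 {u : ℕ → ℝ} {a2 : ℝ} (hu : Exp3 u 0 0 a2) :
    Tendsto (fun K : ℕ => (K:ℝ)^2 * u K) atTop (nhds a2) := by
  obtain ⟨e, he, h1⟩ := hu
  have h2 : Tendsto (fun K : ℕ => a2 + e K) atTop (nhds a2) := by
    simpa using he.const_add a2
  refine h2.congr' ?_
  filter_upwards [h1, eventually_ge_atTop 1] with K h1 hK
  have : (K:ℝ) ≠ 0 := by positivity
  rw [h1]; field_simp; ring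

/-- first symmetric function of `b+1,…,b+n` -/
def S1 (n b : ℝ) : ℝ := n * b + n * (n+1) / 2
/-- second symmetric function of `b+1,…,b+n` -/
def S2 (n b : ℝ) : ℝ := ((S1 n b)^2 - (n * b^2 + b * n * (n+1) + n * (n+1) * (2*n+1) / 6)) / 2

lemma exp_prod (α b : ℝ) (hα : α ≠ 0) (n : ℕ) :
    Exp3 (fun K : ℕ => (∏ j ∈ Finset.range n, (α * K + b + (j+1))) / (K:ℝ)^n)
      (α^n) (α^n * S1 n b / α) (α^n * S2 n b / α^2) := by
  induction n with
  | zero => simpa [S1, S2] using Exp3.const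
  | succ n ih =>
    have h := ih.mul_lin α (b + (n+1))
    have e1 : α^(n+1) * S1 (n+1:ℕ) b / α = α^n * S1 n b / α * α + α^n * (b + (n+1)) := by
      unfold S1; push_cast; field_simp; ring
    have e2 : α^(n+1) * S2 (n+1:ℕ) b / α^2 = α^n * S2 n b / α^2 * α + α^n * S1 n b / α * (b + (n+1)) := by
      unfold S2 S1; push_cast; field_simp; ring
    rw [e1, e2, pow_succ α]
    refine h.congr ?_
    filter_upwards [eventually_ge_atTop 1] with K hK
    have : (K:ℝ) ≠ 0 := by positivity
    rw [Finset.prod_range_succ, pow_succ]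
    field_simp
    ring

lemma multichoose_prod (d m : ℕ) : (d.factorial : ℝ) * ((d+1).multichoose m : ℝ) =
    ∏ j ∈ Finset.range d, ((m:ℝ) + (j+1)) := by
  rw [Nat.multichoose_eq, show d + 1 + m - 1 = m + d by omega]
  have h := Nat.ascFactorial_eq_factorial_mul_choose m d
  have h2 := Nat.ascFactorial_eq_prod_range (m+1) d
  rw [h2] at h
  have h3 : (d.factorial : ℝ) * ((m+d).choose d : ℝ) = ∏ j ∈ Finset.range d, (((m+1+j : ℕ):ℝ)) := by
    exact_mod_cast h.symm
  rw [Nat.choose_symm_add, h3]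
  apply Finset.prod_congr rfl
  intro j _
  push_cast; ring

lemma exp_ehr (d : ℕ) (a : ℝ) (e : ℕ → ℝ)
    (he : ∀ k : ℕ, 3 ≤ k → (d.factorial:ℝ) * e k = ∏ j ∈ Finset.range d, ((k:ℝ) + (j+1)) +
      a * ∏ j ∈ Finset.range d, ((k:ℝ) - 1 + (j+1)) + a * ∏ j ∈ Finset.range d, ((k:ℝ) - 2 + (j+1)) +
      ∏ j ∈ Finset.range d, ((k:ℝ) - 3 + (j+1))) (α β : ℕ) (hα : 0 < α) :
    Exp3 (fun K : ℕ => (d.factorial:ℝ) * e (α * K + β) / (K:ℝ)^d)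
      ((α:ℝ)^d * (2 + 2 * a))
      ((α:ℝ)^d * (S1 d β + a * S1 d (β - 1) + a * S1 d (β - 2) + S1 d (β - 3)) / α)
      ((α:ℝ)^d * (S2 d β + a * S2 d (β - 1) + a * S2 d (β - 2) + S2 d (β - 3)) / α^2) := by
  have hα' : (α:ℝ) ≠ 0 := by positivity
  have h0 := exp_prod α β hα' d
  have h1 := (exp_prod α (β - 1) hα' d).const_mul a
  have h2 := (exp_prod α (β - 2) hα' d).const_mul a
  have h3 := exp_prod α (β - 3) hα' d
  have h := ((h0.add h1).add h2).add h3
  have e0 : (α:ℝ)^d * (2 + 2 * a) = (α:ℝ)^d + a * (α:ℝ)^d + a * (α:ℝ)^d + (α:ℝ)^d := by ring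
  have e1 : (α:ℝ)^d * (S1 d β + a * S1 d (β - 1) + a * S1 d (β - 2) + S1 d (β - 3)) / α =
    (α:ℝ)^d * S1 d β / α + a * ((α:ℝ)^d * S1 d (β-1) / α) + a * ((α:ℝ)^d * S1 d (β-2) / α) + (α:ℝ)^d * S1 d (β-3) / α := by ring
  have e2 : (α:ℝ)^d * (S2 d β + a * S2 d (β - 1) + a * S2 d (β - 2) + S2 d (β - 3)) / α^2 =
    (α:ℝ)^d * S2 d β / α^2 + a * ((α:ℝ)^d * S2 d (β-1) / α^2) + a * ((α:ℝ)^d * S2 d (β-2) / α^2) + (α:ℝ)^d * S2 d (β-3) / α^2 := by ring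
  rw [e0, e1, e2]
  refine h.congr ?_
  filter_upwards [eventually_ge_atTop 3] with K hK
  rw [he (α * K + β) (by nlinarith)]
  push_cast
  simp only [add_sub_assoc]
  ring

/-- final algebra -/
lemma final_algebra (r : ℕ) (hr : 1 ≤ r) (a : ℝ) (e : ℕ → ℝ)
    (he : ∀ k : ℕ, 3 ≤ k → ((r+2).factorial:ℝ) * e k = ∏ j ∈ Finset.range (r+2), ((k:ℝ) + (j+1)) +
      a * ∏ j ∈ Finset.range (r+2), ((k:ℝ) - 1 + (j+1)) + a * ∏ j ∈ Finset.range (r+2), ((k:ℝ) - 2 + (j+1)) +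
      ∏ j ∈ Finset.range (r+2), ((k:ℝ) - 3 + (j+1))) :
    ∃ c σ : ℝ,
      Tendsto (fun K : ℕ => (e (r*(2*K)) + e (r*(2*K+1)) - 2^(r+2+1) * e (r*K)) / (K:ℝ)^r) atTop (nhds c) ∧
      Tendsto (fun K : ℕ => (e (r*(K+1)) - e (r*K)) / (K:ℝ)^(r+1)) atTop (nhds σ) ∧
      ∀ S : ℝ, c = 2^(r+2) / 8 * ((r+1) * σ - (r:ℝ)^r / r.factorial * S) →
        24 = S + (r:ℝ) * (1 - r) / 2 * (2 + 2 * a) := by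
  have hr0 : (r:ℝ) ≠ 0 := by positivity
  have hf0 : ((r+2).factorial:ℝ) ≠ 0 := by positivity
  have A1 := exp_ehr (r+2) a e he (2*r) 0 (by omega)
  have A2 := exp_ehr (r+2) a e he (2*r) r (by omega)
  have A3 := exp_ehr (r+2) a e he r 0 (by omega)
  have A4 := exp_ehr (r+2) a e he r r (by omega)
  have B1 := (A1.add A2).add (A3.const_mul (-2^(r+2+1)))
  have B2 := A4.add (A3.const_mul (-1))
  set N1 := S1 ((r+2:ℕ):ℝ) (0:ℕ) + a * S1 ((r+2:ℕ):ℝ) ((0:ℕ)-1) + a * S1 ((r+2:ℕ):ℝ) ((0:ℕ)-2) + S1 ((r+2:ℕ):ℝ) ((0:ℕ)-3) with hN1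
  set N1' := S1 ((r+2:ℕ):ℝ) r + a * S1 ((r+2:ℕ):ℝ) (r-1) + a * S1 ((r+2:ℕ):ℝ) (r-2) + S1 ((r+2:ℕ):ℝ) (r-3) with hN1'
  set N2 := S2 ((r+2:ℕ):ℝ) (0:ℕ) + a * S2 ((r+2:ℕ):ℝ) ((0:ℕ)-1) + a * S2 ((r+2:ℕ):ℝ) ((0:ℕ)-2) + S2 ((r+2:ℕ):ℝ) ((0:ℕ)-3) with hN2
  set N2' := S2 ((r+2:ℕ):ℝ) r + a * S2 ((r+2:ℕ):ℝ) (r-1) + a * S2 ((r+2:ℕ):ℝ) (r-2) + S2 ((r+2:ℕ):ℝ) (r-3) with hN2'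
  have v1 : N1' = 3 * N1 := by
    rw [hN1, hN1']; unfold S1; push_cast; ring
  have v1' : N1 = (r+2) * r * (1 + a) := by
    rw [hN1]; unfold S1; push_cast; ring
  have hlim1 : ∀ c2 : ℝ, Exp3 (fun K : ℕ => ((r+2).factorial:ℝ) * e (2*r*K+0) / (K:ℝ)^(r+2) + ((r+2).factorial:ℝ) * e (2*r*K+r) / (K:ℝ)^(r+2)
      + -2^(r+2+1) * (((r+2).factorial:ℝ) * e (r*K+0) / (K:ℝ)^(r+2))) 0 0 c2 →
      Tendsto (fun K : ℕ => (e (r*(2*K)) + e (r*(2*K+1)) - 2^(r+2+1) * e (r*K)) / (K:ℝ)^r) atTop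
        (nhds (c2 / (r+2).factorial)) := by
    intro c2 h
    refine (h.lim2.div_const ((r+2).factorial:ℝ)).congr' ?_
    filter_upwards [eventually_ge_atTop 1] with K hK
    have : (K:ℝ) ≠ 0 := by positivity
    rw [show 2*r*K+0 = r*(2*K) by ring, show 2*r*K+r = r*(2*K+1) by ring, add_zero, pow_add (K:ℝ) r 2]
    field_simp
    ring
  have hlim2 : ∀ c1 c2 : ℝ, Exp3 (fun K : ℕ => ((r+2).factorial:ℝ) * e (r*K+r) / (K:ℝ)^(r+2)
      + -1 * (((r+2).factorial:ℝ) * e (r*K+0) / (K:ℝ)^(r+2))) 0 c1 c2 →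
      Tendsto (fun K : ℕ => (e (r*(K+1)) - e (r*K)) / (K:ℝ)^(r+1)) atTop
        (nhds (c1 / (r+2).factorial)) := by
    intro c1 c2 h
    refine (h.lim1.div_const ((r+2).factorial:ℝ)).congr' ?_
    filter_upwards [eventually_ge_atTop 1] with K hK
    have : (K:ℝ) ≠ 0 := by positivity
    rw [show r*K+r = r*(K+1) by ring, add_zero, show r + 2 = (r+1)+1 by ring, pow_succ (K:ℝ) (r+1)]
    field_simp
    ring
  have z0 : ((2*r:ℕ):ℝ)^(r+2) * (2+2*a) + ((2*r:ℕ):ℝ)^(r+2) * (2+2*a) + -2^(r+2+1) * ((r:ℝ)^(r+2) * (2+2*a)) = 0 := by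
    push_cast; rw [mul_pow]; ring
  have z1 : ((2*r:ℕ):ℝ)^(r+2) * N1 / ((2*r:ℕ):ℝ) + ((2*r:ℕ):ℝ)^(r+2) * N1' / ((2*r:ℕ):ℝ) + -2^(r+2+1) * ((r:ℝ)^(r+2) * N1 / r) = 0 := by
    rw [v1]; push_cast; rw [mul_pow]; field_simp; ring
  have z2 : (r:ℝ)^(r+2) * (2+2*a) + -1 * ((r:ℝ)^(r+2) * (2+2*a)) = 0 := by ring
  rw [z0, z1] at B1
  rw [z2] at B2
  refine ⟨_, _, hlim1 _ B1, hlim2 _ _ B2, ?_⟩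
  intro S hS
  have hfac : ((r+2).factorial:ℝ) = (r+2) * (r+1) * r.factorial := by
    rw [Nat.factorial_succ, Nat.factorial_succ]; push_cast; ring
  have hrf : (r.factorial:ℝ) ≠ 0 := by positivity
  have h1 : ((r:ℝ)+1) ≠ 0 := by positivity
  have h2 : ((r:ℝ)+2) ≠ 0 := by positivity
  have hp0 : ((r:ℝ)^r) ≠ 0 := by positivity
  have h2p : ((2:ℝ)^r) ≠ 0 := by positivity
  rw [hfac, v1, v1'] at hS
  have hS2 : (N2' - 7 * N2) * 2 = (r * (2 * ((r+2) * r * (1 + a)))) * (r+1) - S * ((r+2) * (r+1)) := by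
    push_cast at hS
    simp only [mul_pow, pow_add, pow_one] at hS
    field_simp at hS
    linear_combination hS / 4
  have w2 : (N2' - 7 * N2) * 2 = (r+2) * (r+1) * (2 * r^2 * (1+a) - 24 + r * (1 - r) / 2 * (2 + 2*a)) := by
    rw [hN2, hN2']; unfold S2 S1; push_cast; ring
  have hk : ((r:ℝ)+2) * (r+1) ≠ 0 := mul_ne_zero h2 h1
  apply mul_left_cancel₀ hk
  linear_combination w2 - hS2

section partD
variable {d : ℕ}

/-- faces of the hull of finitely many lattice points are hulls of lattice points -/
lemma face_hull (V : Finset (Fin d → ℤ)) (T : Set (Fin d → ℝ)) (c : (Fin d → ℝ) → ℝ)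
    (V' : Finset (Fin d → ℤ)) (hV' : ∀ v, v ∈ V' ↔ v ∈ V ∧ ∀ t ∈ T, coeLat v ⬝ᵥ t = c t)
    (h : ∀ v ∈ V, ∀ t ∈ T, c t ≤ coeLat v ⬝ᵥ t) :
    {y | y ∈ convexHull ℝ (coeLat '' (V : Set (Fin d → ℤ))) ∧ ∀ t ∈ T, y ⬝ᵥ t = c t} =
      convexHull ℝ (coeLat '' (V' : Set (Fin d → ℤ))) := by
  classical
  apply Set.Subset.antisymm
  · rintro y ⟨hy, hyt⟩
    rw [conv_mem_iff] at hy
    obtain ⟨l, hl0, hl1, hl2⟩ := hy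
    have key : ∀ i : V, l i ≠ 0 → (i : Fin d → ℤ) ∈ V' := by
      intro i hi
      rw [hV']
      refine ⟨i.2, fun t ht => ?_⟩
      have h1 : ∑ j : V, l j * (coeLat (j : Fin d → ℤ) ⬝ᵥ t - c t) = 0 := by
        have h2 : (∑ j : V, l j • coeLat (j : Fin d → ℤ)) ⬝ᵥ t = c t := by rw [hl2]; exact hyt t ht
        rw [sum_dotProduct] at h2
        simp only [smul_dotProduct, smul_eq_mul] at h2
        simp only [mul_sub, Finset.sum_sub_distrib]
        rw [h2, ← Finset.sum_mul, hl1]; ring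
      rw [Finset.sum_eq_zero_iff_of_nonneg] at h1
      · have := h1 i (Finset.mem_univ _)
        rcases mul_eq_zero.1 this with h3 | h3
        · exact absurd h3 hi
        · linarith
      · intro j _
        exact mul_nonneg (hl0 j) (by linarith [h j j.2 t ht])
    rw [← hl2]
    have h3 : ∑ i : V, l i • coeLat (i : Fin d → ℤ) = ∑ i ∈ Finset.univ.filter (fun i : V => l i ≠ 0), l i • coeLat (i : Fin d → ℤ) := by
      rw [Finset.sum_filter_of_ne]
      intro x _ hx h0
      exact hx (by rw [h0, zero_smul])
    rw [h3]
    apply (convex_convexHull ℝ _).sum_mem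
    · intro i _; exact hl0 i
    · rw [Finset.sum_filter_ne_zero]; exact hl1
    · intro i hi
      exact subset_convexHull ℝ _ ⟨_, key i (Finset.mem_filter.1 hi).2, rfl⟩
  · apply convexHull_min
    · rintro _ ⟨v, hv, rfl⟩
      have := (hV' v).1 hv
      exact ⟨subset_convexHull ℝ _ ⟨v, this.1, rfl⟩, this.2⟩
    · intro a ha b hb s t hs ht hst
      refine ⟨convex_convexHull ℝ _ ha.1 hb.1 hs ht hst, fun z hz => ?_⟩
      rw [add_dotProduct, smul_dotProduct, smul_dotProduct, ha.2 z hz, hb.2 z hz, smul_eq_mul, smul_eq_mul,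
        ← add_mul, hst, one_mul]

/-- kernel of finitely many functionals -/
lemma ker_dim_ge {ι : Type*} [Fintype ι] (v : ι → Fin d → ℝ) :
    d ≤ Module.finrank ℝ (LinearMap.ker (Matrix.of v).mulVecLin) + Fintype.card ι := by
  have h1 := LinearMap.finrank_range_add_finrank_ker (Matrix.of v).mulVecLin
  have h2 := Submodule.finrank_le (LinearMap.range (Matrix.of v).mulVecLin)
  simp only [Module.finrank_fintype_fun_eq_card, Fintype.card_fin] at h1 h2
  omega

lemma ker_dim_li {ι : Type*} [Fintype ι] (v : ι → Fin d → ℝ) (hv : LinearIndependent ℝ v) :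
    Module.finrank ℝ (LinearMap.ker (Matrix.of v).mulVecLin) + Fintype.card ι = d := by
  have h1 := LinearMap.finrank_range_add_finrank_ker (Matrix.of v).mulVecLin
  have h2 : (Matrix.of v).rank = Fintype.card ι := LinearIndependent.rank_matrix (M := Matrix.of v) hv
  simp only [Module.finrank_fintype_fun_eq_card, Fintype.card_fin] at h1
  unfold Matrix.rank at h2
  omega

lemma mem_ker_of {ι : Type*} (v : ι → Fin d → ℝ) (w : Fin d → ℝ) :
    w ∈ LinearMap.ker (Matrix.of v).mulVecLin ↔ ∀ i, v i ⬝ᵥ w = 0 := by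
  rw [LinearMap.mem_ker]
  exact funext_iff

lemma Ind.solve {a b : Fin d → ℤ} (h : Ind a b) (s t : ℝ) (hst : s • coeLat a + t • coeLat b = 0) :
    s = 0 ∧ t = 0 := by
  obtain ⟨i, j, hij⟩ := h
  have hi := congrFun hst i
  have hj := congrFun hst j
  simp only [Pi.add_apply, Pi.smul_apply, smul_eq_mul, Pi.zero_apply, coeLat] at hi hj
  have hD : ((a i : ℝ) * b j - a j * b i) ≠ 0 := by
    intro h0
    apply hij
    have : (a i : ℝ) * b j = a j * b i := by linarith
    exact_mod_cast this
  constructor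
  · have : s * ((a i : ℝ) * b j - a j * b i) = 0 := by linear_combination (b j : ℝ) * hi - b i * hj
    exact (mul_eq_zero.1 this).resolve_right hD
  · have : t * ((a i : ℝ) * b j - a j * b i) = 0 := by linear_combination (a i : ℝ) * hj - a j * hi
    exact (mul_eq_zero.1 this).resolve_right hD

lemma ext_ind {Q : Set (Fin d → ℝ)} {a b c : Fin d → ℤ} (ha : coeLat a ∈ Q.extremePoints ℝ)
    (hb : coeLat b ∈ Q.extremePoints ℝ) (hc : coeLat c ∈ Q.extremePoints ℝ)
    (hab : a ≠ b) (hac : a ≠ c) (hbc : b ≠ c) : Ind (a - b) (a - c) := by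
  by_contra hI
  unfold Ind at hI
  push Not at hI
  obtain ⟨i, hi⟩ : ∃ i, (a - b) i ≠ 0 := by
    by_contra hh; push Not at hh
    exact hab (sub_eq_zero.1 (funext hh))
  set s : ℤ := (a - b) i with hs
  set t : ℤ := (a - c) i with ht
  have hs0 : (s : ℝ) ≠ 0 := by exact_mod_cast hi
  set ρ : ℝ := t / s with hρ
  have hcc : coeLat c = (1 - ρ) • coeLat a + ρ • coeLat b := by
    ext j
    have := hI i j
    rw [← hs, ← ht] at this
    have h2 : (s : ℝ) * (a j - c j) = (a j - b j) * t := by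
      have : s * (a j - c j) = (a j - b j) * t := by simpa using this
      exact_mod_cast this
    simp only [coeLat, Pi.add_apply, Pi.smul_apply, smul_eq_mul]
    rw [hρ]
    field_simp
    linear_combination -h2
  have hρ0 : ρ ≠ 0 := by
    intro h0
    rw [h0] at hcc
    exact hac (coeLat_inj (by simpa using hcc.symm))
  have hρ1 : ρ ≠ 1 := by
    intro h0
    rw [h0] at hcc
    exact hbc (coeLat_inj (by simpa using hcc.symm))
  rcases lt_or_gt_of_ne hρ0 with h | h
  · have : coeLat a ∈ openSegment ℝ (coeLat b) (coeLat c) := by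
      refine ⟨-ρ / (1 - ρ), 1 / (1 - ρ), div_pos (by linarith) (by linarith), div_pos one_pos (by linarith), ?_, ?_⟩
      · have : (1 - ρ) ≠ 0 := by linarith
        field_simp; ring
      · rw [hcc]
        have : (1 - ρ) ≠ 0 := by linarith
        ext j
        simp only [Pi.add_apply, Pi.smul_apply, smul_eq_mul]
        field_simp; ring
    exact hab (coeLat_inj (ha.2 hb.1 hc.1 this).symm)
  · rcases lt_or_gt_of_ne hρ1 with h' | h'
    · have : coeLat c ∈ openSegment ℝ (coeLat a) (coeLat b) :=
        ⟨1 - ρ, ρ, by linarith, h, by ring, hcc.symm⟩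
      exact hac (coeLat_inj (hc.2 ha.1 hb.1 this))
    · have : coeLat b ∈ openSegment ℝ (coeLat a) (coeLat c) := by
        refine ⟨(ρ - 1) / ρ, 1 / ρ, div_pos (by linarith) h, div_pos one_pos h, ?_, ?_⟩
        · field_simp; ring
        · rw [hcc]
          ext j
          simp only [Pi.add_apply, Pi.smul_apply, smul_eq_mul]
          field_simp; ring
      exact hab (coeLat_inj (hb.2 ha.1 hc.1 this))

lemma prim_ind {a b x y : Fin d → ℤ} (hx : a ⬝ᵥ x = 1) (hy : b ⬝ᵥ y = 1) (hab : a ≠ b) :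
    b = -a ∨ Ind a b := by
  by_contra hcon
  push Not at hcon
  obtain ⟨hne, hI⟩ := hcon
  unfold Ind at hI
  push Not at hI
  have h1 : ∀ i, a i * (b ⬝ᵥ x) = b i := by
    intro i
    calc a i * (b ⬝ᵥ x) = ∑ j, a i * (b j * x j) := by rw [dotProduct, Finset.mul_sum]
      _ = ∑ j, b i * (a j * x j) := by
          apply Finset.sum_congr rfl; intro j _
          linear_combination x j * hI i j
      _ = b i * (a ⬝ᵥ x) := by rw [dotProduct, Finset.mul_sum]
      _ = b i := by rw [hx, mul_one]
  have h2 : ∀ i, b i = (b ⬝ᵥ x) * a i := fun i => by rw [← h1 i]; ring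
  have h3 : b = (b ⬝ᵥ x) • a := by ext i; rw [Pi.smul_apply, smul_eq_mul]; exact h2 i
  have h4 : (b ⬝ᵥ x) * (a ⬝ᵥ y) = 1 := by
    rw [← smul_eq_mul, ← smul_dotProduct, ← h3, hy]
  rcases Int.eq_one_or_neg_one_of_mul_eq_one h4 with h5 | h5
  · rw [h5, one_smul] at h3; exact hab h3.symm
  · rw [h5, neg_one_smul] at h3; exact hne h3

lemma prim_decomp (w : Fin d → ℤ) (hw : w ≠ 0) : ∃ (l : ℤ) (ν b : Fin d → ℤ), w = l • ν ∧ 0 < l ∧ ν ⬝ᵥ b = 1 := by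
  let φ : (Fin d → ℤ) →ₗ[ℤ] ℤ := dotProductBilin ℤ ℤ w
  have hφ : ∀ z, φ z = w ⬝ᵥ z := fun z => rfl
  obtain ⟨n, hn⟩ : ∃ n : ℤ, LinearMap.range φ = Submodule.span ℤ {n} :=
    (Submodule.IsPrincipal.principal (LinearMap.range φ))
  have hdvd : ∀ i, n ∣ w i := by
    intro i
    have : w i ∈ LinearMap.range φ := ⟨Pi.single i 1, by rw [hφ]; simp⟩
    rw [hn, Submodule.mem_span_singleton] at this
    obtain ⟨c, hc⟩ := this
    exact ⟨c, by rw [← hc, smul_eq_mul, mul_comm]⟩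
  have hn0 : n ≠ 0 := by
    rintro rfl
    exact hw (funext fun i => by simpa using hdvd i)
  obtain ⟨b, hb⟩ : ∃ b, φ b = |n| := by
    have : |n| ∈ LinearMap.range φ := by
      rw [hn, Submodule.mem_span_singleton]
      rcases abs_choice n with h | h
      · exact ⟨1, by rw [h]; simp⟩
      · exact ⟨-1, by rw [h]; simp⟩
    exact this
  have hdvd' : ∀ i, |n| ∣ w i := fun i => (abs_dvd _ _).2 (hdvd i)
  choose ν hν using hdvd'
  have hw' : w = |n| • ν := by ext i; rw [Pi.smul_apply, smul_eq_mul]; exact hν i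
  have hpos : 0 < |n| := abs_pos.2 hn0
  refine ⟨|n|, ν, b, hw', hpos, ?_⟩
  rw [hφ] at hb
  conv at hb => lhs; rw [hw']
  rw [smul_dotProduct, smul_eq_mul] at hb
  have : |n| * (ν ⬝ᵥ b) = |n| * 1 := by rw [hb, mul_one]
  exact mul_left_cancel₀ hpos.ne' this

lemma ncard_segment (u u' ν b : Fin d → ℤ) (l : ℤ) (hl : 0 < l) (h : u - u' = l • ν) (hb : ν ⬝ᵥ b = 1) (k : ℕ) :
    ((latticePoints ((k:ℝ) • segment ℝ (coeLat u) (coeLat u'))).ncard : ℤ) = k * l + 1 := by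
  have hν : ν ≠ 0 := by rintro rfl; simp at hb
  have hinj : Function.Injective (fun j : ℤ => (k:ℤ) • u' + j • ν) := by
    intro i j hij
    have : (fun j : ℤ => (k:ℤ) • u' + j • ν) i ⬝ᵥ b = (fun j : ℤ => (k:ℤ) • u' + j • ν) j ⬝ᵥ b := by rw [hij]
    simp only [add_dotProduct, smul_dotProduct, hb, smul_eq_mul] at this
    omega
  have hlR : (0:ℝ) < l := by exact_mod_cast hl
  have hu : coeLat u = coeLat u' + (l:ℝ) • coeLat ν := by
    have h' : u = u' + l • ν := by rw [← h]; abel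
    rw [h']
    ext i; simp [coeLat]
  have hset : latticePoints ((k:ℝ) • segment ℝ (coeLat u) (coeLat u')) =
      (fun j : ℤ => (k:ℤ) • u' + j • ν) '' (Finset.Icc (0:ℤ) (k*l) : Set ℤ) := by
    ext z
    constructor
    · rintro ⟨_, ⟨s, t, hs, ht, hst, rfl⟩, hz⟩
      have hz : coeLat z = (k:ℝ) • coeLat u' + ((k:ℝ) * s * l) • coeLat ν := by
        rw [← hz, hu]
        ext i
        simp only [Pi.add_apply, Pi.smul_apply, smul_eq_mul]
        rw [show t = 1 - s by linarith]; ring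
      refine ⟨(z - (k:ℤ) • u') ⬝ᵥ b, ?_, ?_⟩
      all_goals
        have hj : (((z - (k:ℤ) • u') ⬝ᵥ b : ℤ) : ℝ) = k * s * l := by
          rw [← coe_dot, coeLat_sub, hz]
          have h1 : coeLat ((k:ℤ) • u') = (k:ℝ) • coeLat u' := by ext i; simp [coeLat]
          rw [h1, add_sub_cancel_left, smul_dotProduct, coe_dot, hb]; simp
      · rw [Finset.mem_coe, Finset.mem_Icc]
        constructor
        · have : (0:ℝ) ≤ ((z - (k:ℤ) • u') ⬝ᵥ b : ℤ) := by rw [hj]; positivity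
          exact_mod_cast this
        · have : (((z - (k:ℤ) • u') ⬝ᵥ b : ℤ) : ℝ) ≤ ((k * l : ℤ) : ℝ) := by
            rw [hj]; push_cast
            have : s ≤ 1 := by linarith
            have h2 : (0:ℝ) ≤ k := by positivity
            have := mul_le_mul_of_nonneg_left this (mul_nonneg h2 hlR.le)
            linarith
          exact Int.cast_le.1 this
      · apply coeLat_inj
        rw [hz, ← hj]
        ext i; simp [coeLat]
    · rintro ⟨j, hj, rfl⟩
      rw [Finset.mem_coe, Finset.mem_Icc] at hj
      show coeLat ((k:ℤ) • u' + j • ν) ∈ (k:ℝ) • segment ℝ (coeLat u) (coeLat u')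
      rcases Nat.eq_zero_or_pos k with rfl | hk
      · have : j = 0 := by have := hj.1; have := hj.2; push_cast at *; omega
        subst this
        refine ⟨coeLat u, left_mem_segment ℝ _ _, ?_⟩
        ext i; simp [coeLat]
      · have hkR : (0:ℝ) < k := by exact_mod_cast hk
        have hj0 : (0:ℝ) ≤ j := by exact_mod_cast hj.1
        have hj1 : (j:ℝ) ≤ k * l := by exact_mod_cast hj.2
        refine ⟨(j / (k*l) : ℝ) • coeLat u + (1 - j / (k*l) : ℝ) • coeLat u', ⟨_, _, by positivity, ?_, by ring, rfl⟩, ?_⟩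
        · rw [sub_nonneg, div_le_one (by positivity)]; exact hj1
        · show (k:ℝ) • _ = _
          rw [hu]
          ext i
          simp only [coeLat, Pi.add_apply, Pi.smul_apply, smul_eq_mul]
          push_cast
          field_simp
          ring
  rw [hset, Set.ncard_image_of_injective _ hinj, Set.ncard_coe_finset, Int.card_Icc]
  have : 0 ≤ (k:ℤ) * l := by positivity
  omega

lemma normVol_segment (u u' ν b : Fin d → ℤ) (l : ℤ) (hl : 0 < l) (h : u - u' = l • ν) (hb : ν ⬝ᵥ b = 1) :
    normVol 1 (segment ℝ (coeLat u) (coeLat u')) = l := by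
  rw [normVol_eq_of_tendsto 1 _ (l:ℝ)]
  · simp
  · have h1 : Tendsto (fun k : ℕ => (l:ℝ) + 1 / (k:ℝ)) atTop (nhds ((l:ℝ) + 0)) :=
      tendsto_const_nhds.add tendsto_one_div_atTop_nhds_zero_nat
    rw [add_zero] at h1
    refine h1.congr' ?_
    filter_upwards [eventually_ge_atTop 1] with k hk
    have hk' : (k:ℝ) ≠ 0 := by positivity
    have h2 := ncard_segment u u' ν b l hl h hb k
    have h3 : ((latticePoints ((k:ℝ) • segment ℝ (coeLat u) (coeLat u'))).ncard : ℝ) = k * l + 1 := by exact_mod_cast h2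
    rw [h3]; field_simp

end partD

section partD
variable {d : ℕ}

/-- the data of a Gorenstein polytope together with the vertices of the dual -/
structure Ctx (d r : ℕ) (U V : Finset (Fin d → ℤ)) (Δ : Set (Fin d → ℝ)) (m : Fin d → ℤ) : Prop where
  hr : 1 ≤ r
  hd : d = r + 2
  hΔ : Δ = convexHull ℝ (coeLat '' (V : Set (Fin d → ℤ)))
  hV : V.Nonempty
  hU : U.Nonempty
  hmem : ∀ y, y ∈ Δ ↔ ∀ u ∈ U, 0 ≤ (r:ℝ) * (coeLat u ⬝ᵥ y) - coeLat u ⬝ᵥ coeLat m + 1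
  recc : ∀ y : Fin d → ℝ, (∀ u ∈ U, 0 ≤ coeLat u ⬝ᵥ y) → y = 0
  bd : ∃ C : ℕ, ∀ y : Fin d → ℝ, (∀ u ∈ U, -1 ≤ coeLat u ⬝ᵥ y) → ∀ i, |y i| ≤ C
  prim : ∀ u ∈ U, ∃ b : Fin d → ℤ, u ⬝ᵥ b = 1
  h3 : ∀ a ∈ U, ∀ b ∈ U, ∀ c ∈ U, a ≠ b → a ≠ c → b ≠ c → Ind (a - b) (a - c)

/-- the two-facet face -/
def fac (r : ℕ) (Δ : Set (Fin d → ℝ)) (m : Fin d → ℤ) (x : (Fin d → ℤ) × (Fin d → ℤ)) : Set (Fin d → ℝ) :=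
  {y | y ∈ Δ ∧ (r:ℝ) * (coeLat x.1 ⬝ᵥ y) - coeLat x.1 ⬝ᵥ coeLat m + 1 = 0 ∧
    (r:ℝ) * (coeLat x.2 ⬝ᵥ y) - coeLat x.2 ⬝ᵥ coeLat m + 1 = 0}

variable {r : ℕ} {U V : Finset (Fin d → ℤ)} {Δ : Set (Fin d → ℝ)} {m : Fin d → ℤ}

lemma Ctx.wd (H : Ctx d r U V Δ m) : ∃ W : WD d, W.A = U := by
  classical
  have hU := H.hU
  let g : (Fin d → ℤ) → ℤ := fun z => U.sup' hU fun u => u ⬝ᵥ z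
  have hle : ∀ a ∈ U, ∀ z, a ⬝ᵥ z ≤ g z := fun a ha z => Finset.le_sup' (fun u => u ⬝ᵥ z) ha
  have hex : ∀ z, ∃ a ∈ U, a ⬝ᵥ z = g z := by
    intro z
    obtain ⟨a, ha, h⟩ := Finset.exists_mem_eq_sup' hU fun u => u ⬝ᵥ z
    exact ⟨a, ha, h.symm⟩
  have hz : ∀ z, g z ≤ 0 → z = 0 := by
    intro z hz
    have := H.recc (coeLat (-z)) fun u hu => by
      rw [coe_dot, dotProduct_neg]
      have := hle u hu z
      exact_mod_cast (by omega : 0 ≤ -(u ⬝ᵥ z))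
    have h0 : coeLat (0 : Fin d → ℤ) = 0 := by ext i; simp [coeLat]
    have := coeLat_inj (this.trans h0.symm)
    exact neg_eq_zero.1 this
  have hg0 : g 0 = 0 := by
    obtain ⟨a, -, h⟩ := hex 0
    rw [← h, dotProduct_zero]
  have hnn : ∀ z, 0 ≤ g z := by
    intro z
    by_contra h
    have := hz z (by omega)
    rw [this, hg0] at h
    exact h le_rfl
  obtain ⟨C, hC⟩ := H.bd
  refine ⟨⟨U, g, C, hle, hex, ?_, hnn⟩, rfl⟩
  intro z i
  rcases (hnn z).eq_or_lt with h0 | hpos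
  · have := hz z h0.ge
    rw [this, hg0]; simp
  · have hposR : (0:ℝ) < g z := by exact_mod_cast hpos
    have h1 := hC ((-(1 / (g z : ℝ))) • coeLat z) (fun u hu => by
      rw [dotProduct_smul, coe_dot, smul_eq_mul]
      have : ((u ⬝ᵥ z : ℤ) : ℝ) ≤ g z := by exact_mod_cast hle u hu z
      have h2 : 1 / (g z : ℝ) * ((u ⬝ᵥ z : ℤ) : ℝ) ≤ 1 / (g z : ℝ) * g z := by gcongr
      rw [one_div_mul_cancel hposR.ne'] at h2
      linarith) i
    rw [Pi.smul_apply, smul_eq_mul, abs_mul, abs_neg, abs_of_pos (by positivity : 0 < 1 / (g z : ℝ)),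
      one_div_mul_eq_div, div_le_iff₀ hposR] at h1
    have h2 : ((|z i| : ℤ) : ℝ) ≤ ((C * g z : ℤ) : ℝ) := by
      push_cast; exact h1
    exact Int.cast_le.1 h2

lemma Ctx.smul_mem (H : Ctx d r U V Δ m) (K : ℕ) (hK : 1 ≤ K) (z : Fin d → ℤ) (u : Fin d → ℤ) :
    (r:ℝ) * (coeLat u ⬝ᵥ (((r*K:ℕ):ℝ)⁻¹ • coeLat ((K:ℤ) • m - z))) - coeLat u ⬝ᵥ coeLat m + 1 =
      ((K - u ⬝ᵥ z : ℤ) : ℝ) / K := by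
  have hr : (r:ℝ) ≠ 0 := by have := H.hr; positivity
  have hK0 : (K:ℝ) ≠ 0 := by positivity
  rw [dotProduct_smul, coe_dot, coe_dot, dotProduct_sub, dotProduct_smul]
  push_cast
  simp only [smul_eq_mul]
  field_simp
  push_cast
  ring

lemma Ctx.mem_dil (H : Ctx d r U V Δ m) (K : ℕ) (hK : 1 ≤ K) (z : Fin d → ℤ) :
    coeLat ((K:ℤ) • m - z) ∈ ((r*K:ℕ):ℝ) • Δ ↔ ∀ u ∈ U, u ⬝ᵥ z ≤ K := by
  have hr := H.hr
  have hK0 : (0:ℝ) < K := by exact_mod_cast hK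
  have h0 : ((r*K:ℕ):ℝ) ≠ 0 := by
    have : 0 < r * K := by positivity
    exact_mod_cast this.ne'
  rw [Set.mem_smul_set_iff_inv_smul_mem₀ h0, H.hmem]
  apply forall₂_congr
  intro u hu
  rw [H.smul_mem K hK, le_div_iff₀ hK0, zero_mul]
  rw [Int.cast_nonneg_iff]
  omega

lemma Ctx.mem_fac (H : Ctx d r U V Δ m) (K : ℕ) (hK : 1 ≤ K) (z : Fin d → ℤ) (x : (Fin d → ℤ) × (Fin d → ℤ)) :
    coeLat ((K:ℤ) • m - z) ∈ ((r*K:ℕ):ℝ) • fac r Δ m x ↔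
      (∀ u ∈ U, u ⬝ᵥ z ≤ K) ∧ x.1 ⬝ᵥ z = K ∧ x.2 ⬝ᵥ z = K := by
  have hr := H.hr
  have hK0 : (K:ℝ) ≠ 0 := by positivity
  have h0 : ((r*K:ℕ):ℝ) ≠ 0 := by
    have : 0 < r * K := by positivity
    exact_mod_cast this.ne'
  have h1 : ∀ u : Fin d → ℤ, ((K - u ⬝ᵥ z : ℤ) : ℝ) / K = 0 ↔ u ⬝ᵥ z = K := by
    intro u
    rw [div_eq_zero_iff, or_iff_left hK0, Int.cast_eq_zero]
    omega
  rw [← H.mem_dil K hK, Set.mem_smul_set_iff_inv_smul_mem₀ h0, Set.mem_smul_set_iff_inv_smul_mem₀ h0]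
  show _ ∧ _ ∧ _ ↔ _
  rw [H.smul_mem K hK, H.smul_mem K hK, h1, h1]

lemma ncard_reflect (K : ℕ) (m : Fin d → ℤ) (S : Set (Fin d → ℤ)) (T : Set (Fin d → ℤ))
    (h : ∀ z, (K:ℤ) • m - z ∈ T ↔ z ∈ S) : S.ncard = T.ncard := by
  have : T = (fun z => (K:ℤ) • m - z) '' S := by
    ext t
    constructor
    · intro ht
      refine ⟨(K:ℤ) • m - t, ?_, by simp⟩
      rw [← h]; simpa using ht
    · rintro ⟨z, hz, rfl⟩
      exact (h z).2 hz
  rw [this, Set.ncard_image_of_injective]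
  intro a b hab
  simpa using hab

lemma WD.g_le_iff (W : WD d) (z : Fin d → ℤ) (k : ℤ) : W.g z ≤ k ↔ ∀ u ∈ W.A, u ⬝ᵥ z ≤ k := by
  constructor
  · intro h u hu; exact (W.le u hu z).trans h
  · intro h
    obtain ⟨a, ha, he⟩ := W.ex z
    rw [← he]; exact h a ha

lemma Ctx.count (H : Ctx d r U V Δ m) (W : WD d) (hW : W.A = U) (K : ℕ) :
    ({z | W.g z ≤ K} : Set (Fin d → ℤ)).ncard = (latticePoints (((r*K:ℕ):ℝ) • Δ)).ncard := by
  apply ncard_reflect K m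
  intro z
  show coeLat ((K:ℤ) • m - z) ∈ ((r*K:ℕ):ℝ) • Δ ↔ W.g z ≤ K
  rcases Nat.eq_zero_or_pos K with rfl | hK
  · have hne : Δ.Nonempty := by
      rw [H.hΔ, convexHull_nonempty_iff]
      simpa using H.hV
    simp only [mul_zero, Nat.cast_zero, zero_smul, zero_sub]
    rw [Set.zero_smul_set hne]
    constructor
    · intro h
      have h0 : coeLat (0 : Fin d → ℤ) = 0 := by ext i; simp [coeLat]
      have h1 : -z = 0 := coeLat_inj (Eq.trans h h0.symm)
      rw [neg_eq_zero.1 h1]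
      obtain ⟨a, -, he⟩ := W.ex 0
      rw [← he, dotProduct_zero]
    · intro h
      have h1 : z = 0 := by
        funext i
        have := W.bd z i
        have h2 := W.nn z
        have h3 : W.g z = 0 := le_antisymm h h2
        rw [h3, mul_zero] at this
        exact abs_nonpos_iff.1 this
      rw [h1]
      ext i; simp [coeLat]
  · rw [H.mem_dil K hK, W.g_le_iff, hW]

lemma Ctx.count_fac (H : Ctx d r U V Δ m) (W : WD d) (hW : W.A = U) (K : ℕ) (hK : 1 ≤ K)
    (x : (Fin d → ℤ) × (Fin d → ℤ)) (hx : x.1 ∈ U) :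
    (W.Fac x K).ncard = (latticePoints (((r*K:ℕ):ℝ) • fac r Δ m x)).ncard := by
  apply ncard_reflect K m
  intro z
  show coeLat ((K:ℤ) • m - z) ∈ ((r*K:ℕ):ℝ) • fac r Δ m x ↔ x.1 ⬝ᵥ z = K ∧ x.2 ⬝ᵥ z = K ∧ W.g z = K
  rw [H.mem_fac K hK, ← hW, ← W.g_le_iff]
  constructor
  · rintro ⟨h1, h2, h3⟩
    refine ⟨h2, h3, le_antisymm h1 ?_⟩
    rw [← h2]
    exact W.le _ (by rw [hW]; exact hx) z
  · rintro ⟨h1, h2, h3⟩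
    exact ⟨h3.le, h1, h2⟩

/-- limits along faces -/
lemma Ctx.fac_limit (H : Ctx d r U V Δ m) (x : (Fin d → ℤ) × (Fin d → ℤ)) (hx1 : x.1 ∈ U) (hx2 : x.2 ∈ U) (p : ℕ)
    (hp : (fac r Δ m x).Nonempty → dimSet (fac r Δ m x) ≤ p) :
    ∃ L : ℝ, Tendsto (fun k : ℕ => ((latticePoints ((k:ℝ) • fac r Δ m x)).ncard : ℝ) / (k:ℝ)^p) atTop (nhds L) ∧
      (¬ ((fac r Δ m x).Nonempty ∧ dimSet (fac r Δ m x) = p) → L = 0) := by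
  classical
  have hr : (0:ℝ) < r := by exact_mod_cast H.hr
  by_cases hne : (fac r Δ m x).Nonempty
  · let c : (Fin d → ℝ) → ℝ := fun t => (coeLat m ⬝ᵥ t - 1) / r
    let T : Set (Fin d → ℝ) := {coeLat x.1, coeLat x.2}
    let V' := V.filter fun v => ∀ t ∈ T, coeLat v ⬝ᵥ t = c t
    have heq : ∀ (y : Fin d → ℝ) (u : Fin d → ℤ), (r:ℝ) * (coeLat u ⬝ᵥ y) - coeLat u ⬝ᵥ coeLat m + 1 = 0 ↔
        y ⬝ᵥ coeLat u = c (coeLat u) := by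
      intro y u
      simp only [c]
      rw [eq_div_iff hr.ne', dotProduct_comm y, dotProduct_comm (coeLat m)]
      constructor <;> intro h <;> linarith
    have h1 := face_hull V T c V' (fun v => by simp [V']) (by
      intro v hv t ht
      have hvΔ : coeLat v ∈ Δ := by rw [H.hΔ]; exact subset_convexHull ℝ _ ⟨v, hv, rfl⟩
      rw [H.hmem] at hvΔ
      have aux : ∀ u ∈ U, c (coeLat u) ≤ coeLat v ⬝ᵥ coeLat u := by
        intro u hu
        have := hvΔ u hu
        simp only [c]
        rw [div_le_iff₀ hr, dotProduct_comm (coeLat m), dotProduct_comm (coeLat v)]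
        linarith
      rcases ht with rfl | ht
      · exact aux _ hx1
      · rw [Set.mem_singleton_iff] at ht
        rw [ht]; exact aux _ hx2)
    have h2 : fac r Δ m x = convexHull ℝ (coeLat '' (V' : Set (Fin d → ℤ))) := by
      rw [← h1, ← H.hΔ]
      ext y
      show _ ∧ _ ∧ _ ↔ _ ∧ _
      rw [heq, heq]
      simp [T]
    have hV' : V'.Nonempty := by
      rw [h2, convexHull_nonempty_iff] at hne
      simpa using hne
    have hp' := hp hne
    rw [h2] at hp' ⊢
    obtain ⟨L, hL1, hL2⟩ := lp_limit V' hV' p hp'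
    refine ⟨L, hL1, fun h => hL2 (lt_of_le_of_ne hp' fun he => h ⟨?_, he⟩)⟩
    rw [← h2]; exact hne
  · rw [Set.not_nonempty_iff_eq_empty] at hne
    refine ⟨0, ?_, fun _ => rfl⟩
    have : ∀ k : ℕ, latticePoints ((k:ℝ) • fac r Δ m x) = ∅ := by
      intro k; rw [hne, Set.smul_set_empty]; rfl
    simp [this]

/-- linear forms vanish on directions of sets where they are constant -/
lemma vectorSpan_le_ker {ι : Type*} (v : ι → Fin d → ℝ) (θ : Set (Fin d → ℝ)) (c : ι → ℝ)
    (h : ∀ y ∈ θ, ∀ i, v i ⬝ᵥ y = c i) :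
    (affineSpan ℝ θ).direction ≤ LinearMap.ker (Matrix.of v).mulVecLin := by
  rw [direction_affineSpan, vectorSpan, Submodule.span_le]
  rintro _ ⟨a, ha, b, hb, rfl⟩
  rw [SetLike.mem_coe, mem_ker_of]
  intro i
  show v i ⬝ᵥ (a - b) = 0
  rw [dotProduct_sub, h a ha, h b hb, sub_self]

lemma dim_le_of_li {ι : Type*} [Fintype ι] (v : ι → Fin d → ℝ) (hv : LinearIndependent ℝ v)
    (θ : Set (Fin d → ℝ)) (c : ι → ℝ)
    (h : ∀ y ∈ θ, ∀ i, v i ⬝ᵥ y = c i) : dimSet θ + Fintype.card ι ≤ d := by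
  have h1 := Submodule.finrank_mono (vectorSpan_le_ker v θ c h)
  have h2 := ker_dim_li v hv
  unfold dimSet
  omega

lemma Ctx.eqv (H : Ctx d r U V Δ m) (y : Fin d → ℝ) (u : Fin d → ℤ) :
    (r:ℝ) * (coeLat u ⬝ᵥ y) - coeLat u ⬝ᵥ coeLat m + 1 = 0 ↔
        coeLat u ⬝ᵥ y = (coeLat u ⬝ᵥ coeLat m - 1) / r := by
  have hr : (0:ℝ) < r := by exact_mod_cast H.hr
  rw [eq_div_iff hr.ne']
  constructor <;> intro h <;> linarith

lemma Ctx.ind (H : Ctx d r U V Δ m) {a b : Fin d → ℤ} (ha : a ∈ U) (hb : b ∈ U) (hab : a ≠ b) :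
    b = -a ∨ Ind a b := by
  obtain ⟨x, hx⟩ := H.prim a ha
  obtain ⟨y, hy⟩ := H.prim b hb
  exact prim_ind hx hy hab

lemma Ctx.dim_facet (H : Ctx d r U V Δ m) {a : Fin d → ℤ} (ha : a ∈ U) : dimSet (fac r Δ m (a, a)) ≤ r + 1 := by
  have ha0 : coeLat a ≠ 0 := by
    intro h0
    obtain ⟨b, hb⟩ := H.prim a ha
    have := coe_dot a b
    rw [h0, hb, zero_dotProduct] at this
    norm_num at this
  have := dim_le_of_li (fun _ : Fin 1 => coeLat a) (by
    rw [linearIndependent_unique_iff]; exact ha0) (fac r Δ m (a,a)) (fun _ => _)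
    (fun y hy _ => (H.eqv y a).1 hy.2.1)
  have := H.hd
  simp at *
  omega

lemma Ctx.dim_ridge (H : Ctx d r U V Δ m) (x : (Fin d → ℤ) × (Fin d → ℤ)) (hx : x ∈ U.offDiag)
    (hne : (fac r Δ m x).Nonempty) : dimSet (fac r Δ m x) ≤ r := by
  obtain ⟨h1, h2, h12⟩ := Finset.mem_offDiag.1 hx
  have hI : Ind x.1 x.2 := by
    rcases H.ind h1 h2 h12 with h | h
    · exfalso
      obtain ⟨y, -, hy1, hy2⟩ := hne
      have : coeLat x.2 = -coeLat x.1 := by rw [h]; ext i; simp [coeLat]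
      rw [this, neg_dotProduct, neg_dotProduct] at hy2
      linarith
    · exact h
  have := dim_le_of_li ![coeLat x.1, coeLat x.2] (LinearIndependent.pair_iff.2 fun s t h => hI.solve s t h)
    (fac r Δ m x) ![(coeLat x.1 ⬝ᵥ coeLat m - 1) / r, (coeLat x.2 ⬝ᵥ coeLat m - 1) / r]
    (fun y hy i => by
      fin_cases i
      · exact (H.eqv y x.1).1 hy.2.1
      · exact (H.eqv y x.2).1 hy.2.2)
  have := H.hd
  simp at *
  omega

end partD

section partD
variable {d : ℕ} {r : ℕ} {U V : Finset (Fin d → ℤ)} {Δ : Set (Fin d → ℝ)} {m : Fin d → ℤ}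

lemma Ctx.fac_face (H : Ctx d r U V Δ m) (x : (Fin d → ℤ) × (Fin d → ℤ)) (h1 : x.1 ∈ U) (h2 : x.2 ∈ U)
    (hne : (fac r Δ m x).Nonempty) (hdim : dimSet (fac r Δ m x) = r) : IsFaceOfDim Δ r (fac r Δ m x) := by
  have hr : (0:ℝ) < r := by exact_mod_cast H.hr
  refine ⟨fun _ => ?_, hne, hdim⟩
  let L0 : (Fin d → ℝ) →ₗ[ℝ] ℝ := dotProductBilin ℝ ℝ (-(coeLat x.1 + coeLat x.2))
  have hL0 : ∀ y, LinearMap.toContinuousLinearMap L0 y = -(coeLat x.1 ⬝ᵥ y + coeLat x.2 ⬝ᵥ y) := by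
    intro y
    show (-(coeLat x.1 + coeLat x.2)) ⬝ᵥ y = _
    rw [neg_dotProduct, add_dotProduct]
  refine ⟨LinearMap.toContinuousLinearMap L0, ?_⟩
  ext y
  constructor
  · rintro ⟨hy, hy1, hy2⟩
    refine ⟨hy, fun z hz => ?_⟩
    rw [hL0, hL0]
    have hz1 := (H.hmem z).1 hz x.1 h1
    have hz2 := (H.hmem z).1 hz x.2 h2
    have e : (r:ℝ) * (coeLat x.1 ⬝ᵥ y + coeLat x.2 ⬝ᵥ y) ≤ r * (coeLat x.1 ⬝ᵥ z + coeLat x.2 ⬝ᵥ z) := by linarith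
    have := le_of_mul_le_mul_left e hr
    linarith
  · rintro ⟨hy, hmax⟩
    obtain ⟨z, hz, hz1, hz2⟩ := hne
    have h := hmax z hz
    rw [hL0, hL0] at h
    have hy1 := (H.hmem y).1 hy x.1 h1
    have hy2 := (H.hmem y).1 hy x.2 h2
    have e : (r:ℝ) * (coeLat x.1 ⬝ᵥ y + coeLat x.2 ⬝ᵥ y) ≤ r * (coeLat x.1 ⬝ᵥ z + coeLat x.2 ⬝ᵥ z) :=
      mul_le_mul_of_nonneg_left (by linarith) hr.le
    exact ⟨hy, by linarith, by linarith⟩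

lemma Ctx.key (H : Ctx d r U V Δ m) (θ : Set (Fin d → ℝ)) (hθ : IsFaceOfDim Δ r θ) :
    ∃ x ∈ U.offDiag, fac r Δ m x = θ ∧
      ∀ v ∈ U, (∀ y ∈ θ, (r:ℝ) * (coeLat v ⬝ᵥ y) - coeLat v ⬝ᵥ coeLat m + 1 = 0) → v = x.1 ∨ v = x.2 := by
  classical
  have hr : (0:ℝ) < r := by exact_mod_cast H.hr
  obtain ⟨hexp, hne, hdim⟩ := hθ
  obtain ⟨l, hl⟩ := hexp hne
  have hmemθ : ∀ y, y ∈ θ ↔ y ∈ Δ ∧ ∀ z ∈ Δ, l z ≤ l y := fun y => by rw [hl]; rfl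
  have hconv : Convex ℝ θ := hexp.convex (by rw [H.hΔ]; exact convex_convexHull ℝ _)
  let q : (Fin d → ℤ) → (Fin d → ℝ) → ℝ := fun v y => (r:ℝ) * (coeLat v ⬝ᵥ y) - coeLat v ⬝ᵥ coeLat m + 1
  have hq : ∀ v ∈ U, ∀ y ∈ Δ, 0 ≤ q v y := fun v hv y hy => (H.hmem y).1 hy v hv
  let B := U.filter fun v => ∀ y ∈ θ, q v y = 0
  have hB : ∀ v, v ∈ B ↔ v ∈ U ∧ ∀ y ∈ θ, q v y = 0 := fun v => by simp [B]
  obtain ⟨y0, hy0⟩ := hne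
  -- a relative interior point
  have hw : ∀ v : Fin d → ℤ, ∃ y ∈ θ, v ∈ U → v ∉ B → 0 < q v y := by
    intro v
    by_cases h : v ∈ U ∧ v ∉ B
    · have : ∃ y ∈ θ, q v y ≠ 0 := by
        by_contra hh
        push Not at hh
        exact h.2 ((hB v).2 ⟨h.1, hh⟩)
      obtain ⟨y, hy, hyq⟩ := this
      exact ⟨y, hy, fun _ _ => lt_of_le_of_ne (hq v h.1 y ((hmemθ y).1 hy).1) hyq.symm⟩
    · exact ⟨y0, hy0, fun h1 h2 => absurd ⟨h1, h2⟩ h⟩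
  choose Y hYθ hYq using hw
  have hUc : (0:ℝ) < U.card := by
    have := Finset.card_pos.2 H.hU
    exact_mod_cast this
  let x0 : Fin d → ℝ := ∑ v ∈ U, (1 / (U.card:ℝ)) • Y v
  have hx0 : x0 ∈ θ := by
    apply hconv.sum_mem
    · intro _ _; positivity
    · rw [Finset.sum_const, nsmul_eq_mul]; field_simp
    · intro v _; exact hYθ v
  have hx0q : ∀ v ∈ U, v ∉ B → 0 < q v x0 := by
    intro v hv hvB
    have h1 : q v x0 = ∑ w ∈ U, (1 / (U.card:ℝ)) * q v (Y w) := by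
      simp only [q, x0]
      rw [dotProduct_sum]
      simp only [dotProduct_smul, smul_eq_mul]
      simp only [mul_add, mul_sub, Finset.sum_add_distrib, Finset.sum_sub_distrib, Finset.sum_const, nsmul_eq_mul, Finset.mul_sum]
      field_simp
    rw [h1]
    apply Finset.sum_pos'
    · intro w _
      exact mul_nonneg (by positivity) (hq v hv _ ((hmemθ _).1 (hYθ w)).1)
    · exact ⟨v, hv, mul_pos (by positivity) (hYq v hv hvB)⟩
  -- directions
  have hdir : (affineSpan ℝ θ).direction = LinearMap.ker (Matrix.of fun b : B => coeLat (b : Fin d → ℤ)).mulVecLin := by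
    apply le_antisymm
    · exact vectorSpan_le_ker _ θ (fun b => _) fun y hy b => (H.eqv y b).1 (((hB b).1 b.2).2 y hy)
    · intro w hw
      rw [mem_ker_of] at hw
      have hev : ∀ s : ℝ, (∀ᶠ ε in nhdsWithin (0:ℝ) (Set.Ioi 0), ∀ v ∈ U,
          0 ≤ q v (x0 + ε • (s • w))) := by
        intro s
        rw [Finset.eventually_all]
        intro v hv
        have hqe : ∀ ε : ℝ, q v (x0 + ε • (s • w)) = q v x0 + ε * (r * s * (coeLat v ⬝ᵥ w)) := by
          intro ε
          simp only [q, dotProduct_add, dotProduct_smul, smul_eq_mul]; ring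
        simp only [hqe]
        by_cases hvB : v ∈ B
        · have := hw ⟨v, hvB⟩
          simp only at this
          rw [this]
          simp [hq v hv x0 ((hmemθ _).1 hx0).1]
        · have ht : Tendsto (fun ε : ℝ => q v x0 + ε * (r * s * (coeLat v ⬝ᵥ w))) (nhdsWithin (0:ℝ) (Set.Ioi 0))
              (nhds (q v x0 + 0 * (r * s * (coeLat v ⬝ᵥ w)))) := by
            apply Tendsto.mono_left _ nhdsWithin_le_nhds
            exact Continuous.tendsto (by fun_prop) 0
          rw [zero_mul, add_zero] at ht
          filter_upwards [ht.eventually (lt_mem_nhds (hx0q v hv hvB))] with ε hε using hε.le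
      obtain ⟨ε, ⟨hε1, hε2⟩, hε0⟩ := (((hev 1).and (hev (-1))).and self_mem_nhdsWithin).exists
      have hε0 : 0 < ε := hε0
      have hm1 : x0 + ε • ((1:ℝ) • w) ∈ Δ := (H.hmem _).2 hε1
      have hm2 : x0 + ε • ((-1:ℝ) • w) ∈ Δ := (H.hmem _).2 hε2
      have hmx := ((hmemθ _).1 hx0).2
      have hl2 := hmx _ hm2
      have hin : x0 + ε • ((1:ℝ) • w) ∈ θ := by
        rw [hmemθ]
        refine ⟨hm1, fun z hz => (hmx z hz).trans ?_⟩
        simp only [map_add, map_smul, smul_eq_mul] at hl2 ⊢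
        linarith
      have hd1 := AffineSubspace.vsub_mem_direction (subset_affineSpan ℝ θ hin) (subset_affineSpan ℝ θ hx0)
      have : w = ε⁻¹ • ((x0 + ε • ((1:ℝ) • w)) -ᵥ x0) := by
        rw [vsub_eq_sub, add_sub_cancel_left, one_smul, smul_smul, inv_mul_cancel₀ hε0.ne', one_smul]
      rw [this]
      exact Submodule.smul_mem _ _ hd1
  have hlc : ∀ w ∈ (affineSpan ℝ θ).direction, l w = 0 := by
    intro w hw
    have : (affineSpan ℝ θ).direction ≤ LinearMap.ker (l : (Fin d → ℝ) →ₗ[ℝ] ℝ) := by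
      rw [direction_affineSpan, vectorSpan, Submodule.span_le]
      rintro _ ⟨a, ha, b, hb, rfl⟩
      rw [SetLike.mem_coe, LinearMap.mem_ker]
      show l (a - b) = 0
      rw [map_sub, sub_eq_zero]
      exact le_antisymm (((hmemθ b).1 hb).2 a ((hmemθ a).1 ha).1) (((hmemθ a).1 ha).2 b ((hmemθ b).1 hb).1)
    exact LinearMap.mem_ker.1 (this hw)
  have hback : ∀ y ∈ Δ, (∀ b ∈ B, q b y = 0) → y ∈ θ := by
    intro y hy hyB
    have h1 : y - x0 ∈ (affineSpan ℝ θ).direction := by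
      rw [hdir, mem_ker_of]
      intro b
      have e1 := (H.eqv y b).1 (hyB b b.2)
      have e2 := (H.eqv x0 b).1 (((hB b).1 b.2).2 x0 hx0)
      rw [dotProduct_sub, e1, e2, sub_self]
    have h2 := hlc _ h1
    rw [map_sub, sub_eq_zero] at h2
    rw [hmemθ]
    refine ⟨hy, fun z hz => ?_⟩
    rw [h2]; exact ((hmemθ _).1 hx0).2 z hz
  -- cardinality
  have hfr : Module.finrank ℝ (LinearMap.ker (Matrix.of fun b : B => coeLat (b : Fin d → ℤ)).mulVecLin) = r := by
    rw [← hdir]; exact hdim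
  have hge : 2 ≤ B.card := by
    have h1 := ker_dim_ge (fun b : B => coeLat (b : Fin d → ℤ))
    rw [hfr, Fintype.card_coe] at h1
    have := H.hd
    omega
  have hle : B.card ≤ 2 := by
    by_contra hcon
    obtain ⟨a, b, c, ha, hb, hc, hab, hac, hbc⟩ := Finset.two_lt_card_iff.1 (by omega : 2 < B.card)
    have hI := H.h3 a ((hB a).1 ha).1 b ((hB b).1 hb).1 c ((hB c).1 hc).1 hab hac hbc
    have ea := (hB a).1 ha |>.2
    have eb := (hB b).1 hb |>.2
    have ec := (hB c).1 hc |>.2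
    have hdot : ∀ v, q v x0 = coeLat v ⬝ᵥ ((r:ℝ) • x0 - coeLat m) + 1 := by
      intro v
      simp only [q]; rw [dotProduct_sub, dotProduct_smul, smul_eq_mul]
    have hli : LinearIndependent ℝ ![coeLat a, coeLat (a - b), coeLat (a - c)] := by
      rw [Fintype.linearIndependent_iff]
      intro g hg
      rw [Fin.sum_univ_three] at hg
      simp only [Matrix.cons_val] at hg
      have h0 : g 0 = 0 := by
        have := congrArg (fun y => y ⬝ᵥ ((r:ℝ) • x0 - coeLat m)) hg
        simp only [add_dotProduct, smul_dotProduct, coeLat_sub, sub_dotProduct (coeLat a), smul_eq_mul, zero_dotProduct] at this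
        have f1 := ea x0 hx0
        have f2 := eb x0 hx0
        have f3 := ec x0 hx0
        rw [hdot] at f1 f2 f3
        have g1 : coeLat a ⬝ᵥ ((r:ℝ) • x0 - coeLat m) = -1 := by linarith
        have g2 : coeLat b ⬝ᵥ ((r:ℝ) • x0 - coeLat m) = -1 := by linarith
        have g3 : coeLat c ⬝ᵥ ((r:ℝ) • x0 - coeLat m) = -1 := by linarith
        rw [g1, g2, g3] at this
        linarith
      rw [h0, zero_smul, zero_add] at hg
      have := hI.solve _ _ hg
      intro i
      fin_cases i
      · exact h0
      · exact this.1
      · exact this.2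
    have := dim_le_of_li _ hli θ ![(coeLat a ⬝ᵥ coeLat m - 1) / r, (coeLat a ⬝ᵥ coeLat m - 1) / r - (coeLat b ⬝ᵥ coeLat m - 1) / r,
        (coeLat a ⬝ᵥ coeLat m - 1) / r - (coeLat c ⬝ᵥ coeLat m - 1) / r] (by
      intro y hy i
      have f1 := (H.eqv y a).1 (ea y hy)
      have f2 := (H.eqv y b).1 (eb y hy)
      have f3 := (H.eqv y c).1 (ec y hy)
      fin_cases i
      · exact f1
      · show coeLat (a - b) ⬝ᵥ y = _
        rw [coeLat_sub, sub_dotProduct, f1, f2]; rfl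
      · show coeLat (a - c) ⬝ᵥ y = _
        rw [coeLat_sub, sub_dotProduct, f1, f3]; rfl)
    rw [hdim, Fintype.card_fin] at this
    have := H.hd
    omega
  obtain ⟨a, b, hab, hBab⟩ := Finset.card_eq_two.1 (le_antisymm hle hge)
  have haB : a ∈ B := by rw [hBab]; simp
  have hbB : b ∈ B := by rw [hBab]; simp
  refine ⟨(a, b), Finset.mem_offDiag.2 ⟨((hB a).1 haB).1, ((hB b).1 hbB).1, hab⟩, ?_, ?_⟩
  · ext y
    constructor
    · rintro ⟨hy, hy1, hy2⟩
      apply hback y hy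
      intro v hv
      rw [hBab, Finset.mem_insert, Finset.mem_singleton] at hv
      rcases hv with rfl | rfl
      · exact hy1
      · exact hy2
    · intro hy
      exact ⟨((hmemθ y).1 hy).1, ((hB a).1 haB).2 y hy, ((hB b).1 hbB).2 y hy⟩
  · intro v hv hvy
    have : v ∈ B := (hB v).2 ⟨hv, hvy⟩
    rw [hBab, Finset.mem_insert, Finset.mem_singleton] at this
    exact this

end partD

section partD
variable {d : ℕ} {r : ℕ} {U V : Finset (Fin d → ℤ)} {Δ : Set (Fin d → ℝ)} {m : Fin d → ℤ}

lemma Ctx.good (H : Ctx d r U V Δ m) (x : (Fin d → ℤ) × (Fin d → ℤ)) (hx : x ∈ U.offDiag)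
    (hne : (fac r Δ m x).Nonempty) (hdim : dimSet (fac r Δ m x) = r) (v : Fin d → ℤ) (hv : v ∈ U)
    (h : ∀ y ∈ fac r Δ m x, (r:ℝ) * (coeLat v ⬝ᵥ y) - coeLat v ⬝ᵥ coeLat m + 1 = 0) : v = x.1 ∨ v = x.2 := by
  obtain ⟨h1, h2, h12⟩ := Finset.mem_offDiag.1 hx
  obtain ⟨z, hz, hzf, hk⟩ := H.key _ (H.fac_face x h1 h2 hne hdim)
  have e1 := hk x.1 h1 fun y hy => hy.2.1
  have e2 := hk x.2 h2 fun y hy => hy.2.2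
  have e3 := hk v hv h
  rcases e1 with e1 | e1 <;> rcases e2 with e2 | e2 <;> rcases e3 with e3 | e3 <;>
    simp_all

lemma Ctx.dual (H : Ctx d r U V Δ m) (P : Set (Fin d → ℝ))
    (hP : P = (fun x => (r : ℝ) • x - coeLat m) '' Δ)
    (hQ : polarDual P = convexHull ℝ (coeLat '' (U : Set (Fin d → ℤ))))
    (x : (Fin d → ℤ) × (Fin d → ℤ)) (hx : x ∈ U.offDiag)
    (hne : (fac r Δ m x).Nonempty) (hdim : dimSet (fac r Δ m x) = r) :
    dualFace P ((fun x => (r : ℝ) • x - coeLat m) '' fac r Δ m x) = segment ℝ (coeLat x.1) (coeLat x.2) := by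
  classical
  obtain ⟨h1, h2, h12⟩ := Finset.mem_offDiag.1 hx
  have hdot : ∀ (v : Fin d → ℤ) (y : Fin d → ℝ), coeLat v ⬝ᵥ ((r:ℝ) • y - coeLat m) =
      (r:ℝ) * (coeLat v ⬝ᵥ y) - coeLat v ⬝ᵥ coeLat m := by
    intro v y
    rw [dotProduct_sub, dotProduct_smul, smul_eq_mul]
  have h := face_hull U ((fun x => (r : ℝ) • x - coeLat m) '' fac r Δ m x) (fun _ => -1) {x.1, x.2} (by
    intro v
    rw [Finset.mem_insert, Finset.mem_singleton]
    constructor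
    · rintro (rfl | rfl)
      · refine ⟨h1, ?_⟩
        rintro _ ⟨y, hy, rfl⟩
        dsimp only
        rw [hdot]; linarith [hy.2.1]
      · refine ⟨h2, ?_⟩
        rintro _ ⟨y, hy, rfl⟩
        dsimp only
        rw [hdot]; linarith [hy.2.2]
    · rintro ⟨hv, hvt⟩
      apply H.good x hx hne hdim v hv
      intro y hy
      have := hvt _ ⟨y, hy, rfl⟩
      dsimp only at this
      rw [hdot] at this; linarith) (by
    rintro v hv _ ⟨y, hy, rfl⟩
    dsimp only
    rw [hdot]
    have := (H.hmem y).1 hy.1 v hv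
    linarith)
  rw [Finset.coe_insert, Finset.coe_singleton, Set.image_insert_eq, Set.image_singleton, convexHull_pair] at h
  rw [← h, ← hQ]
  rfl

lemma Ctx.fiber (H : Ctx d r U V Δ m) (G : Finset ((Fin d → ℤ) × (Fin d → ℤ)))
    (hG : ∀ x, x ∈ G ↔ x ∈ U.offDiag ∧ (fac r Δ m x).Nonempty ∧ dimSet (fac r Δ m x) = r)
    (F : Set (Fin d → ℝ) → ℝ) :
    ∑ x ∈ G, F (fac r Δ m x) = 2 * ∑ᶠ θ ∈ {θ | IsFaceOfDim Δ r θ}, F θ := by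
  classical
  have hset : {θ | IsFaceOfDim Δ r θ} = ((G.image (fac r Δ m) : Finset (Set (Fin d → ℝ))) : Set (Set (Fin d → ℝ))) := by
    ext θ
    rw [Finset.mem_coe, Finset.mem_image]
    constructor
    · intro hθ
      obtain ⟨x, hx, hxθ, -⟩ := H.key θ hθ
      exact ⟨x, (hG x).2 ⟨hx, by rw [hxθ]; exact hθ.2.1, by rw [hxθ]; exact hθ.2.2⟩, hxθ⟩
    · rintro ⟨x, hx, rfl⟩
      obtain ⟨h1, h2, h3⟩ := (hG x).1 hx
      obtain ⟨h4, h5, -⟩ := Finset.mem_offDiag.1 h1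
      exact H.fac_face x h4 h5 h2 h3
  rw [hset, finsum_mem_coe_finset, Finset.sum_comp, Finset.mul_sum]
  apply Finset.sum_congr rfl
  intro θ hθ
  obtain ⟨x, hx, rfl⟩ := Finset.mem_image.1 hθ
  have hf : (G.filter fun a => fac r Δ m a = fac r Δ m x) = {x, x.swap} := by
    obtain ⟨h1, h2, h3⟩ := (hG x).1 hx
    obtain ⟨h4, h5, h6⟩ := Finset.mem_offDiag.1 h1
    have hsw : fac r Δ m x.swap = fac r Δ m x := by
      ext y
      constructor
      · rintro ⟨a, b, c⟩; exact ⟨a, c, b⟩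
      · rintro ⟨a, b, c⟩; exact ⟨a, c, b⟩
    ext a
    rw [Finset.mem_filter, Finset.mem_insert, Finset.mem_singleton]
    constructor
    · rintro ⟨ha, hax⟩
      obtain ⟨b4, b5, b6⟩ := Finset.mem_offDiag.1 ((hG a).1 ha).1
      have c1 := H.good x h1 h2 h3 a.1 b4 fun y hy => by rw [← hax] at hy; exact hy.2.1
      have c2 := H.good x h1 h2 h3 a.2 b5 fun y hy => by rw [← hax] at hy; exact hy.2.2
      rcases c1 with c1 | c1 <;> rcases c2 with c2 | c2
      · exact absurd (c1.trans c2.symm) b6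
      · exact Or.inl (Prod.ext c1 c2)
      · exact Or.inr (Prod.ext c1 c2)
      · exact absurd (c1.trans c2.symm) b6
    · rintro (rfl | rfl)
      · exact ⟨hx, rfl⟩
      · refine ⟨(hG _).2 ⟨Finset.mem_offDiag.2 ⟨h5, h4, h6.symm⟩, ?_, ?_⟩, hsw⟩
        · rw [hsw]; exact h2
        · rw [hsw]; exact h3
  rw [hf, Finset.card_pair, nsmul_eq_mul]
  · norm_num
  · intro h
    obtain ⟨h4, h5, h6⟩ := Finset.mem_offDiag.1 ((hG x).1 hx).1
    exact h6 (congrArg Prod.fst h)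

lemma Ctx.final (H : Ctx d r U V Δ m) (P : Set (Fin d → ℝ))
    (hP : P = (fun x => (r : ℝ) • x - coeLat m) '' Δ)
    (hQ : polarDual P = convexHull ℝ (coeLat '' (U : Set (Fin d → ℤ)))) (e : ℕ → ℝ)
    (he : ∀ k : ℕ, e k = ((latticePoints ((k:ℝ) • Δ)).ncard : ℝ)) (c σ : ℝ)
    (hc : Tendsto (fun K : ℕ => (e (r*(2*K)) + e (r*(2*K+1)) - 2^(d+1) * e (r*K)) / (K:ℝ)^r) atTop (nhds c))
    (hσ : Tendsto (fun K : ℕ => (e (r*(K+1)) - e (r*K)) / (K:ℝ)^(r+1)) atTop (nhds σ)) :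
    c = 2^d / 8 * ((r+1) * σ - (r:ℝ)^r / r.factorial *
      ∑ᶠ θ ∈ {θ | IsFaceOfDim Δ r θ}, normVol r θ * normVol 1 (dualFace P ((fun x => (r : ℝ) • x - coeLat m) '' θ))) := by
  classical
  obtain ⟨W, hW⟩ := H.wd
  have hr : 0 < r := H.hr
  have hrR : (0:ℝ) < r := by exact_mod_cast hr
  have hlim : ∀ (x : (Fin d → ℤ) × (Fin d → ℤ)) (p : ℕ) (L : ℝ), x.1 ∈ U →
      Tendsto (fun k : ℕ => ((latticePoints ((k:ℝ) • fac r Δ m x)).ncard : ℝ) / (k:ℝ)^p) atTop (nhds L) →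
      Tendsto (fun K : ℕ => ((W.Fac x K).ncard : ℝ) / (K:ℝ)^p) atTop (nhds ((r:ℝ)^p * L)) := by
    intro x p L hx hL
    have hcomp : Tendsto (fun K : ℕ => r * K) atTop atTop :=
      Filter.tendsto_id.const_mul_atTop' hr
    have h1 := (hL.comp hcomp).const_mul ((r:ℝ)^p)
    refine h1.congr' ?_
    filter_upwards [eventually_ge_atTop 1] with K hK
    have hK0 : (K:ℝ) ≠ 0 := by positivity
    rw [H.count_fac W hW K hK x hx]
    simp only [Function.comp]
    have : ((r * K : ℕ) : ℝ)^p = (r:ℝ)^p * (K:ℝ)^p := by push_cast; rw [mul_pow]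
    rw [this]
    field_simp
  have hβ : ∀ a : Fin d → ℤ, ∃ L : ℝ, a ∈ U → Tendsto (fun K : ℕ => ((W.Fac (a, a) K).ncard : ℝ) / (K:ℝ)^(r+1)) atTop (nhds L) := by
    intro a
    by_cases ha : a ∈ U
    · obtain ⟨L, hL, -⟩ := H.fac_limit (a, a) ha ha (r+1) (fun _ => H.dim_facet ha)
      exact ⟨_, fun _ => hlim (a, a) _ L ha hL⟩
    · exact ⟨0, fun h => absurd h ha⟩
  choose β hβ using hβ
  have hτ : ∀ x : (Fin d → ℤ) × (Fin d → ℤ), ∃ L : ℝ, x ∈ U.offDiag →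
      Tendsto (fun k : ℕ => ((latticePoints ((k:ℝ) • fac r Δ m x)).ncard : ℝ) / (k:ℝ)^r) atTop (nhds L) ∧
      (¬ ((fac r Δ m x).Nonempty ∧ dimSet (fac r Δ m x) = r) → L = 0) := by
    intro x
    by_cases hx : x ∈ U.offDiag
    · obtain ⟨h1, h2, h12⟩ := Finset.mem_offDiag.1 hx
      obtain ⟨L, hL⟩ := H.fac_limit x h1 h2 r (H.dim_ridge x hx)
      exact ⟨L, fun _ => hL⟩
    · exact ⟨0, fun h => absurd h hx⟩
  choose τ hτ using hτ
  have hl : ∀ x : (Fin d → ℤ) × (Fin d → ℤ), ∃ (l : ℤ) (ν b : Fin d → ℤ), x ∈ U.offDiag →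
      x.1 - x.2 = l • ν ∧ 0 < l ∧ ν ⬝ᵥ b = 1 := by
    intro x
    by_cases hx : x ∈ U.offDiag
    · obtain ⟨h1, h2, h12⟩ := Finset.mem_offDiag.1 hx
      obtain ⟨l, ν, b, h⟩ := prim_decomp (x.1 - x.2) (sub_ne_zero.2 h12)
      exact ⟨l, ν, b, fun _ => h⟩
    · exact ⟨0, 0, 0, fun h => absurd h hx⟩
  choose l ν b hl using hl
  have HH : W.Hyp r β (fun x => (r:ℝ)^r * τ x) l ν b := by
    constructor
    · exact H.hd
    · rw [hW]; intro a ha b hb hab; exact H.ind ha hb hab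
    · rw [hW]; exact H.h3
    · rw [hW]; exact hβ
    · rw [hW]; intro x hx
      exact hlim x r _ (Finset.mem_offDiag.1 hx).1 (hτ x hx).1
    · rw [hW]; intro x hx; exact (hl x hx).1
    · rw [hW]; intro x hx; exact (hl x hx).2.1.le
    · rw [hW]; intro x hx; exact (hl x hx).2.2
    · rw [hW]; exact H.prim
  have hE : ∀ K : ℕ, e (r * K) = (({z | W.g z ≤ K} : Set (Fin d → ℤ)).ncard : ℝ) := by
    intro K
    rw [he, H.count W hW K]
  have hmain := WD.main HH (fun K => e (r * K)) hE hc hσ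
  rw [hmain, hW]
  congr 2
  let G := U.offDiag.filter fun x => (fac r Δ m x).Nonempty ∧ dimSet (fac r Δ m x) = r
  have hG : ∀ x, x ∈ G ↔ x ∈ U.offDiag ∧ (fac r Δ m x).Nonempty ∧ dimSet (fac r Δ m x) = r := by
    intro x; simp only [G, Finset.mem_filter]
  have h1 : ∑ x ∈ U.offDiag, (l x : ℝ) * ((r:ℝ)^r * τ x) = ∑ x ∈ G, (l x : ℝ) * ((r:ℝ)^r * τ x) := by
    symm
    apply Finset.sum_filter_of_ne
    intro x hx hne
    by_contra hcon
    rw [(hτ x hx).2 hcon] at hne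
    simp at hne
  have hfib := H.fiber G hG fun θ => normVol r θ * normVol 1 (dualFace P ((fun x => (r : ℝ) • x - coeLat m) '' θ))
  have h2 : ∑ x ∈ G, (l x : ℝ) * ((r:ℝ)^r * τ x) = (r:ℝ)^r / r.factorial * ∑ x ∈ G,
      normVol r (fac r Δ m x) * normVol 1 (dualFace P ((fun x => (r : ℝ) • x - coeLat m) '' fac r Δ m x)) := by
    rw [Finset.mul_sum]
    apply Finset.sum_congr rfl
    intro x hx
    obtain ⟨g1, g2, g3⟩ := (hG x).1 hx
    have hf : (r.factorial:ℝ) ≠ 0 := by positivity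
    rw [H.dual P hP hQ x g1 g2 g3, normVol_segment x.1 x.2 (ν x) (b x) (l x) (hl x g1).2.1 (hl x g1).1 (hl x g1).2.2,
      normVol_eq_of_tendsto r _ _ (hτ x g1).1]
    field_simp
  rw [h1, h2, hfib]
  ring

end partD

lemma mk_ctx {d r : ℕ} (hr : 1 ≤ r) (hd : d = r + 2) (V : Finset (Fin d → ℤ)) (Δ : Set (Fin d → ℝ))
    (hΔ : Δ = convexHull ℝ (coeLat '' (V : Set (Fin d → ℤ)))) (m : Fin d → ℤ) (P : Set (Fin d → ℝ))
    (hP : P = (fun x => (r : ℝ) • x - coeLat m) '' Δ) (hPr : IsReflexive P) :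
    ∃ U : Finset (Fin d → ℤ), Ctx d r U V Δ m ∧
      polarDual P = convexHull ℝ (coeLat '' (U : Set (Fin d → ℤ))) := by
  have hr' : (0:ℝ) < r := by exact_mod_cast hr
  obtain ⟨U, hQU, hUext, hU, hUS⟩ := reflexive_data (by omega) hPr
  have h0P : (0 : Fin d → ℝ) ∈ P := interior_subset hPr.2.1
  have hV : V.Nonempty := by
    rw [hP, hΔ] at h0P
    obtain ⟨x, hx, -⟩ := h0P
    have := convexHull_nonempty_iff.1 ⟨x, hx⟩
    simpa using this
  have hUne : U.Nonempty := by
    have : (0 : Fin d → ℝ) ∈ polarDual P := by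
      rw [mem_polar_iff]; intro x _; simp
    rw [hQU] at this
    have := convexHull_nonempty_iff.1 ⟨_, this⟩
    simpa using this
  have hPS : P = convexHull ℝ ((fun x => (r : ℝ) • x - coeLat m) '' (coeLat '' (V : Set (Fin d → ℤ)))) := by
    rw [hP, hΔ, affine_image_hull]
  have hbd : Bornology.IsBounded P := (lp_compact hPr.1).isBounded
  refine ⟨U, ⟨hr, hd, hΔ, hV, hUne, ?_, fun y hy => no_recession hbd hU y hy, ?_, ?_, ?_⟩, hQU⟩
  · intro y
    have h1 : y ∈ Δ ↔ (r:ℝ) • y - coeLat m ∈ P := by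
      rw [hP]
      constructor
      · intro h; exact ⟨y, h, rfl⟩
      · rintro ⟨z, hz, hzy⟩
        have : (r:ℝ) • z = (r:ℝ) • y := by
          have := congrArg (· + coeLat m) hzy
          simpa using this
        have := smul_right_injective _ hr'.ne' this
        rwa [← this]
    rw [h1, hU]
    apply forall₂_congr
    intro u hu
    rw [dotProduct_sub, dotProduct_smul, smul_eq_mul]
    constructor <;> intro h <;> linarith
  · obtain ⟨C, hC⟩ := hbd.exists_norm_le
    refine ⟨⌈C⌉₊, fun y hy i => ?_⟩
    have := hC y ((hU y).2 hy)
    exact (norm_le_pi_norm y i).trans (this.trans (Nat.le_ceil C))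
  · intro u hu
    obtain ⟨x, ⟨_, ⟨v, hv, rfl⟩, rfl⟩, hx⟩ := hUS _ ((V.finite_toSet.image _).image _) hPS u hu
    refine ⟨m - (r:ℤ) • v, ?_⟩
    simp only at hx
    rw [dotProduct_sub, dotProduct_smul, coe_dot, coe_dot, smul_eq_mul] at hx
    have : (r : ℤ) * (u ⬝ᵥ v) - u ⬝ᵥ m = -1 := by exact_mod_cast hx
    rw [dotProduct_sub, dotProduct_smul, smul_eq_mul]
    linarith
  · intro a ha b hb c hc
    exact ext_ind (hUext a ha) (hUext b hb) (hUext c hc)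

theorem gorenstein_index_d_sub_two_24 (d : ℕ) (hd : 3 ≤ d) (r : ℕ) (hr : r = d - 2)
    (Δ : Set (Fin d → ℝ)) (hΔ : IsLatticePolytope Δ) (hdim : dimSet Δ = d)
    (m : Fin d → ℤ) (P : Set (Fin d → ℝ))
    (hP : P = (fun x => (r : ℝ) • x - coeLat m) '' Δ)
    (hPrefl : IsReflexive P) :
    (24 : ℝ) =
      (∑ᶠ θ ∈ {θ : Set (Fin d → ℝ) | IsFaceOfDim Δ r θ},
          normVol r θ *
            normVol (d - 1 - r) (dualFace P ((fun x => (r : ℝ) • x - coeLat m) '' θ))) +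
        ((r : ℝ) * (1 - (r : ℝ)) / 2) * normVol d Δ := by
  have hd2 : d = r + 2 := by omega
  have hr1 : 1 ≤ r := by omega
  obtain ⟨V, hV⟩ := hΔ
  obtain ⟨U, H, hQ⟩ := mk_ctx hr1 hd2 V Δ hV m P hP hPrefl
  obtain ⟨h, hh0, hh2, hh3, hh4, hE⟩ := gorenstein_ehrhart r hr1 hd2 V Δ hV hdim m P hP hPrefl
  have hdr : d - 1 - r = 1 := by omega
  rw [hdr]
  -- volume
  have hvol : normVol d Δ = 2 + 2 * (h 1 : ℝ) := by
    have h1 := ehrhart_limit d 3 h hh4 _ hE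
    rw [normVol_eq_of_tendsto d Δ _ h1]
    simp only [Finset.sum_range_succ, Finset.sum_range_zero, hh0, hh2, hh3]
    have : (d.factorial:ℝ) ≠ 0 := by positivity
    field_simp
    push_cast
    ring
  rw [hvol]
  let e : ℕ → ℝ := fun k => ((latticePoints ((k:ℝ) • Δ)).ncard : ℝ)
  have he : ∀ k : ℕ, 3 ≤ k → ((r+2).factorial:ℝ) * e k = ∏ j ∈ Finset.range (r+2), ((k:ℝ) + (j+1)) +
      (h 1 : ℝ) * ∏ j ∈ Finset.range (r+2), ((k:ℝ) - 1 + (j+1)) + (h 1 : ℝ) * ∏ j ∈ Finset.range (r+2), ((k:ℝ) - 2 + (j+1)) +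
      ∏ j ∈ Finset.range (r+2), ((k:ℝ) - 3 + (j+1)) := by
    intro k hk
    have h1 := hE k
    rw [sum_antidiag_eq _ 3 h hh4 k hk] at h1
    simp only [Finset.sum_range_succ, Finset.sum_range_zero, hh0, hh2, hh3] at h1
    have h2 : e k = ((d+1).multichoose (k - 0) : ℝ) + h 1 * (d+1).multichoose (k-1) + h 1 * (d+1).multichoose (k-2)
        + (d+1).multichoose (k-3) := by
      simp only [e]
      rw [h1]; push_cast; ring
    have g0 := multichoose_prod d (k - 0)
    have g1 := multichoose_prod d (k - 1)
    have g2 := multichoose_prod d (k - 2)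
    have g3 := multichoose_prod d (k - 3)
    rw [Nat.cast_sub (by omega)] at g0 g1 g2 g3
    rw [← hd2, h2, mul_add, mul_add, mul_add, mul_left_comm, mul_left_comm (d.factorial:ℝ) (h 1 : ℝ), g0, g1, g2, g3]
    push_cast
    simp only [sub_zero]
  obtain ⟨c, σ, hc, hσ, hfin⟩ := final_algebra r hr1 (h 1) e he
  apply hfin
  rw [← hd2] at hc ⊢
  exact H.final P hP hQ e (fun _ => rfl) c σ hc hσ

end
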